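/- For every real number μ ≥ 7.1032054, there exist only finitely many pairs of integers (p,q) with q ≥ 1 such that |π − p/q| < 1/q^μ. (In other words, the irrationality measure of π is at most 7.103205334137… < 7.1032054.) -/

import Mathlib

section Tauberian

open Real Set Filter Topology MeasureTheory

/-- The Fejér kernel of width `l`. -/
noncomputable def fejerKernel (l w : ℝ) : ℝ := 2 * (1 - cos (l * w)) / (l * w ^ 2)

theorem fejerKernel_nonneg {l : ℝ} (hl : 0 < l) (w : ℝ) : 0 ≤ fejerKernel l w := by
  have := cos_le_one (l * w)
  unfold fejerKernel
  exact div_nonneg (by linarith) (by positivity)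

theorem fejerKernel_le {l : ℝ} (hl : 0 < l) (w : ℝ) : fejerKernel l w ≤ l := by
  unfold fejerKernel
  refine div_le_of_le_mul₀ (by positivity) hl.le ?_
  nlinarith [one_sub_sq_div_two_le_cos (x := l * w)]

theorem fejerKernel_le_tail {l : ℝ} (hl : 0 < l) (w : ℝ) :
    fejerKernel l w ≤ 4 / l * (w ^ 2)⁻¹ := by
  rcases eq_or_ne w 0 with rfl | hw
  · simp [fejerKernel]
  have : 4 / l * (w ^ 2)⁻¹ = 4 / (l * w ^ 2) := by field_simp
  rw [this, fejerKernel]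
  exact div_le_div_of_nonneg_right (by linarith [neg_one_le_cos (l * w)]) (by positivity)

theorem measurable_fejerKernel (l : ℝ) : Measurable (fejerKernel l) := by
  unfold fejerKernel
  fun_prop

theorem integrable_fejerKernel {l : ℝ} (hl : 0 < l) : Integrable (fejerKernel l) := by
  refine (integrable_inv_one_add_sq.const_mul (l + 4 / l)).mono'
    (measurable_fejerKernel l).aestronglyMeasurable (ae_of_all _ fun w ↦ ?_)
  rw [norm_of_nonneg (fejerKernel_nonneg hl w), ← div_eq_mul_inv, le_div_iff₀ (by positivity)]
  have h1 := fejerKernel_le hl w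
  have h2 : fejerKernel l w * w ^ 2 ≤ 4 / l := by
    rcases eq_or_ne w 0 with rfl | hw
    · simp; positivity
    · have := fejerKernel_le_tail hl w
      rwa [← div_eq_mul_inv, le_div_iff₀ (by positivity)] at this
  linarith

theorem le_fejerKernel {l : ℝ} (hl : 0 < l) {w : ℝ} (hw : w ≠ 0) (hlw : |w| ≤ 1 / l) :
    l / 2 ≤ fejerKernel l w := by
  have h1 : |l * w| ≤ 1 := by
    rw [abs_mul, abs_of_pos hl]
    rw [le_div_iff₀ hl] at hlw
    linarith
  have h2 := (abs_le.mp (cos_bound h1)).2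
  have h3 : |l * w| ^ 4 ≤ (l * w) ^ 2 := by
    rw [← sq_abs (l * w)]
    exact pow_le_pow_of_le_one (abs_nonneg _) h1 (by norm_num)
  unfold fejerKernel
  rw [le_div_iff₀ (by positivity)]
  have : l / 2 * (l * w ^ 2) = (l * w) ^ 2 / 2 := by ring
  nlinarith [sq_nonneg (l * w)]

theorem integral_triangle_mul_exp {l : ℝ} (hl : 0 < l) {w : ℝ} (hw : w ≠ 0) :
    ∫ t in (-l)..l, ((1 - |t| / l : ℝ) : ℂ) * Complex.exp (Complex.I * t * w) =
      fejerKernel l w := by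
  have hw' : (w : ℂ) ≠ 0 := by exact_mod_cast hw
  have hl' : (l : ℂ) ≠ 0 := by exact_mod_cast hl.ne'
  have key (σ : ℂ) (hσ : σ ≠ 0) (a b : ℝ) :
      ∫ t in a..b, (1 - σ * t / l) * Complex.exp (Complex.I * t * w) =
      (fun t : ℝ ↦ ((1 - σ * t / l) / (Complex.I * w) - σ / (l * w ^ 2)) *
        Complex.exp (Complex.I * t * w)) b -
      (fun t : ℝ ↦ ((1 - σ * t / l) / (Complex.I * w) - σ / (l * w ^ 2)) *
        Complex.exp (Complex.I * t * w)) a := by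
    refine intervalIntegral.integral_eq_sub_of_hasDerivAt
      (f := fun t : ℝ ↦ ((1 - σ * t / l) / (Complex.I * w) - σ / (l * w ^ 2)) *
        Complex.exp (Complex.I * t * w)) (fun x _ ↦ ?_)
      (Continuous.intervalIntegrable (u := fun t : ℝ ↦ (1 - σ * t / l) *
        Complex.exp (Complex.I * t * w)) (by fun_prop) _ _)
    have h1 : HasDerivAt (fun t : ℝ ↦ Complex.exp (Complex.I * t * w))
        (Complex.exp (Complex.I * x * w) * (Complex.I * w)) x := by
      have : HasDerivAt (fun t : ℝ ↦ Complex.I * t * w) (Complex.I * w) x := by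
        simpa using ((Complex.ofRealCLM.hasDerivAt (x := x)).const_mul Complex.I).mul_const (w : ℂ)
      exact this.cexp
    have h2 : HasDerivAt (fun t : ℝ ↦ (1 - σ * t / l) / (Complex.I * w) - σ / (l * w ^ 2))
        ((-(σ / l)) / (Complex.I * w)) x := by
      have : HasDerivAt (fun t : ℝ ↦ σ * t / l) (σ / l) x := by
        simpa using ((Complex.ofRealCLM.hasDerivAt (x := x)).const_mul σ).div_const (l : ℂ)
      exact ((this.const_sub 1).div_const _).sub_const _
    convert! h2.mul h1 using 1
    field_simp
    ring_nf
    simp only [Complex.I_sq]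
    ring
  have hint : ∀ a b : ℝ, IntervalIntegrable
      (fun t : ℝ ↦ ((1 - |t| / l : ℝ) : ℂ) * Complex.exp (Complex.I * t * w)) volume a b :=
    fun a b ↦ Continuous.intervalIntegrable (by fun_prop) _ _
  rw [← intervalIntegral.integral_add_adjacent_intervals (hint (-l) 0) (hint 0 l)]
  have e1 : ∫ t in (-l)..0, ((1 - |t| / l : ℝ) : ℂ) * Complex.exp (Complex.I * t * w) =
      ∫ t in (-l)..0, (1 - (-1) * t / l) * Complex.exp (Complex.I * t * w) := by
    refine intervalIntegral.integral_congr fun t ht ↦ ?_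
    rw [uIcc_of_le (by linarith)] at ht
    simp only [abs_of_nonpos ht.2]
    push_cast
    ring
  have e2 : ∫ t in (0 : ℝ)..l, ((1 - |t| / l : ℝ) : ℂ) * Complex.exp (Complex.I * t * w) =
      ∫ t in (0 : ℝ)..l, (1 - 1 * t / l) * Complex.exp (Complex.I * t * w) := by
    refine intervalIntegral.integral_congr fun t ht ↦ ?_
    rw [uIcc_of_le hl.le] at ht
    simp only [abs_of_nonneg ht.1]
    push_cast
    ring
  rw [e1, e2, key _ (by norm_num), key _ (by norm_num)]
  unfold fejerKernel
  push_cast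
  rw [Complex.cos]
  have e3 : Complex.exp (Complex.I * -l * w) = Complex.exp (-(l * w) * Complex.I) := by ring_nf
  have e4 : Complex.exp (Complex.I * l * w) = Complex.exp (l * w * Complex.I) := by ring_nf
  simp only [e3, e4]
  field_simp
  simp
  ring

/-- Pairing with the Fejér kernel in terms of boundary values of the Laplace transform. -/
theorem integral_mul_fejerKernel {b : ℝ → ℝ} (hb : Measurable b) {C : ℝ} (hC : ∀ u, |b u| ≤ C)
    {G : ℂ → ℂ} (hG : ContinuousOn G {s | 0 ≤ s.re})
    (hL : ∀ s : ℂ, 0 < s.re → ∫ u in Ioi (0 : ℝ), (b u : ℂ) * Complex.exp (-s * u) = G s)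
    {l : ℝ} (hl : 0 < l) (y : ℝ) :
    ∫ t in (-l)..l, ((1 - |t| / l : ℝ) : ℂ) * Complex.exp (Complex.I * t * y) * G (Complex.I * t) =
      ((∫ u in Ioi (0 : ℝ), b u * fejerKernel l (y - u) : ℝ) : ℂ) := by
  have hC0 : 0 ≤ C := (abs_nonneg _).trans (hC 0)
  have step (ε : ℝ) (hε : 0 < ε) :
      ∫ t in (-l)..l, ((1 - |t| / l : ℝ) : ℂ) * Complex.exp (Complex.I * t * y) *
        G (ε + Complex.I * t) =
      ∫ u in Ioi (0 : ℝ), (b u : ℂ) * Complex.exp (-ε * u) * (fejerKernel l (y - u) : ℂ) := by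
    have h1 : ∀ t : ℝ, G (ε + Complex.I * t) =
        ∫ u in Ioi (0 : ℝ), (b u : ℂ) * Complex.exp (-(ε + Complex.I * t) * u) := fun t ↦
      (hL _ (by simpa using hε)).symm
    simp_rw [h1, ← integral_const_mul]
    have hφ : Integrable (fun t : ℝ ↦ ((1 - |t| / l : ℝ) : ℂ) * Complex.exp (Complex.I * t * y))
        (volume.restrict (Ioc (-l) l)) :=
      (Continuous.integrableOn_Icc (by fun_prop)).mono_set Ioc_subset_Icc_self
    have hbe : Integrable (fun u : ℝ ↦ (b u : ℂ) * Complex.exp (-ε * u))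
        (volume.restrict (Ioi (0 : ℝ))) := by
      refine (integrableOn_exp_mul_complex_Ioi (a := -ε) (by simpa using hε) 0).bdd_mul
        (c := C) (by fun_prop) (ae_of_all _ fun u ↦ ?_)
      simpa using hC u
    have hprod := (hφ.mul_prod hbe).bdd_mul (c := 1)
      (f := fun z : ℝ × ℝ ↦ Complex.exp (-(Complex.I * z.1 * z.2)))
      (Continuous.aestronglyMeasurable (by fun_prop)) (ae_of_all _ fun z ↦ by
        rw [Complex.norm_exp]; simp)
    rw [intervalIntegral.integral_of_le (by linarith), integral_integral_swap]
    · refine integral_congr_ae ?_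
      have hne : ∀ᵐ u ∂(volume.restrict (Ioi (0 : ℝ))), u ≠ y :=
        ae_restrict_of_ae (Measure.ae_ne volume y)
      filter_upwards [hne] with u hu
      rw [← integral_triangle_mul_exp hl (sub_ne_zero.mpr hu.symm), ←
        intervalIntegral.integral_of_le (by linarith), ← intervalIntegral.integral_const_mul]
      refine intervalIntegral.integral_congr fun t _ ↦ ?_
      have : Complex.exp (Complex.I * t * y) * Complex.exp (-(ε + Complex.I * t) * u) =
          Complex.exp (-ε * u) * Complex.exp (Complex.I * t * ((y - u : ℝ) : ℂ)) := by
        rw [← Complex.exp_add, ← Complex.exp_add]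
        push_cast
        ring_nf
      linear_combination ((1 - |t| / l : ℝ) : ℂ) * b u * this
    · convert! hprod using 1
      ext z
      have : Complex.exp (-(ε + Complex.I * z.1) * z.2) =
          Complex.exp (-ε * z.2) * Complex.exp (-(Complex.I * z.1 * z.2)) := by
        rw [← Complex.exp_add]
        ring_nf
      simp only [Function.uncurry, this]
      ring
  have hlimL : Tendsto (fun n : ℕ ↦ ∫ t in (-l)..l,
      ((1 - |t| / l : ℝ) : ℂ) * Complex.exp (Complex.I * t * y) *
        G ((1 / ((n : ℝ) + 1) : ℝ) + Complex.I * t)) atTop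
      (𝓝 (∫ t in (-l)..l,
        ((1 - |t| / l : ℝ) : ℂ) * Complex.exp (Complex.I * t * y) * G (Complex.I * t))) := by
    have hcomp : IsCompact ((fun z : ℝ × ℝ ↦ (z.1 : ℂ) + Complex.I * z.2) ''
        (Icc 0 1 ×ˢ Icc (-l) l)) :=
      (isCompact_Icc.prod isCompact_Icc).image (by fun_prop)
    obtain ⟨B, hB⟩ := hcomp.exists_bound_of_continuousOn (hG.mono (by
      rintro _ ⟨z, hz, rfl⟩
      simpa using hz.1.1))
    refine intervalIntegral.tendsto_integral_filter_of_dominated_convergence (fun _ ↦ B)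
      (Eventually.of_forall fun n ↦ ?_) (Eventually.of_forall fun n ↦ ?_) (by simp) ?_
    · refine ContinuousOn.aestronglyMeasurable ?_ measurableSet_uIoc
      refine (Continuous.continuousOn (by fun_prop)).mul (hG.comp (by fun_prop) fun t _ ↦ ?_)
      have : 0 ≤ 1 / ((n : ℝ) + 1) := by positivity
      rw [mem_ofPred_eq, Complex.add_re, Complex.ofReal_re]
      simpa using this
    · refine ae_of_all _ fun t ht ↦ ?_
      rw [uIoc_of_le (by linarith)] at ht
      have hn : 1 / ((n : ℝ) + 1) ≤ 1 := by
        rw [div_le_one (by positivity)]; linarith [n.cast_nonneg (α := ℝ)]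
      have h1 := hB _ ⟨(1 / ((n : ℝ) + 1), t), ⟨⟨by positivity, hn⟩, ht.1.le, ht.2⟩, rfl⟩
      have h2 : ‖((1 - |t| / l : ℝ) : ℂ)‖ ≤ 1 := by
        rw [Complex.norm_real, norm_eq_abs, abs_le]
        have : |t| / l ≤ 1 := by rw [div_le_one hl, abs_le]; exact ⟨ht.1.le, ht.2⟩
        have : 0 ≤ |t| / l := by positivity
        constructor <;> linarith
      have h3 : ‖Complex.exp (Complex.I * t * y)‖ = 1 := by rw [Complex.norm_exp]; simp
      rw [norm_mul, norm_mul, h3, mul_one]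
      calc _ ≤ 1 * B := by gcongr
        _ = B := one_mul B
    · refine ae_of_all _ fun t _ ↦ Tendsto.const_mul _ ?_
      have h0 : ContinuousWithinAt G {s | 0 ≤ s.re} (Complex.I * t) := hG _ (by simp)
      refine h0.tendsto.comp (tendsto_nhdsWithin_iff.mpr ⟨?_, Eventually.of_forall fun n ↦ ?_⟩)
      · have := (Complex.continuous_ofReal.tendsto 0).comp
          (tendsto_one_div_add_atTop_nhds_zero_nat (𝕜 := ℝ))
        simpa using this.add_const (Complex.I * t)
      · have : 0 ≤ 1 / ((n : ℝ) + 1) := by positivity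
        rw [mem_ofPred_eq, Complex.add_re, Complex.ofReal_re]
        simpa using this
  have hlimR : Tendsto (fun n : ℕ ↦ ∫ u in Ioi (0 : ℝ), (b u : ℂ) *
      Complex.exp (-((1 / ((n : ℝ) + 1) : ℝ) : ℂ) * u) * (fejerKernel l (y - u) : ℂ)) atTop
      (𝓝 (∫ u in Ioi (0 : ℝ), (b u : ℂ) * (fejerKernel l (y - u) : ℂ))) := by
    have hk : Integrable (fun u ↦ fejerKernel l (y - u)) :=
      (integrable_fejerKernel hl).comp_sub_left y
    refine tendsto_integral_of_dominated_convergence (fun u ↦ C * fejerKernel l (y - u))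
      (fun n ↦ ?_) (hk.const_mul C).integrableOn (fun n ↦ ?_) ?_
    · have := measurable_fejerKernel l
      exact Measurable.aestronglyMeasurable (by fun_prop)
    · refine (ae_restrict_iff' measurableSet_Ioi).mpr (ae_of_all _ fun u hu ↦ ?_)
      have hu : 0 < u := hu
      rw [norm_mul, norm_mul, Complex.norm_real, Complex.norm_real,
        norm_of_nonneg (fejerKernel_nonneg hl _)]
      refine mul_le_mul_of_nonneg_right ?_ (fejerKernel_nonneg hl _)
      have : ‖Complex.exp (-((1 / ((n : ℝ) + 1) : ℝ) : ℂ) * u)‖ ≤ 1 := by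
        rw [Complex.norm_exp, exp_le_one_iff]
        rw [← Complex.ofReal_neg, ← Complex.ofReal_mul, Complex.ofReal_re]
        have : 0 ≤ 1 / ((n : ℝ) + 1) * u := by positivity
        linarith
      calc _ ≤ C * 1 := by gcongr; exact hC u
        _ = C := mul_one C
    · refine ae_of_all _ fun u ↦ ?_
      have h1 : Tendsto (fun n : ℕ ↦ Complex.exp (-((1 / ((n : ℝ) + 1) : ℝ) : ℂ) * u)) atTop
          (𝓝 1) := by
        have := (Complex.continuous_ofReal.tendsto 0).comp
          (tendsto_one_div_add_atTop_nhds_zero_nat (𝕜 := ℝ))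
        have := ((this.neg).mul_const (u : ℂ)).cexp
        simpa using this
      simpa using (h1.const_mul (b u : ℂ)).mul_const (fejerKernel l (y - u) : ℂ)
  have := tendsto_nhds_unique (hlimL.congr fun n ↦ step _ (by positivity)) hlimR
  rw [this, ← integral_complex_ofReal]
  simp

theorem tendsto_integral_mul_fejerKernel {b : ℝ → ℝ} (hb : Measurable b) {C : ℝ}
    (hC : ∀ u, |b u| ≤ C) {G : ℂ → ℂ} (hG : ContinuousOn G {s | 0 ≤ s.re})
    (hL : ∀ s : ℂ, 0 < s.re → ∫ u in Ioi (0 : ℝ), (b u : ℂ) * Complex.exp (-s * u) = G s)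
    {l : ℝ} (hl : 0 < l) :
    Tendsto (fun y ↦ ∫ u in Ioi (0 : ℝ), b u * fejerKernel l (y - u)) atTop (𝓝 0) := by
  have h := Real.tendsto_integral_exp_smul_cocompact (E := ℂ) ((Ioc (-l) l).indicator
    fun t ↦ ((1 - |t| / l : ℝ) : ℂ) * G (Complex.I * t))
  have h2 : Tendsto (fun y : ℝ ↦ -y / (2 * π)) atTop (cocompact ℝ) := by
    refine (Tendsto.atBot_div_const (by positivity) tendsto_neg_atTop_atBot).mono_right ?_
    exact atBot_le_cocompact
  have h3 := (h.comp h2)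
  suffices Tendsto (fun y ↦ ((∫ u in Ioi (0 : ℝ), b u * fejerKernel l (y - u) : ℝ) : ℂ)) atTop
      (𝓝 0) by
    simpa [Function.comp_def] using (Complex.continuous_re.tendsto 0).comp this
  refine h3.congr fun y ↦ ?_
  rw [← integral_mul_fejerKernel hb hC hG hL hl y]
  rw [intervalIntegral.integral_of_le (by linarith), ← integral_indicator measurableSet_Ioc]
  simp only [Function.comp]
  refine integral_congr_ae (ae_of_all _ fun t ↦ ?_)
  by_cases ht : t ∈ Ioc (-l) l
  · simp only [indicator_of_mem ht, Circle.smul_def, Real.fourierChar_apply, smul_eq_mul]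
    have : ((2 * π * -(t * (-y / (2 * π))) : ℝ) : ℂ) * Complex.I = Complex.I * t * y := by
      have : 2 * π * -(t * (-y / (2 * π))) = t * y := by field_simp
      rw [this]; push_cast; ring
    rw [this]
    ring
  · simp [indicator_of_notMem ht]

end Tauberian

section PrimeNumberTheorem

open Real Set Filter Topology MeasureTheory ArithmeticFunction

theorem eventually_exists_lt_of_tendsto_fejer {b : ℝ → ℝ} (hb : Measurable b) {C : ℝ}
    (hC : ∀ u, |b u| ≤ C)
    (hk : ∀ l : ℝ, 0 < l →
      Tendsto (fun y ↦ ∫ u in Ioi (0 : ℝ), b u * fejerKernel l (y - u)) atTop (𝓝 0))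
    {η δ : ℝ} (hη : 0 < η) (hδ : 0 < δ) :
    ∀ᶠ y in atTop, ∃ u ∈ Icc (y - δ) (y + δ), b u < η := by
  have hC0 : 0 ≤ C := (abs_nonneg _).trans (hC 0)
  set A : ℝ := C * 4 * (1 + 1 / δ ^ 2) * π with hA
  have hA0 : 0 ≤ A := by positivity
  set l : ℝ := 1 / δ + 2 * A / η + 1 with hl
  have hl0 : 0 < l := by positivity
  have hlδ : 1 / l ≤ δ := by
    rw [div_le_comm₀ hl0 hδ]
    have : 0 ≤ 2 * A / η := by positivity
    linarith
  have hlA : A / l < η / 2 := by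
    rw [div_lt_iff₀ hl0]
    have : η / 2 * l = η / 2 * (1 / δ) + A + η / 2 := by rw [hl]; field_simp
    have : 0 < η / 2 * (1 / δ) := by positivity
    linarith
  filter_upwards [(hk l hl0).eventually_lt_const (half_pos hη), eventually_gt_atTop δ] with y hy hyδ
  by_contra! hcon
  refine absurd hy (not_lt.mpr ?_)
  have hfi : Integrable (fun u ↦ b u * fejerKernel l (y - u)) :=
    ((integrable_fejerKernel hl0).comp_sub_left y).bdd_mul (c := C) hb.aestronglyMeasurable
      (ae_of_all _ hC)
  have hci : Integrable (fun u : ℝ ↦ (1 + (y - u) ^ 2)⁻¹) :=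
    integrable_inv_one_add_sq.comp_sub_left y
  have hii : Integrable ((Icc (y - 1 / l) (y + 1 / l)).indicator fun _ ↦ η * l / 2) :=
    (integrable_indicator_iff measurableSet_Icc).mpr (by simp)
  set B : ℝ := C * (4 / l) * (1 + 1 / δ ^ 2) with hB
  have hB0 : 0 ≤ B := by positivity
  have hle : ∫ u in Ioi (0 : ℝ), ((Icc (y - 1 / l) (y + 1 / l)).indicator (fun _ ↦ η * l / 2) u -
      B * (1 + (y - u) ^ 2)⁻¹) ≤ ∫ u in Ioi (0 : ℝ), b u * fejerKernel l (y - u) := by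
    refine setIntegral_mono_ae (hii.sub (hci.const_mul B)).integrableOn hfi.integrableOn ?_
    filter_upwards [Measure.ae_ne volume y] with u hu
    have hk0 := fejerKernel_nonneg hl0 (y - u)
    have hT : 0 ≤ B * (1 + (y - u) ^ 2)⁻¹ := by positivity
    by_cases h1 : u ∈ Icc (y - 1 / l) (y + 1 / l)
    · rw [indicator_of_mem h1]
      have h2 := le_fejerKernel hl0 (sub_ne_zero.mpr hu.symm)
        (abs_le.mpr ⟨by linarith [h1.2], by linarith [h1.1]⟩)
      have h3 := hcon u ⟨by linarith [h1.1], by linarith [h1.2]⟩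
      have := mul_le_mul h3 h2 (by positivity) (hη.le.trans h3)
      linarith
    rw [indicator_of_notMem h1]
    by_cases h4 : u ∈ Icc (y - δ) (y + δ)
    · have := mul_nonneg (hη.le.trans (hcon u h4)) hk0
      linarith
    have h5 : δ ^ 2 ≤ (y - u) ^ 2 := by
      rw [sq_le_sq, abs_of_pos hδ, le_abs]
      by_contra! h
      exact h4 ⟨by linarith, by linarith⟩
    have h6 : fejerKernel l (y - u) ≤ 4 / l * ((1 + 1 / δ ^ 2) * (1 + (y - u) ^ 2)⁻¹) := by
      refine (fejerKernel_le_tail hl0 _).trans ?_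
      gcongr
      have h7 : 0 < (y - u) ^ 2 := lt_of_lt_of_le (by positivity) h5
      rw [← div_eq_mul_inv, le_div_iff₀ (by positivity), inv_mul_le_iff₀ h7]
      have : 1 ≤ 1 / δ ^ 2 * (y - u) ^ 2 := by
        rw [div_mul_eq_mul_div, one_mul, one_le_div (by positivity)]; exact h5
      linarith
    have h8 : -(C * fejerKernel l (y - u)) ≤ b u * fejerKernel l (y - u) := by
      have := mul_le_mul_of_nonneg_right (abs_le.mp (hC u)).1 hk0
      linarith
    have h9 := mul_le_mul_of_nonneg_left h6 hC0
    have : B * (1 + (y - u) ^ 2)⁻¹ = C * (4 / l * ((1 + 1 / δ ^ 2) * (1 + (y - u) ^ 2)⁻¹)) := by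
      rw [hB]; ring
    linarith
  refine le_trans ?_ hle
  rw [integral_sub hii.integrableOn (hci.const_mul B).integrableOn, integral_const_mul]
  have e1 : ∫ u in Ioi (0 : ℝ), (Icc (y - 1 / l) (y + 1 / l)).indicator (fun _ ↦ η * l / 2) u
      = η := by
    rw [setIntegral_indicator measurableSet_Icc, inter_eq_self_of_subset_right]
    · rw [setIntegral_const, smul_eq_mul, measureReal_def, Real.volume_Icc,
        ENNReal.toReal_ofReal (by linarith [one_div_pos.mpr hl0])]
      field_simp
      ring
    · intro u hu
      have := hu.1
      exact mem_Ioi.mpr (by linarith)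
  have e2 : ∫ u in Ioi (0 : ℝ), (1 + (y - u) ^ 2)⁻¹ ≤ π := by
    have h := integral_sub_left_eq_self (fun x : ℝ ↦ (1 + x ^ 2)⁻¹) volume y
    rw [integral_univ_inv_one_add_sq] at h
    rw [← h]
    exact setIntegral_le_integral hci (ae_of_all _ fun u ↦ by positivity)
  rw [e1]
  have e3 := mul_le_mul_of_nonneg_left e2 hB0
  have e4 : B * π = A / l := by rw [hB, hA]; ring
  linarith

theorem integral_psi_exp {s : ℂ} (hs : 0 < s.re) :
    LSeries (fun n ↦ (Λ n : ℂ)) (1 + s) = (1 + s) *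
      ∫ u in Ioi (0 : ℝ), ((Chebyshev.psi (exp u) * exp (-u) : ℝ) : ℂ) * Complex.exp (-s * u) := by
  have hsum (t : ℝ) : ∑ k ∈ Finset.Icc 1 ⌊t⌋₊, Λ k = Chebyshev.psi t := rfl
  rw [LSeries_eq_mul_integral_of_nonneg (fun n ↦ Λ n) (r := 1) zero_le_one (by simpa using hs)
    ?_ (fun n ↦ vonMangoldt_nonneg)]
  · congr 1
    have := integral_comp_exp_Ioi (fun t : ℝ ↦ (∑ k ∈ Finset.Icc 1 ⌊t⌋₊, ((Λ k : ℝ) : ℂ)) *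
      (t : ℂ) ^ (-(1 + s + 1))) 0
    rw [exp_zero] at this
    rw [← this]
    refine integral_congr_ae (ae_of_all _ fun u ↦ ?_)
    simp only [← Complex.ofReal_sum, hsum, Complex.real_smul]
    rw [Complex.cpow_def_of_ne_zero (by exact_mod_cast (exp_pos u).ne'), ← Complex.ofReal_log
      (exp_pos u).le, log_exp]
    push_cast
    have : Complex.exp u * Complex.exp (u * -(1 + s + 1)) =
        Complex.exp (-u) * Complex.exp (-s * u) := by
      rw [← Complex.exp_add, ← Complex.exp_add]
      ring_nf
    linear_combination (Chebyshev.psi (exp u) : ℂ) * this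
  · refine Asymptotics.IsBigO.of_bound (Real.log 4 + 4) (Eventually.of_forall fun n ↦ ?_)
    have h := hsum n
    rw [Nat.floor_natCast] at h
    rw [h, norm_of_nonneg (Chebyshev.psi_nonneg _), norm_of_nonneg (by positivity), rpow_one]
    exact Chebyshev.psi_le_const_mul_self n.cast_nonneg

/-- Normalised error in the prime number theorem, in logarithmic scale. -/
noncomputable def psiError (u : ℝ) : ℝ := Chebyshev.psi (exp u) * exp (-u) - 1

theorem measurable_psiError : Measurable psiError := by
  have : Measurable Chebyshev.psi := Chebyshev.psi_mono.measurable
  unfold psiError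
  fun_prop

theorem abs_psiError_le (u : ℝ) : |psiError u| ≤ Real.log 4 + 5 := by
  have h1 : Chebyshev.psi (exp u) * exp (-u) ≤ Real.log 4 + 4 := by
    rw [exp_neg, ← div_eq_mul_inv, div_le_iff₀ (exp_pos u)]
    exact Chebyshev.psi_le_const_mul_self (exp_pos u).le
  have h2 : 0 ≤ Chebyshev.psi (exp u) * exp (-u) :=
    mul_nonneg (Chebyshev.psi_nonneg _) (exp_pos _).le
  have h3 : 0 ≤ Real.log 4 := log_nonneg (by norm_num)
  unfold psiError
  rw [abs_le]
  constructor <;> linarith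

theorem LSeries_vonMangoldt_eq_aux_add {s : ℂ} (hs : 1 < s.re) :
    LSeries (fun n ↦ (Λ n : ℂ)) s =
      vonMangoldt.LFunctionResidueClassAux (1 : ZMod 1) s + 1 / (s - 1) := by
  rw [vonMangoldt.eqOn_LFunctionResidueClassAux isUnit_one hs]
  have : vonMangoldt.residueClass (1 : ZMod 1) = fun n ↦ Λ n := by
    ext n
    simp [vonMangoldt.residueClass, indicator, Subsingleton.elim (n : ZMod 1) 1]
  simp [this]

theorem integral_psiError_mul_exp {s : ℂ} (hs : 0 < s.re) :
    ∫ u in Ioi (0 : ℝ), (psiError u : ℂ) * Complex.exp (-s * u) =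
      (vonMangoldt.LFunctionResidueClassAux (1 : ZMod 1) (1 + s) - 1) / (1 + s) := by
  have hs0 : s ≠ 0 := by rintro rfl; simp at hs
  have hs1 : 1 + s ≠ 0 := by
    intro h
    have := congrArg Complex.re h
    simp at this
    linarith
  have hexp : IntegrableOn (fun u : ℝ ↦ Complex.exp (-s * u)) (Ioi 0) :=
    integrableOn_exp_mul_complex_Ioi (by simpa using hs) 0
  have h1 : ∫ u in Ioi (0 : ℝ), (psiError u : ℂ) * Complex.exp (-s * u) =
      (∫ u in Ioi (0 : ℝ), ((Chebyshev.psi (exp u) * exp (-u) : ℝ) : ℂ) * Complex.exp (-s * u)) -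
        ∫ u in Ioi (0 : ℝ), Complex.exp (-s * u) := by
    rw [← integral_sub _ hexp]
    · refine integral_congr_ae (ae_of_all _ fun u ↦ ?_)
      simp only [psiError]
      push_cast
      ring
    · refine hexp.bdd_mul (c := Real.log 4 + 6) ?_ (ae_of_all _ fun u ↦ ?_)
      · have := measurable_psiError.add_const 1
        unfold psiError at this
        simp only [sub_add_cancel] at this
        exact (Complex.measurable_ofReal.comp this).aestronglyMeasurable
      · have h := abs_le.mp (abs_psiError_le u)
        unfold psiError at h
        rw [Complex.norm_real, norm_eq_abs, abs_le]
        constructor <;> linarith [h.1, h.2]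
  have h2 := integral_psi_exp hs
  rw [LSeries_vonMangoldt_eq_aux_add (by simpa using hs)] at h2
  rw [h1, integral_exp_mul_complex_Ioi (by simpa using hs) 0]
  have h3 : ∫ u in Ioi (0 : ℝ), ((Chebyshev.psi (exp u) * exp (-u) : ℝ) : ℂ) * Complex.exp (-s * u)
      = (vonMangoldt.LFunctionResidueClassAux (1 : ZMod 1) (1 + s) + 1 / (1 + s - 1)) / (1 + s) := by
    rw [h2]; field_simp
  rw [h3]
  simp
  field_simp
  ring

theorem eventually_exists_psiError_lt {η δ : ℝ} (hη : 0 < η) (hδ : 0 < δ) :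
    (∀ᶠ y in atTop, ∃ u ∈ Icc (y - δ) (y + δ), psiError u < η) ∧
      ∀ᶠ y in atTop, ∃ u ∈ Icc (y - δ) (y + δ), -η < psiError u := by
  have hG : ContinuousOn
      (fun s ↦ (vonMangoldt.LFunctionResidueClassAux (1 : ZMod 1) (1 + s) - 1) / (1 + s))
      {s | 0 ≤ s.re} := by
    refine ContinuousOn.div (ContinuousOn.sub ?_ continuousOn_const) (by fun_prop) fun s hs h ↦ ?_
    · exact (vonMangoldt.continuousOn_LFunctionResidueClassAux (1 : ZMod 1)).comp (by fun_prop)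
        fun s hs ↦ by simpa using hs
    · have h1 := congrArg Complex.re h
      have hs : 0 ≤ s.re := hs
      simp at h1
      linarith
  have hk : ∀ l : ℝ, 0 < l →
      Tendsto (fun y ↦ ∫ u in Ioi (0 : ℝ), psiError u * fejerKernel l (y - u)) atTop (𝓝 0) :=
    fun l hl ↦ tendsto_integral_mul_fejerKernel measurable_psiError abs_psiError_le hG
      (fun s hs ↦ integral_psiError_mul_exp hs) hl
  refine ⟨eventually_exists_lt_of_tendsto_fejer measurable_psiError abs_psiError_le hk hη hδ, ?_⟩
  have := eventually_exists_lt_of_tendsto_fejer (b := fun u ↦ -psiError u) measurable_psiError.neg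
    (fun u ↦ by rw [abs_neg]; exact abs_psiError_le u) (fun l hl ↦ ?_) hη hδ
  · filter_upwards [this] with y ⟨u, hu, h⟩
    exact ⟨u, hu, by linarith⟩
  · have := (hk l hl).neg
    simpa [integral_neg] using this

/-- The prime number theorem for the Chebyshev function `ψ`. -/
theorem tendsto_psi_div : Tendsto (fun x ↦ Chebyshev.psi x / x) atTop (𝓝 1) := by
  have hlim : Tendsto psiError atTop (𝓝 0) := by
    rw [Metric.tendsto_nhds]
    intro ε hε
    have hc : Tendsto (fun δ : ℝ ↦ exp (2 * δ)) (𝓝 0) (𝓝 1) := by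
      have : Continuous fun δ : ℝ ↦ exp (2 * δ) := by fun_prop
      simpa using this.tendsto 0
    set ε' := min ε 1 with hε'
    have hε'0 : 0 < ε' := by positivity
    have hε'1 : ε' ≤ 1 := min_le_right _ _
    have hε'ε : ε' ≤ ε := min_le_left _ _
    obtain ⟨δ, hδ1, hδ⟩ : ∃ δ : ℝ, exp (2 * δ) < 1 + ε' / 4 ∧ 0 < δ := by
      have h1 := (hc.mono_left (nhdsWithin_le_nhds (s := Ioi 0))).eventually_lt_const
        (show (1 : ℝ) < 1 + ε' / 4 by linarith)
      exact (h1.and self_mem_nhdsWithin).exists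
    obtain ⟨h1, h2⟩ := eventually_exists_psiError_lt (η := ε' / 4) (by positivity) hδ
    have h1' := (tendsto_atTop_add_const_right atTop δ tendsto_id).eventually h1
    have h2' := (tendsto_atTop_add_const_right atTop (-δ) tendsto_id).eventually h2
    have mono {u v : ℝ} (h : u ≤ v) : Chebyshev.psi (exp u) ≤ Chebyshev.psi (exp v) :=
      Chebyshev.psi_mono (exp_le_exp.mpr h)
    have comp {u v : ℝ} (h : u ≤ v) (h' : v ≤ u + 2 * δ) :
        1 + psiError u ≤ (1 + ε' / 4) * (1 + psiError v) := by
      have e1 : exp (-u) ≤ (1 + ε' / 4) * exp (-v) := by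
        calc exp (-u) ≤ exp (2 * δ + -v) := exp_le_exp.mpr (by linarith)
          _ = exp (2 * δ) * exp (-v) := exp_add _ _
          _ ≤ _ := by gcongr
      have : 1 + psiError u = Chebyshev.psi (exp u) * exp (-u) := by unfold psiError; ring
      have h2 : 1 + psiError v = Chebyshev.psi (exp v) * exp (-v) := by unfold psiError; ring
      rw [this, h2]
      calc _ ≤ Chebyshev.psi (exp v) * ((1 + ε' / 4) * exp (-v)) :=
            mul_le_mul (mono h) e1 (exp_pos _).le (Chebyshev.psi_nonneg _)
        _ = _ := by ring
    filter_upwards [h1', h2'] with y hy1 hy2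
    obtain ⟨u, hu, hu'⟩ := hy1
    obtain ⟨v, hv, hv'⟩ := hy2
    simp only [id] at hu hv
    have c1 := comp (u := y) (v := u) (by linarith [hu.1]) (by linarith [hu.2])
    have c2 := comp (u := v) (v := y) (by linarith [hv.2]) (by linarith [hv.1])
    rw [Real.dist_eq, sub_zero, abs_lt]
    constructor <;> nlinarith
  refine (hlim.comp tendsto_log_atTop |>.add_const 1).congr' ?_ |>.trans (by simp)
  filter_upwards [eventually_gt_atTop 0] with x hx
  simp [psiError, exp_log hx, exp_neg, div_eq_mul_inv]

theorem tendsto_theta_div : Tendsto (fun x ↦ Chebyshev.theta x / x) atTop (𝓝 1) := by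
  have h : Tendsto (fun x ↦ (Chebyshev.psi x - Chebyshev.theta x) / x) atTop (𝓝 0) := by
    have h1 := Chebyshev.isBigO_psi_sub_theta_sqrt.trans_isLittleO (k := fun x : ℝ ↦ x) ?_
    · exact h1.tendsto_div_nhds_zero
    · refine Asymptotics.isLittleO_of_tendsto' ?_ ?_
      · filter_upwards [eventually_gt_atTop 0] with x hx h
        exact absurd h hx.ne'
      · simpa [sqrt_div_self, Function.comp_def] using
          tendsto_inv_atTop_zero.comp tendsto_sqrt_atTop
  have := tendsto_psi_div.sub h
  simp only [sub_zero] at this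
  refine this.congr fun x ↦ ?_
  ring

end PrimeNumberTheorem

section Functionals

open Real Set Filter Topology MeasureTheory

/-- The set of points at which the integrands are regular. -/
def regSet : Set ℂ := {y | y - 5 ≠ 0 ∧ y + 5 ≠ 0}

/-- The integral along the vertical segment from `-1 - 2i` to `-1 + 2i`, divided by `i`. -/
noncomputable def lineInt (F : ℂ → ℂ) : ℂ := ∫ t in (-2 : ℝ)..2, F (-1 + t * Complex.I)

/-- Minus half of the residue at `5`. -/
noncomputable def halfRes (F : ℂ → ℂ) : ℂ :=
  -(1 / 2) * ((2 * π * Complex.I)⁻¹ * ∮ z in C(5, 31449 / 10000), F z)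

/-- The part of `lineInt F` that remains after the multiple of `π` is removed. -/
noncomputable def ratPart (F : ℂ → ℂ) : ℂ := lineInt F - π * halfRes F

theorem line_mem_regSet (t : ℝ) : (-1 + t * Complex.I : ℂ) ∈ regSet := by
  constructor <;> intro h <;> have := congrArg Complex.re h <;> norm_num at this

theorem sphere_subset_regSet : Metric.sphere (5 : ℂ) (31449 / 10000) ⊆ regSet := by
  intro z hz
  rw [mem_sphere_iff_norm] at hz
  constructor <;> intro h
  · rw [h] at hz; norm_num at hz
  · have : z - 5 = -10 := by linear_combination h
    rw [this] at hz; norm_num at hz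

section Linear

variable {F G : ℂ → ℂ}

theorem intervalIntegrable_line (hF : ContinuousOn F regSet) (a b : ℝ) :
    IntervalIntegrable (fun t : ℝ ↦ F (-1 + t * Complex.I)) volume a b :=
  (hF.comp_continuous (by fun_prop) line_mem_regSet).intervalIntegrable _ _

theorem circleIntegrable_of_continuousOn (hF : ContinuousOn F regSet) :
    CircleIntegrable F 5 (31449 / 10000) :=
  (hF.mono sphere_subset_regSet).circleIntegrable (by norm_num)

theorem lineInt_add (hF : ContinuousOn F regSet) (hG : ContinuousOn G regSet) :
    lineInt (fun y ↦ F y + G y) = lineInt F + lineInt G :=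
  intervalIntegral.integral_add (intervalIntegrable_line hF _ _) (intervalIntegrable_line hG _ _)

theorem lineInt_const_mul (c : ℂ) : lineInt (fun y ↦ c * F y) = c * lineInt F :=
  intervalIntegral.integral_const_mul _ _

theorem lineInt_congr (h : EqOn F G regSet) : lineInt F = lineInt G :=
  intervalIntegral.integral_congr fun t _ ↦ h (line_mem_regSet t)

theorem halfRes_add (hF : ContinuousOn F regSet) (hG : ContinuousOn G regSet) :
    halfRes (fun y ↦ F y + G y) = halfRes F + halfRes G := by
  unfold halfRes
  rw [circleIntegral.integral_add (circleIntegrable_of_continuousOn hF)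
    (circleIntegrable_of_continuousOn hG)]
  ring

theorem halfRes_const_mul (c : ℂ) : halfRes (fun y ↦ c * F y) = c * halfRes F := by
  unfold halfRes
  rw [circleIntegral.integral_const_mul]
  ring

theorem halfRes_congr (h : EqOn F G regSet) : halfRes F = halfRes G := by
  unfold halfRes
  rw [circleIntegral.integral_congr (by norm_num) (h.mono sphere_subset_regSet)]

theorem ratPart_add (hF : ContinuousOn F regSet) (hG : ContinuousOn G regSet) :
    ratPart (fun y ↦ F y + G y) = ratPart F + ratPart G := by
  unfold ratPart
  rw [lineInt_add hF hG, halfRes_add hF hG]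
  ring

theorem ratPart_const_mul (c : ℂ) : ratPart (fun y ↦ c * F y) = c * ratPart F := by
  unfold ratPart
  rw [lineInt_const_mul, halfRes_const_mul]
  ring

theorem ratPart_congr (h : EqOn F G regSet) : ratPart F = ratPart G := by
  unfold ratPart
  rw [lineInt_congr h, halfRes_congr h]

theorem lineInt_zero : lineInt (fun _ ↦ 0) = 0 := by simp [lineInt]

theorem halfRes_zero : halfRes (fun _ ↦ 0) = 0 := by simp [halfRes, circleIntegral]

theorem ratPart_zero : ratPart (fun _ ↦ 0) = 0 := by simp [ratPart, lineInt_zero, halfRes_zero]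

theorem halfRes_sum {ι : Type*} (s : Finset ι) {f : ι → ℂ → ℂ}
    (hf : ∀ i ∈ s, ContinuousOn (f i) regSet) :
    halfRes (fun y ↦ ∑ i ∈ s, f i y) = ∑ i ∈ s, halfRes (f i) := by
  classical
  induction s using Finset.induction_on with
  | empty => simpa using halfRes_zero
  | insert a s ha ih =>
    simp_rw [Finset.sum_insert ha]
    rw [halfRes_add (hf a (Finset.mem_insert_self a s)) (continuousOn_finsetSum s fun i hi ↦
      hf i (Finset.mem_insert_of_mem hi)), ih fun i hi ↦ hf i (Finset.mem_insert_of_mem hi)]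

theorem ratPart_sum {ι : Type*} (s : Finset ι) {f : ι → ℂ → ℂ}
    (hf : ∀ i ∈ s, ContinuousOn (f i) regSet) :
    ratPart (fun y ↦ ∑ i ∈ s, f i y) = ∑ i ∈ s, ratPart (f i) := by
  classical
  induction s using Finset.induction_on with
  | empty => simpa using ratPart_zero
  | insert a s ha ih =>
    simp_rw [Finset.sum_insert ha]
    rw [ratPart_add (hf a (Finset.mem_insert_self a s)) (continuousOn_finsetSum s fun i hi ↦
      hf i (Finset.mem_insert_of_mem hi)), ih fun i hi ↦ hf i (Finset.mem_insert_of_mem hi)]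

theorem lineInt_of_hasDerivAt (hF : ContinuousOn F regSet)
    (h : ∀ t ∈ uIcc (-2 : ℝ) 2, HasDerivAt G (F (-1 + t * Complex.I)) (-1 + t * Complex.I)) :
    lineInt F = -Complex.I * (G (-1 + 2 * Complex.I) - G (-1 - 2 * Complex.I)) := by
  have h1 (t : ℝ) (ht : t ∈ uIcc (-2 : ℝ) 2) :
      HasDerivAt (fun t : ℝ ↦ -Complex.I * G (-1 + t * Complex.I))
      (F (-1 + t * Complex.I)) t := by
    have h2 : HasDerivAt (fun t : ℝ ↦ (-1 + t * Complex.I : ℂ)) Complex.I t := by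
      simpa using ((Complex.ofRealCLM.hasDerivAt (x := t)).mul_const Complex.I).const_add (-1)
    have := ((h t ht).comp_of_eq t h2 rfl).const_mul (-Complex.I)
    convert! this using 1
    linear_combination (F (-1 + t * Complex.I)) * Complex.I_mul_I
  unfold lineInt
  rw [intervalIntegral.integral_eq_sub_of_hasDerivAt h1
    (intervalIntegrable_line hF _ _)]
  push_cast
  ring_nf

theorem halfRes_of_hasDerivAt (h : ∀ y ∈ regSet, HasDerivAt G (F y) y) : halfRes F = 0 := by
  unfold halfRes
  rw [circleIntegral.integral_eq_zero_of_hasDerivWithinAt (by norm_num)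
    fun z hz ↦ (h z (sphere_subset_regSet hz)).hasDerivWithinAt]
  simp

theorem ratPart_of_hasDerivAt (hF : ContinuousOn F regSet)
    (h : ∀ y ∈ regSet, HasDerivAt G (F y) y) :
    ratPart F = -Complex.I * (G (-1 + 2 * Complex.I) - G (-1 - 2 * Complex.I)) := by
  unfold ratPart
  rw [lineInt_of_hasDerivAt hF fun t _ ↦ h _ (line_mem_regSet t), halfRes_of_hasDerivAt h]
  ring

end Linear

theorem continuousOn_inv_sub : ContinuousOn (fun y : ℂ ↦ (y - 5)⁻¹) regSet :=
  ContinuousOn.inv₀ (by fun_prop) fun _ h ↦ h.1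

theorem continuousOn_inv_neg_sub : ContinuousOn (fun y : ℂ ↦ (-y - 5)⁻¹) regSet :=
  ContinuousOn.inv₀ (by fun_prop) fun y h h' ↦ h.2 (by linear_combination -h')

theorem halfRes_inv_sub : halfRes (fun y ↦ (y - 5)⁻¹) = -(1 / 2) := by
  unfold halfRes
  rw [circleIntegral.integral_sub_center_inv _ (by norm_num), inv_mul_cancel₀, mul_one]
  exact Complex.two_pi_I_ne_zero

theorem halfRes_inv_neg_sub : halfRes (fun y ↦ (-y - 5)⁻¹) = 0 := by
  unfold halfRes
  rw [DiffContOnCl.circleIntegral_eq_zero (by norm_num)]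
  · simp
  · refine DifferentiableOn.diffContOnCl ?_
    intro y hy
    rw [closure_ball _ (by norm_num), mem_closedBall_iff_norm] at hy
    refine DifferentiableAt.differentiableWithinAt (DifferentiableAt.inv (by fun_prop) fun h ↦ ?_)
    have : y - 5 = -10 := by linear_combination -h
    rw [this] at hy
    norm_num at hy

theorem log_conj_sub_log {x y : ℝ} (hx : 0 < x) :
    Complex.log (x - y * Complex.I) - Complex.log (x + y * Complex.I) =
      -(2 * Real.arctan (y / x)) * Complex.I := by
  have harg : (x + y * Complex.I : ℂ).arg = Real.arctan (y / x) := by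
    have h1 : |(x + y * Complex.I : ℂ).arg| < π / 2 := by
      rw [Complex.abs_arg_lt_pi_div_two_iff]
      left; simpa using hx
    have h2 := Complex.tan_arg (x + y * Complex.I)
    rw [← Real.arctan_tan (abs_lt.mp h1).1 (abs_lt.mp h1).2, h2]
    simp
  have hc : (x - y * Complex.I : ℂ) = (starRingEnd ℂ) (x + y * Complex.I) := by
    simp [sub_eq_add_neg]
  rw [hc, Complex.log_conj, Complex.ext_iff]
  · generalize Real.arctan (y / x) = θ at harg ⊢
    simp [Complex.log_im, harg]
    ring
  · rw [harg]
    have := Real.arctan_lt_pi_div_two (y / x)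
    exact ne_of_lt (by linarith [pi_pos])

theorem ratPart_inv_sub_add_inv_neg_sub :
    ratPart (fun y ↦ (y - 5)⁻¹ + (-y - 5)⁻¹) = 0 := by
  unfold ratPart
  rw [halfRes_add continuousOn_inv_sub continuousOn_inv_neg_sub, halfRes_inv_sub,
    halfRes_inv_neg_sub, lineInt_of_hasDerivAt
      (G := fun y ↦ Complex.log (5 - y) - Complex.log (5 + y))
      (F := fun y ↦ (y - 5)⁻¹ + (-y - 5)⁻¹) (continuousOn_inv_sub.add continuousOn_inv_neg_sub)]
  · have h1 := log_conj_sub_log (x := 6) (y := 2) (by norm_num)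
    have h2 := log_conj_sub_log (x := 4) (y := 2) (by norm_num)
    have h3 := Real.arctan_inv_2_add_arctan_inv_3
    have h4 : (Real.arctan (2 / 6) : ℂ) + (Real.arctan (2 / 4) : ℂ) = π / 4 := by
      rw [show (2 / 6 : ℝ) = 3⁻¹ by norm_num, show (2 / 4 : ℝ) = 2⁻¹ by norm_num]
      rw [← Complex.ofReal_add, add_comm, h3]
      push_cast; ring
    simp only [Complex.ofReal_ofNat] at h1 h2
    have e1 : (5 - (-1 + 2 * Complex.I) : ℂ) = 6 - 2 * Complex.I := by ring
    have e2 : (5 + (-1 + 2 * Complex.I) : ℂ) = 4 + 2 * Complex.I := by ring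
    have e3 : (5 - (-1 - 2 * Complex.I) : ℂ) = 6 + 2 * Complex.I := by ring
    have e4 : (5 + (-1 - 2 * Complex.I) : ℂ) = 4 - 2 * Complex.I := by ring
    simp only [e1, e2, e3, e4]
    linear_combination -Complex.I * h1 - Complex.I * h2 - 2 * h4 + 2 *
      (Real.arctan (2 / 6) + Real.arctan (2 / 4)) * Complex.I_mul_I
  · intro t _
    have l1 : (5 - (-1 + t * Complex.I) : ℂ) ∈ Complex.slitPlane := by left; norm_num
    have l2 : (5 + (-1 + t * Complex.I) : ℂ) ∈ Complex.slitPlane := by left; norm_num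
    have d1 := (((hasDerivAt_id (-1 + t * Complex.I : ℂ)).const_sub 5).clog l1)
    have d2 := (((hasDerivAt_id (-1 + t * Complex.I : ℂ)).const_add 5).clog l2)
    refine (d1.sub d2).congr_deriv ?_
    have hr := line_mem_regSet t
    generalize (-1 + t * Complex.I : ℂ) = y at hr
    obtain ⟨a, b⟩ := hr
    have c : -y - 5 ≠ 0 := fun h ↦ b (by linear_combination -h)
    have d : 5 - y ≠ 0 := fun h ↦ a (by linear_combination -h)
    have e : 5 + y ≠ 0 := fun h ↦ b (by linear_combination h)
    simp only [id]
    field_simp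
    ring

theorem hasDerivAt_inv_pow {u : ℂ → ℂ} {u' y : ℂ} (hu : HasDerivAt u u' y) (h0 : u y ≠ 0) {j : ℕ}
    (hj : j ≠ 0) :
    HasDerivAt (fun y ↦ -(1 / j : ℂ) * (u y)⁻¹ ^ j) (u' * (u y)⁻¹ ^ (j + 1)) y := by
  obtain ⟨m, rfl⟩ := Nat.exists_eq_succ_of_ne_zero hj
  have := ((hu.inv h0).pow (m + 1)).const_mul (-(1 / ((m + 1 : ℕ) : ℂ)))
  refine this.congr_deriv ?_
  have : ((m + 1 : ℕ) : ℂ) ≠ 0 := by exact_mod_cast m.succ_ne_zero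
  field_simp
  simp [pow_succ]
  field_simp

theorem continuousOn_inv_sub_pow (j : ℕ) : ContinuousOn (fun y : ℂ ↦ (y - 5)⁻¹ ^ j) regSet :=
  continuousOn_inv_sub.pow j

theorem continuousOn_inv_neg_sub_pow (j : ℕ) : ContinuousOn (fun y : ℂ ↦ (-y - 5)⁻¹ ^ j) regSet :=
  continuousOn_inv_neg_sub.pow j

theorem halfRes_inv_pow {j : ℕ} (hj : j ≠ 0) :
    halfRes (fun y ↦ (y - 5)⁻¹ ^ (j + 1) + (-y - 5)⁻¹ ^ (j + 1)) = 0 ∧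
    ratPart (fun y ↦ (y - 5)⁻¹ ^ (j + 1) + (-y - 5)⁻¹ ^ (j + 1)) =
      -Complex.I * (1 / j) * (-(-6 + 2 * Complex.I)⁻¹ ^ j + (-6 - 2 * Complex.I)⁻¹ ^ j +
        (-4 - 2 * Complex.I)⁻¹ ^ j - (-4 + 2 * Complex.I)⁻¹ ^ j) := by
  have key : ∀ y ∈ regSet, HasDerivAt (fun y : ℂ ↦
      -(1 / j : ℂ) * (y - 5)⁻¹ ^ j - (-(1 / j : ℂ) * (-y - 5)⁻¹ ^ j))
      ((y - 5)⁻¹ ^ (j + 1) + (-y - 5)⁻¹ ^ (j + 1)) y := by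
    intro y hy
    have c : -y - 5 ≠ 0 := fun h ↦ hy.2 (by linear_combination -h)
    have d1 := hasDerivAt_inv_pow ((hasDerivAt_id y).sub_const 5) hy.1 hj
    have d2 := hasDerivAt_inv_pow ((hasDerivAt_id y).neg.sub_const 5) c hj
    refine (d1.sub d2).congr_deriv ?_
    simp
  refine ⟨halfRes_of_hasDerivAt key, ?_⟩
  rw [ratPart_of_hasDerivAt (F := fun y ↦ (y - 5)⁻¹ ^ (j + 1) + (-y - 5)⁻¹ ^ (j + 1))
    ((continuousOn_inv_sub_pow _).add (continuousOn_inv_neg_sub_pow _)) key]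
  ring_nf

end Functionals

section PartialFractions

open Polynomial

theorem isCoprime_pow_X_pow {R : Type*} [CommRing R] (w : R[X]) (L N : ℕ) :
    IsCoprime ((1 + X * w) ^ L) (X ^ N) :=
  (show IsCoprime (1 + X * w) X from ⟨1, -w, by ring⟩).pow

theorem exists_map_eq_of_mul_pow (O : Subring ℂ) {f : ℂ[X]} {w g : O[X]} {L : ℕ}
    (h : f * ((1 + X * w) ^ L).map O.subtype = g.map O.subtype) :
    ∃ q : O[X], q.map O.subtype = f := by
  rw [← mem_lifts, lifts_iff_coeff_lifts]
  intro j
  obtain ⟨a, b, hab⟩ := isCoprime_pow_X_pow w L (j + 1)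
  have h1 : f = (g * a).map O.subtype + f * b.map O.subtype * X ^ (j + 1) := by
    have := congrArg (Polynomial.map O.subtype) hab
    rw [Polynomial.map_add, Polynomial.map_mul, Polynomial.map_mul, Polynomial.map_one,
      Polynomial.map_pow (n := j + 1), Polynomial.map_X] at this
    rw [Polynomial.map_mul, ← h]
    linear_combination -f * this
  refine ⟨(g * a).coeff j, ?_⟩
  rw [h1, coeff_add, coeff_map, coeff_mul_X_pow']
  simp

theorem exists_truncated_quotient {R : Type*} [CommRing R] [Nontrivial R] (h : R[X]) (τ : R)
    {L : ℕ} (hL : 0 < L) :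
    ∃ v : R[X], v.natDegree < L ∧ X ^ L ∣ h - v * (1 + C τ * X) ^ L := by
  obtain ⟨a, b, hab⟩ := isCoprime_pow_X_pow (C τ) L L
  have hm : (X ^ L : R[X]).Monic := monic_X_pow L
  refine ⟨(h * a) %ₘ X ^ L, ?_, ?_⟩
  · have := natDegree_modByMonic_lt (h * a) hm (by
      intro h1
      have := congrArg natDegree h1
      rw [natDegree_X_pow, natDegree_one] at this
      omega)
    simpa using this
  · refine ⟨h * b + (h * a) /ₘ X ^ L * (1 + C τ * X) ^ L, ?_⟩
    have := modByMonic_add_div (h * a) (X ^ L : R[X])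
    rw [mul_comm X (C τ)] at hab
    linear_combination -h * hab - (1 + C τ * X) ^ L * this

/-- Even partial fraction decomposition with poles at `±5`. -/
theorem exists_partialFraction {H : ℂ[X]} (hev : H.comp (-X) = H) {L : ℕ} (hL : 0 < L)
    {O : Subring ℂ} {lam c μ : ℂ} (hlam : lam ≠ 0) (hμ : μ = c * 10 ^ L * lam ^ (L - 1))
    (hτ : lam / 10 ∈ O) (hH : ∃ h : O[X], H.comp (C 5 + C lam * X) = C μ * h.map O.subtype) :
    ∃ (v : ℕ → ℂ) (Q : ℂ[X]), (∀ j, v j ∈ O) ∧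
      H = Q * ((X - C 5) * (X + C 5)) ^ L + ∑ j ∈ Finset.range L, C (c * lam ^ j * v j) *
        ((X - C 5) ^ (L - 1 - j) * (X + C 5) ^ L + (-X - C 5) ^ (L - 1 - j) * (C 5 - X) ^ L) := by
  obtain ⟨h, hh⟩ := hH
  obtain ⟨v, hvL, g, hg⟩ := exists_truncated_quotient h (⟨lam / 10, hτ⟩ : O) hL
  set A : ℕ → ℂ := fun j ↦ c * lam ^ j * v.coeff (L - 1 - j) with hA
  set S1 : ℂ[X] := ∑ j ∈ Finset.range L, C (A j) * ((X - C 5) ^ (L - 1 - j) * (X + C 5) ^ L) with hS1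
  set S2 : ℂ[X] := ∑ j ∈ Finset.range L, C (A j) * ((-X - C 5) ^ (L - 1 - j) * (C 5 - X) ^ L) with hS2
  have key1 : (X - C 5 : ℂ[X]) ^ L ∣ H - S1 := by
    have e1 : S1.comp (C 5 + C lam * X) =
        C μ * (v * (1 + C (⟨lam / 10, hτ⟩ : O) * X) ^ L).map O.subtype := by
      have ev : v.map O.subtype = ∑ j ∈ Finset.range L, C ((v.coeff j : ℂ)) * X ^ j := by
        conv_lhs => rw [v.as_sum_range' L hvL]
        simp [Polynomial.map_sum, ← C_mul_X_pow_eq_monomial]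
      have e10 : (C lam * X + C 10 : ℂ[X]) = C 10 * (1 + C (lam / 10) * X) := by
        rw [mul_add, ← mul_assoc, ← C_mul, mul_div_cancel₀ _ (by norm_num : (10 : ℂ) ≠ 0)]
        ring
      rw [Polynomial.map_mul, ev, ← Finset.sum_range_reflect, hS1, Polynomial.sum_comp,
        Finset.sum_mul, Finset.mul_sum]
      refine Finset.sum_congr rfl fun j hj ↦ ?_
      have hj : j < L := Finset.mem_range.mp hj
      have e5 : (C 5 + C 5 : ℂ[X]) = C 10 := by rw [← C_add]; norm_num
      simp only [mul_comp, C_comp, pow_comp, sub_comp, add_comp, X_comp,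
        Polynomial.map_pow, Polynomial.map_add, Polynomial.map_one, Polynomial.map_mul, map_X,
        map_C, Subring.subtype_apply]
      have a1 : (C 5 + C lam * X - C 5 : ℂ[X]) = C lam * X := by ring
      have a2 : (C 5 + C lam * X + C 5 : ℂ[X]) = C 10 * (1 + C (lam / 10) * X) := by
        rw [← e10, ← e5]; ring
      rw [a1, a2, hμ, hA]
      have a3 : lam ^ (L - 1) = lam ^ j * lam ^ (L - 1 - j) := by
        rw [← pow_add]; congr 1; omega
      rw [a3]
      simp only [mul_pow, C_mul, C_pow]
      ring
    have e2 : (H - S1).comp (C 5 + C lam * X) = X ^ L * (C μ * g.map O.subtype) := by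
      rw [sub_comp, hh, e1, ← mul_sub, ← Polynomial.map_sub, hg, Polynomial.map_mul]
      simp
      ring
    have e3 := congrArg (fun p : ℂ[X] ↦ p.comp (C lam⁻¹ * (X - C 5))) e2
    simp only [comp_assoc] at e3
    have e4 : (C 5 + C lam * X : ℂ[X]).comp (C lam⁻¹ * (X - C 5)) = X := by
      simp only [add_comp, mul_comp, C_comp, X_comp, ← mul_assoc, ← C_mul,
        mul_inv_cancel₀ hlam]
      simp
    rw [e4, comp_X] at e3
    rw [e3]
    simp only [mul_comp, pow_comp, X_comp, mul_pow]
    exact Dvd.dvd.mul_right (Dvd.intro_left _ rfl) _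
  have key2 : (X - C 5 : ℂ[X]) ^ L ∣ S2 := by
    refine Finset.dvd_sum fun j _ ↦ Dvd.dvd.mul_left (Dvd.dvd.mul_left ?_ _) _
    rw [show (C 5 - X : ℂ[X]) = -(X - C 5) by ring, neg_pow]
    exact Dvd.intro_left ((-1 : ℂ[X]) ^ L) rfl
  have key3 : (X - C 5 : ℂ[X]) ^ L ∣ H - (S1 + S2) := by
    rw [← sub_sub]
    exact dvd_sub key1 key2
  have hcompS : (S1 + S2).comp (-X) = S1 + S2 := by
    rw [add_comp, add_comm S1 S2]
    congr 1
    · simp only [hS1, hS2, Polynomial.sum_comp]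
      refine Finset.sum_congr rfl fun j _ ↦ ?_
      simp only [mul_comp, C_comp, pow_comp, sub_comp, add_comp, X_comp]
      ring
    · simp only [hS1, hS2, Polynomial.sum_comp]
      refine Finset.sum_congr rfl fun j _ ↦ ?_
      simp only [mul_comp, C_comp, pow_comp, sub_comp, neg_comp, X_comp, neg_neg]
      ring
  have key4 : (X + C 5 : ℂ[X]) ^ L ∣ H - (S1 + S2) := by
    obtain ⟨g, hg⟩ := key3
    have := congrArg (fun p : ℂ[X] ↦ p.comp (-X)) hg
    simp only [sub_comp, hev, hcompS, mul_comp, pow_comp, X_comp, C_comp] at this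
    rw [this]
    refine Dvd.dvd.mul_right ?_ _
    rw [show (-X - C 5 : ℂ[X]) = -(X + C 5) by ring, neg_pow]
    exact Dvd.intro_left _ rfl
  have hcop : IsCoprime ((X - C 5 : ℂ[X]) ^ L) ((X + C 5) ^ L) := by
    refine IsCoprime.pow ⟨-C (1 / 10), C (1 / 10), ?_⟩
    have : (C (1 / 10) * C 5 + C (1 / 10) * C 5 : ℂ[X]) = 1 := by
      rw [← C_mul, ← C_add]
      norm_num
    linear_combination this
  obtain ⟨Q, hQ⟩ := hcop.mul_dvd key3 key4
  refine ⟨fun j ↦ v.coeff (L - 1 - j), Q, fun j ↦ (v.coeff _).2, ?_⟩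
  have e5 : (∑ j ∈ Finset.range L, C (c * lam ^ j * (v.coeff (L - 1 - j) : ℂ)) *
      ((X - C 5) ^ (L - 1 - j) * (X + C 5) ^ L + (-X - C 5) ^ (L - 1 - j) * (C 5 - X) ^ L) : ℂ[X]) =
      S1 + S2 := by
    rw [hS1, hS2, ← Finset.sum_add_distrib]
    refine Finset.sum_congr rfl fun j _ ↦ ?_
    rw [mul_add]
  rw [e5, mul_pow]
  linear_combination hQ

end PartialFractions

section LocalIntegrality

open Polynomial Complex

theorem continuousOn_eval_regSet (Q : ℂ[X]) : ContinuousOn (fun y ↦ Q.eval y) regSet :=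
  Q.continuous.continuousOn

theorem hasDerivAt_comp_antideriv {Q q : ℂ[X]} {α β r : ℂ} (hβ : β ≠ 0)
    (hQ : Q.comp (C α + C β * X) = C r * q) (y : ℂ) :
    HasDerivAt (fun y ↦ r * β * ∑ i ∈ Finset.range (q.natDegree + 1),
      q.coeff i / (i + 1) * ((y - α) / β) ^ (i + 1)) (Q.eval y) y := by
  have h1 : Q.eval y = r * ∑ i ∈ Finset.range (q.natDegree + 1),
      q.coeff i * ((y - α) / β) ^ i := by
    have := congrArg (Polynomial.eval ((y - α) / β)) hQ
    rw [eval_comp, eval_mul, eval_C, q.eval_eq_sum_range] at this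
    rw [← this]
    congr 1
    simp
    field_simp
    ring
  rw [h1, show r * ∑ i ∈ Finset.range (q.natDegree + 1), q.coeff i * ((y - α) / β) ^ i =
    r * β * ∑ i ∈ Finset.range (q.natDegree + 1), q.coeff i * ((y - α) / β) ^ i * β⁻¹ by
      rw [← Finset.sum_mul]; field_simp]
  refine HasDerivAt.const_mul _ (HasDerivAt.fun_sum fun i _ ↦ ?_)
  have h2 : HasDerivAt (fun y ↦ (y - α) / β) β⁻¹ y := by
    simpa [div_eq_mul_inv] using ((hasDerivAt_id y).sub_const α).mul_const β⁻¹
  refine ((h2.fun_pow (i + 1)).const_mul (q.coeff i / (i + 1))).congr_deriv ?_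
  have : (i + 1 : ℂ) ≠ 0 := by exact_mod_cast Nat.succ_ne_zero i
  simp
  field_simp

theorem halfRes_eval (Q : ℂ[X]) : halfRes (fun y ↦ Q.eval y) = 0 :=
  halfRes_of_hasDerivAt fun y _ ↦
    hasDerivAt_comp_antideriv (Q := Q) (q := Q) (α := 0) (β := 1) (r := 1) one_ne_zero (by simp) y

theorem ratPart_eval_mem {O : Subring ℂ} (hI : I ∈ O) {Q : ℂ[X]} {q : O[X]} {α β r D v₁ v₂ : ℂ}
    (hβ : β ≠ 0) (hQ : Q.comp (C α + C β * X) = C r * q.map O.subtype)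
    (hv₁ : v₁ ∈ O) (hv₂ : v₂ ∈ O) (h₁ : (-1 - 2 * I : ℂ) = α + β * v₁)
    (h₂ : (-1 + 2 * I : ℂ) = α + β * v₂)
    (hD : ∀ i ≤ Q.natDegree, D / (i + 1) ∈ O) :
    ∃ z ∈ O, D * ratPart (fun y ↦ Q.eval y) = r * β * z := by
  rcases eq_or_ne r 0 with hr | hr
  · have : Q = 0 := by
      have h0 : Q.comp (C α + C β * X) = 0 := by rw [hQ, hr]; simp
      have h1 := congrArg (fun p : ℂ[X] ↦ p.comp (C β⁻¹ * (X - C α))) h0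
      simp only [comp_assoc, zero_comp] at h1
      have e4 : (C α + C β * X : ℂ[X]).comp (C β⁻¹ * (X - C α)) = X := by
        simp only [add_comp, mul_comp, C_comp, X_comp, ← mul_assoc, ← C_mul, mul_inv_cancel₀ hβ]
        simp
      rwa [e4, comp_X] at h1
    exact ⟨0, O.zero_mem, by simp [this, ratPart_zero]⟩
  rw [ratPart_of_hasDerivAt (continuousOn_eval_regSet Q)
    fun y _ ↦ hasDerivAt_comp_antideriv hβ hQ y, h₁, h₂]
  have hdeg : (q.map O.subtype).natDegree = Q.natDegree := by
    have := congrArg natDegree hQ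
    rw [natDegree_comp, natDegree_C_mul hr, add_comm (C α), natDegree_linear hβ, mul_one] at this
    exact this.symm
  have hs : ∀ v ∈ O, ∑ i ∈ Finset.range ((q.map O.subtype).natDegree + 1),
      (q.map O.subtype).coeff i * (D / (i + 1)) * v ^ (i + 1) ∈ O := fun v hv ↦
    O.sum_mem fun i hi ↦ O.mul_mem (O.mul_mem (by simp) (hD i (by
      rw [Finset.mem_range, hdeg] at hi; omega))) (O.pow_mem hv _)
  refine ⟨-I * (_ - _), O.mul_mem (O.neg_mem hI) (O.sub_mem (hs v₂ hv₂) (hs v₁ hv₁)), ?_⟩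
  simp only [add_sub_cancel_left, mul_div_cancel_left₀ _ hβ]
  rw [← Finset.sum_sub_distrib, ← mul_sub, ← Finset.sum_sub_distrib]
  simp only [Finset.mul_sum]
  refine Finset.sum_congr rfl fun i _ ↦ ?_
  ring

theorem inv_pow_succ_mul_pow {x : ℂ} (hx : x ≠ 0) {j L : ℕ} (hj : j < L) :
    x⁻¹ ^ (j + 1) * x ^ L = x ^ (L - 1 - j) := by
  obtain ⟨m, rfl⟩ := Nat.exists_eq_add_of_lt hj
  rw [show j + m + 1 - 1 - j = m by omega, show j + m + 1 = m + (j + 1) by ring, pow_add x m, inv_pow, mul_comm,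
    mul_assoc, mul_inv_cancel₀ (pow_ne_zero _ hx), mul_one]

theorem natDegree_quotient_add_le {H Q : ℂ[X]} {L : ℕ} (hL : 0 < L) {a : ℕ → ℂ}
    (hH : H = Q * ((X - C 5) * (X + C 5)) ^ L + ∑ j ∈ Finset.range L, C (a j) *
      ((X - C 5) ^ (L - 1 - j) * (X + C 5) ^ L + (-X - C 5) ^ (L - 1 - j) * (C 5 - X) ^ L))
    (hQ : Q ≠ 0) : Q.natDegree + 2 * L ≤ H.natDegree := by
  have hmE : ((X - C 5) * (X + C 5) : ℂ[X]).Monic := (monic_X_sub_C 5).mul (monic_X_add_C 5)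
  have hE : ((X - C 5) * (X + C 5) : ℂ[X]).natDegree = 2 := by
    rw [(monic_X_sub_C 5).natDegree_mul (monic_X_add_C 5)]
    simp
  have h1 : (Q * ((X - C 5) * (X + C 5)) ^ L).natDegree = Q.natDegree + 2 * L := by
    rw [natDegree_mul hQ (hmE.pow L).ne_zero, hmE.natDegree_pow, hE, mul_comm L]
  have h2 : (∑ j ∈ Finset.range L, C (a j) * ((X - C 5) ^ (L - 1 - j) * (X + C 5) ^ L +
      (-X - C 5) ^ (L - 1 - j) * (C 5 - X) ^ L) : ℂ[X]).natDegree ≤ 2 * L - 1 := by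
    refine natDegree_sum_le_of_forall_le _ _ fun j hj ↦ (natDegree_C_mul_le _ _).trans ?_
    have hj := Finset.mem_range.mp hj
    have e : ∀ (p q : ℂ[X]), p.natDegree ≤ 1 → q.natDegree ≤ 1 →
        (p ^ (L - 1 - j) * q ^ L).natDegree ≤ 2 * L - 1 := by
      intro p q hp hq
      refine natDegree_mul_le.trans ?_
      have := natDegree_pow_le_of_le (L - 1 - j) hp
      have := natDegree_pow_le_of_le L hq
      omega
    refine natDegree_add_le_of_degree_le (e _ _ ?_ ?_) (e _ _ ?_ ?_) <;> compute_degree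
  have h3 := natDegree_add_eq_left_of_natDegree_lt (p := Q * ((X - C 5) * (X + C 5)) ^ L)
    (h2.trans_lt (by omega))
  rw [← hH, h1] at h3
  exact h3.ge

/-- Local integrality of the two periods of `H / (y² - 25)^L` for an even polynomial `H` whose
expansions at the pole `5` and around the endpoints of the path are divisible by `μ` and `ρ`. -/
theorem periods_mem_of_local {O : Subring ℂ} (hI : I ∈ O) {H : ℂ[X]} (hev : H.comp (-X) = H)
    {L J : ℕ} (hL : 0 < L) (hLJ : L ≤ J + 1) (hdeg : H.natDegree + 1 ≤ J + 2 * L)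
    {lam c μ : ℂ} (hlam : lam ≠ 0) (hc : c ≠ 0) (hμ : μ = c * 10 ^ L * lam ^ (L - 1))
    (hτ : lam / 10 ∈ O) (hH : ∃ h : O[X], H.comp (C 5 + C lam * X) = C μ * h.map O.subtype)
    {α β ρ : ℂ} (hβ : β ≠ 0) (hρ : ρ ≠ 0)
    (hH' : ∃ h : O[X], H.comp (C α + C β * X) = C ρ * h.map O.subtype)
    {ε : ℂ} (hε : ε ≠ 0)
    (hE : ∃ w : O[X], (C α + C β * X - C 5) * (C α + C β * X + C 5) =
      C ε * (1 + X * w).map O.subtype)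
    {κ₁ κ₂ : ℂ} (hκ₁ : ∃ l : O[X], C α + C β * X - C 5 = C κ₁ * l.map O.subtype)
    (hκ₂ : ∃ l : O[X], C α + C β * X + C 5 = C κ₂ * l.map O.subtype)
    {r₁ r₂ r₃ r₄ : ℂ} (hr₁ : r₁ ∈ O) (hr₂ : r₂ ∈ O) (hr₃ : r₃ ∈ O) (hr₄ : r₄ ∈ O)
    (h₁ : lam = κ₁ * r₁) (h₂ : κ₁ = κ₂ * r₂) (h₃ : c * κ₁ ^ (L - 1) * κ₂ ^ L = ρ * r₃)
    (h₄ : β * ρ = c * ε ^ L * r₄)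
    {v₁ v₂ : ℂ} (hv₁ : v₁ ∈ O) (hv₂ : v₂ ∈ O) (hy₁ : (-1 - 2 * I : ℂ) = α + β * v₁)
    (hy₂ : (-1 + 2 * I : ℂ) = α + β * v₂)
    (hu₁ : lam * (-6 + 2 * I)⁻¹ ∈ O) (hu₂ : lam * (-6 - 2 * I)⁻¹ ∈ O)
    (hu₃ : lam * (-4 - 2 * I)⁻¹ ∈ O) (hu₄ : lam * (-4 + 2 * I)⁻¹ ∈ O)
    {D : ℂ} (hD : ∀ j : ℕ, 1 ≤ j → j ≤ J → D / j ∈ O) :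
    c⁻¹ * D * ratPart (fun y ↦ H.eval y / ((y - 5) * (y + 5)) ^ L) ∈ O ∧
      c⁻¹ * 2 * halfRes (fun y ↦ H.eval y / ((y - 5) * (y + 5)) ^ L) ∈ O := by
  obtain ⟨v, Q, hv, hHQ⟩ := exists_partialFraction hev hL hlam hμ hτ hH
  set T : ℕ → ℂ → ℂ := fun j y ↦ (y - 5)⁻¹ ^ (j + 1) + (-y - 5)⁻¹ ^ (j + 1) with hT
  have hTc : ∀ j, ContinuousOn (T j) regSet := fun j ↦
    (continuousOn_inv_sub_pow _).add (continuousOn_inv_neg_sub_pow _)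
  have hF : Set.EqOn (fun y ↦ H.eval y / ((y - 5) * (y + 5)) ^ L)
      (fun y ↦ Q.eval y + ∑ j ∈ Finset.range L, c * lam ^ j * v j * T j y) regSet := by
    intro y hy
    have e1 : y - 5 ≠ 0 := hy.1
    have e2 : y + 5 ≠ 0 := hy.2
    have e3 : -y - 5 ≠ 0 := fun h ↦ hy.2 (by linear_combination -h)
    have e4 : 5 - y ≠ 0 := fun h ↦ hy.1 (by linear_combination -h)
    simp only
    rw [div_eq_iff (pow_ne_zero _ (mul_ne_zero e1 e2)), add_mul, Finset.sum_mul]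
    conv_lhs => rw [hHQ]
    simp only [eval_add, eval_mul, eval_pow, eval_sub, eval_X, eval_C, eval_finsetSum, eval_neg]
    congr 1
    refine Finset.sum_congr rfl fun j hj ↦ ?_
    have hj := Finset.mem_range.mp hj
    rw [mul_assoc (c * lam ^ j * v j)]
    congr 1
    rw [hT]
    simp only [add_mul]
    congr 1
    · rw [mul_pow, ← mul_assoc, inv_pow_succ_mul_pow e1 hj]
    · rw [show (y - 5) * (y + 5) = (-y - 5) * (5 - y) by ring, mul_pow, ← mul_assoc,
        inv_pow_succ_mul_pow e3 hj]
  have hcont : ∀ j ∈ Finset.range L, ContinuousOn (fun y ↦ c * lam ^ j * v j * T j y) regSet :=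
    fun j _ ↦ (hTc j).const_mul _
  have hcs : ContinuousOn (fun y ↦ ∑ j ∈ Finset.range L, c * lam ^ j * v j * T j y) regSet :=
    continuousOn_finsetSum _ hcont
  obtain ⟨L, rfl⟩ : ∃ m, L = m + 1 := ⟨L - 1, by omega⟩
  constructor
  · rw [ratPart_congr hF, ratPart_add (continuousOn_eval_regSet Q) hcs, ratPart_sum _ hcont, mul_add]
    refine O.add_mem ?_ ?_
    · rcases eq_or_ne Q 0 with h0 | h0
      · simp [h0, ratPart_zero]
      have hdQ := natDegree_quotient_add_le hL hHQ h0
      obtain ⟨h', hh'⟩ := hH'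
      obtain ⟨w, hw⟩ := hE
      obtain ⟨l₁, hl₁⟩ := hκ₁
      obtain ⟨l₂, hl₂⟩ := hκ₂
      have hQ : ∃ q : O[X], q.map O.subtype = C (ε ^ (L + 1) / ρ) * Q.comp (C α + C β * X) := by
        set m : O[X] → ℂ[X] := fun q ↦ q.map O.subtype with hm
        refine exists_map_eq_of_mul_pow O (w := w) (L := L + 1) (g := h' -
          ∑ j ∈ Finset.range (L + 1), C (⟨v j, hv j⟩ * ⟨r₃, hr₃⟩ * ⟨r₁, hr₁⟩ ^ j : O) *
            (l₁ ^ (L - j) * l₂ ^ (L + 1) + (-1) ^ (L - j) * (-1) ^ (L + 1) *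
              C ((⟨r₂, hr₂⟩ : O) ^ (j + 1)) * l₂ ^ (L - j) * l₁ ^ (L + 1))) ?_
        have h5 := congrArg (fun p : ℂ[X] ↦ p.comp (C α + C β * X)) hHQ
        simp only [add_comp, mul_comp, pow_comp, sub_comp, neg_comp, X_comp, C_comp,
          Polynomial.sum_comp] at h5
        rw [hh', hw, hl₁, hl₂] at h5
        have h6 : C ρ * (C (ε ^ (L + 1) / ρ) * Q.comp (C α + C β * X) *
            ((1 + X * w) ^ (L + 1)).map O.subtype) = Q.comp (C α + C β * X) *
            (C ε * (1 + X * w).map O.subtype) ^ (L + 1) := by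
          rw [Polynomial.map_pow, mul_pow, ← C_pow, ← mul_assoc, ← mul_assoc, ← C_mul,
            mul_div_cancel₀ _ hρ]
          ring
        refine mul_left_cancel₀ (C_ne_zero.mpr hρ) ?_
        rw [h6, Polynomial.map_sub, mul_sub, h5, eq_sub_iff_add_eq, add_right_inj,
          Polynomial.map_sum, Finset.mul_sum]
        refine Finset.sum_congr rfl fun j hj ↦ ?_
        have hj := Finset.mem_range_succ_iff.mp hj
        have c1 : c * lam ^ j * κ₁ ^ (L - j) * κ₂ ^ (L + 1) = ρ * (r₃ * r₁ ^ j) := by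
          rw [← mul_assoc ρ, ← h₃, h₁, mul_pow]
          have : κ₁ ^ (L + 1 - 1) = κ₁ ^ j * κ₁ ^ (L - j) := by
            rw [← pow_add]; congr 1; omega
          rw [this]
          ring
        have c2 : c * lam ^ j * κ₂ ^ (L - j) * κ₁ ^ (L + 1) =
            ρ * (r₃ * r₁ ^ j * r₂ ^ (j + 1)) := by
          have : κ₂ ^ (L + 1) = κ₂ ^ j * κ₂ ^ (L - j) * κ₂ := by
            rw [← pow_add, ← pow_succ]; congr 1; omega
          rw [← mul_assoc ρ, ← mul_assoc ρ, ← h₃, this, h₁, mul_pow, add_tsub_cancel_right]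
          calc _ = c * κ₁ ^ L * (κ₂ ^ (L - j) * r₁ ^ j) * (κ₁ ^ j * κ₁) := by ring
            _ = _ := by rw [← pow_succ, h₂]; ring
        have c1' := congrArg (C : ℂ → ℂ[X]) c1
        have c2' := congrArg (C : ℂ → ℂ[X]) c2
        simp only [Polynomial.map_mul, Polynomial.map_add, Polynomial.map_pow, Polynomial.map_neg,
          Polynomial.map_one, map_C, Subring.subtype_apply, 
          C_mul, C_pow] at c1' c2' ⊢
        have e1 : (C 5 - (C α + C β * X) : ℂ[X]) = -(C κ₁ * l₁.map O.subtype) := by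
          rw [← hl₁]; ring
        have e2 : (-(C α + C β * X) - C 5 : ℂ[X]) = -(C κ₂ * l₂.map O.subtype) := by
          rw [← hl₂]; ring
        rw [e1, e2, show L + 1 - 1 - j = L - j by omega, neg_pow, neg_pow (_ * _) (L + 1)]
        simp only [mul_pow]
        linear_combination -C (v j) * (l₁.map O.subtype) ^ (L - j) * (l₂.map O.subtype) ^ (L + 1)
          * c1' - C (v j) * (-1) ^ (L - j) * (-1) ^ (L + 1) * (l₂.map O.subtype) ^ (L - j) *
            (l₁.map O.subtype) ^ (L + 1) * c2'
      obtain ⟨q, hq⟩ := hQ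
      have hQ : Q.comp (C α + C β * X) = C (ρ / ε ^ (L + 1)) * q.map O.subtype := by
        rw [hq, ← mul_assoc, ← C_mul, div_mul_div_cancel₀ (pow_ne_zero _ hε), div_self hρ, C_1,
          one_mul]
      obtain ⟨z, hz, hz'⟩ := ratPart_eval_mem hI hβ hQ hv₁ hv₂ hy₁ hy₂ (D := D) fun i hi ↦ by
        have := hD (i + 1) (by omega) (by omega)
        rwa [Nat.cast_succ] at this
      rw [mul_assoc, hz']
      convert O.mul_mem hr₄ hz using 1
      have : ε ^ (L + 1) ≠ 0 := pow_ne_zero _ hε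
      field_simp
      linear_combination z * h₄
    · rw [Finset.sum_range_succ', mul_add]
      refine O.add_mem ?_ ?_
      · rw [Finset.mul_sum]
        refine O.sum_mem fun j hj ↦ ?_
        have hj := Finset.mem_range.mp hj
        rw [ratPart_const_mul, hT]
        simp only
        rw [(halfRes_inv_pow j.succ_ne_zero).2]
        have := O.mul_mem (O.mul_mem (hv (j + 1)) (hD (j + 1) (by omega) (by omega)))
          (O.mul_mem (O.neg_mem hI) (O.sub_mem (O.add_mem (O.add_mem
            (O.neg_mem (O.pow_mem hu₁ (j + 1))) (O.pow_mem hu₂ (j + 1)))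
            (O.pow_mem hu₃ (j + 1))) (O.pow_mem hu₄ (j + 1))))
        convert this using 1
        simp only [mul_pow]
        field_simp
      · rw [ratPart_const_mul, hT]
        simp only [zero_add, pow_one]
        rw [ratPart_inv_sub_add_inv_neg_sub]
        simp
  · rw [halfRes_congr hF, halfRes_add (continuousOn_eval_regSet Q) hcs, halfRes_sum _ hcont,
      halfRes_eval, zero_add, Finset.sum_range_succ', Finset.sum_eq_zero, zero_add,
      halfRes_const_mul, hT]
    · simp only [zero_add, pow_one]
      rw [halfRes_add continuousOn_inv_sub continuousOn_inv_neg_sub, halfRes_inv_sub,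
        halfRes_inv_neg_sub]
      convert O.neg_mem (hv 0) using 1
      field_simp
      simp
    · intro j _
      rw [halfRes_const_mul, hT]
      simp only
      rw [(halfRes_inv_pow j.succ_ne_zero).1, mul_zero]

end LocalIntegrality

section Localization

open Polynomial Complex

/-- The Gaussian integers, as a subring of `ℂ`. -/
noncomputable def gaussRing : Subring ℂ := GaussianInt.toComplex.range

theorem I_mem_gaussRing : I ∈ gaussRing := ⟨⟨0, 1⟩, by simp [GaussianInt.toComplex_def]⟩

/-- The Gaussian integers with all naturals prime to `p` inverted. -/
noncomputable def locGauss (p : ℕ) (hp : p.Prime) : Subring ℂ where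
  carrier := {x | ∃ b : ℕ, ¬p ∣ b ∧ (b : ℂ) * x ∈ gaussRing}
  mul_mem' := by
    rintro x y ⟨b, hb, hx⟩ ⟨c, hc, hy⟩
    refine ⟨b * c, hp.prime.not_dvd_mul hb hc, ?_⟩
    convert gaussRing.mul_mem hx hy using 1
    push_cast
    ring
  one_mem' := ⟨1, hp.not_dvd_one, by simp⟩
  add_mem' := by
    rintro x y ⟨b, hb, hx⟩ ⟨c, hc, hy⟩
    refine ⟨b * c, hp.prime.not_dvd_mul hb hc, ?_⟩
    convert gaussRing.add_mem (gaussRing.mul_mem (natCast_mem gaussRing c) hx)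
      (gaussRing.mul_mem (natCast_mem gaussRing b) hy) using 1
    push_cast
    ring
  zero_mem' := ⟨1, hp.not_dvd_one, by simp⟩
  neg_mem' := by
    rintro x ⟨b, hb, hx⟩
    exact ⟨b, hb, by simpa using hx⟩

variable {p : ℕ} {hp : p.Prime}

theorem gaussRing_le_locGauss : gaussRing ≤ locGauss p hp :=
  fun x hx ↦ ⟨1, hp.not_dvd_one, by simpa using hx⟩

theorem I_mem_locGauss : I ∈ locGauss p hp := gaussRing_le_locGauss I_mem_gaussRing

theorem mem_locGauss_of_mul {x y : ℂ} {b : ℕ} (hb : ¬p ∣ b) (hy : y ∈ locGauss p hp)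
    (h : b * x = y) : x ∈ locGauss p hp := by
  obtain ⟨c, hc, hy⟩ := hy
  exact ⟨c * b, hp.prime.not_dvd_mul hc hb, by rwa [Nat.cast_mul, mul_assoc, h]⟩

theorem mem_locGauss_of_eq {x : ℂ} (b : ℕ) (u v : ℤ) (hb : ¬p ∣ b) (h : b * x = u + v * I) :
    x ∈ locGauss p hp :=
  mem_locGauss_of_mul hb (add_mem (intCast_mem _ u) (mul_mem (intCast_mem _ v) I_mem_locGauss)) h

theorem inv_natCast_mem_locGauss {b : ℕ} (hb : ¬p ∣ b) : (b : ℂ)⁻¹ ∈ locGauss p hp := by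
  refine mem_locGauss_of_mul hb (one_mem _) (mul_inv_cancel₀ ?_)
  rintro h
  exact hb (by simp [Nat.cast_eq_zero.mp h])

theorem mem_gaussRing_of_forall_mem_locGauss {x : ℂ} (h : ∀ p (hp : p.Prime), x ∈ locGauss p hp) :
    x ∈ gaussRing := by
  let 𝔞 : Ideal ℤ :=
    { carrier := {m | (m : ℂ) * x ∈ gaussRing}
      add_mem' := fun {a b} ha hb ↦ by
        simp only [Set.mem_ofPred_eq] at *
        rw [Int.cast_add, add_mul]; exact add_mem ha hb
      zero_mem' := by simp
      smul_mem' := fun c a ha ↦ by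
        simp only [Set.mem_ofPred_eq, smul_eq_mul] at *
        rw [Int.cast_mul, mul_assoc]
        exact mul_mem (intCast_mem _ _) ha }
  suffices h1 : 𝔞 = ⊤ by
    have : (1 : ℤ) ∈ 𝔞 := by rw [h1]; trivial
    simpa using (show ((1 : ℤ) : ℂ) * x ∈ gaussRing from this)
  obtain ⟨g, hg⟩ := (IsPrincipalIdealRing.principal 𝔞).principal
  by_contra hne
  have hg1 : g.natAbs ≠ 1 := by
    intro h1
    apply hne
    rw [hg, Ideal.submodule_span_eq, Ideal.span_singleton_eq_top]
    exact Int.isUnit_iff_natAbs_eq.mpr h1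
  obtain ⟨p, hp, hpg⟩ := Nat.exists_prime_and_dvd hg1
  obtain ⟨b, hb, hx⟩ := h p hp
  have : (b : ℤ) ∈ 𝔞 := by
    show ((b : ℤ) : ℂ) * x ∈ gaussRing
    simpa using hx
  rw [hg, Ideal.submodule_span_eq, Ideal.mem_span_singleton] at this
  exact hb (hpg.trans (by simpa using Int.natAbs_dvd_natAbs.mpr this))

theorem div_natCast_mem_of_dvd {O : Subring ℂ} {D j : ℕ} (h : j ∣ D) : (D : ℂ) / j ∈ O := by
  rcases eq_or_ne j 0 with rfl | hj
  · simp
  · rw [← Nat.cast_div h (by exact_mod_cast hj)]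
    exact natCast_mem _ _

theorem C_mem_lifts_subtype {O : Subring ℂ} {x : ℂ} (hx : x ∈ O) : C x ∈ lifts O.subtype :=
  C_mem_lifts O.subtype ⟨x, hx⟩

theorem exists_eq_C_mul_map {O : Subring ℂ} {P P' : ℂ[X]} {r : ℂ} (h : P' ∈ lifts O.subtype)
    (hP : P = C r * P') : ∃ h : O[X], P = C r * h.map O.subtype := by
  obtain ⟨q, rfl⟩ := (mem_lifts _).mp h
  exact ⟨q, hP⟩

theorem inv_neg_six_add : (-6 + 2 * I : ℂ)⁻¹ = -(3 + I) / 20 :=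
  inv_eq_of_mul_eq_one_right <| by linear_combination -I_sq / 10

theorem inv_neg_six_sub : (-6 - 2 * I : ℂ)⁻¹ = -(3 - I) / 20 :=
  inv_eq_of_mul_eq_one_right <| by linear_combination -I_sq / 10

theorem inv_neg_four_sub : (-4 - 2 * I : ℂ)⁻¹ = -(2 - I) / 10 :=
  inv_eq_of_mul_eq_one_right <| by linear_combination -I_sq / 5

theorem inv_neg_four_add : (-4 + 2 * I : ℂ)⁻¹ = -(2 + I) / 10 :=
  inv_eq_of_mul_eq_one_right <| by linear_combination -I_sq / 5

/-- Local integrality at a prime different from `2` and `5`. -/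
theorem periods_mem_of_inv_ten_mem {O : Subring ℂ} (hI : I ∈ O) (h10 : (10 : ℂ)⁻¹ ∈ O) {H : ℂ[X]}
    (hev : H.comp (-X) = H) (hH : H ∈ lifts O.subtype)
    {L J : ℕ} (hL : 0 < L) (hLJ : L ≤ J + 1) (hdeg : H.natDegree + 1 ≤ J + 2 * L)
    {D : ℂ} (hD : ∀ j : ℕ, 1 ≤ j → j ≤ J → D / j ∈ O) :
    D * ratPart (fun y ↦ H.eval y / ((y - 5) * (y + 5)) ^ L) ∈ O ∧
      2 * halfRes (fun y ↦ H.eval y / ((y - 5) * (y + 5)) ^ L) ∈ O := by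
  obtain ⟨h, rfl⟩ := (mem_lifts _).mp hH
  have hn : ∀ n : ℕ, (n : ℂ) ∈ O := natCast_mem O
  have h5 : (5 : ℂ) ∈ O := by simpa using hn 5
  have h2 : (2 : ℂ) ∈ O := by simpa using hn 2
  have h1025 : (-25 : ℂ)⁻¹ ∈ O := by
    convert O.neg_mem (O.mul_mem (O.pow_mem h10 2) (hn 4)) using 1
    norm_num
  have hX5 : (C (5 : ℂ) + C 1 * X) = (C (⟨5, h5⟩ : O) + X).map O.subtype := by simp
  have main := periods_mem_of_local hI hev hL hLJ hdeg (lam := 1) (c := 1) (μ := 10 ^ L)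
    one_ne_zero one_ne_zero (by simp) (by simpa using h10)
    ⟨C (⟨10⁻¹, h10⟩ : O) ^ L * h.comp (C (⟨5, h5⟩ : O) + X), by
      rw [hX5, Polynomial.map_mul, Polynomial.map_comp, ← mul_assoc, Polynomial.map_pow, map_C,
        ← C_pow, ← C_mul]
      simp⟩
    (α := 0) (β := 1) (ρ := 1) one_ne_zero one_ne_zero ⟨h, by simp⟩ (ε := -25) (by norm_num)
    ⟨C (⟨(-25)⁻¹, h1025⟩ : O) * X, by
      have e : (C (-25) * C ((-25)⁻¹) : ℂ[X]) = 1 := by rw [← C_mul]; norm_num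
      have e5 : (C 5 * C 5 : ℂ[X]) = -C (-25) := by rw [← C_mul, ← C_neg]; norm_num
      simp only [Polynomial.map_mul, Polynomial.map_add, Polynomial.map_one, map_X, map_C,
        Subring.subtype_apply, map_zero, map_one]
      linear_combination -X ^ 2 * e - e5⟩
    (κ₁ := 1) (κ₂ := 1) ⟨X - C (⟨5, h5⟩ : O), by simp⟩ ⟨X + C (⟨5, h5⟩ : O), by simp⟩
    (r₁ := 1) (r₂ := 1) (r₃ := 1) (r₄ := (-25)⁻¹ ^ L) O.one_mem O.one_mem O.one_mem
    (O.pow_mem h1025 L) (by simp) (by simp) (by simp)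
    (by rw [mul_assoc, ← mul_pow]; norm_num) (v₁ := -1 - 2 * I) (v₂ := -1 + 2 * I)
    (O.sub_mem (O.neg_mem O.one_mem) (O.mul_mem h2 hI))
    (O.add_mem (O.neg_mem O.one_mem) (O.mul_mem h2 hI)) (by simp) (by simp)
    (by
      rw [inv_neg_six_add]
      convert! O.neg_mem (O.mul_mem h10 (O.mul_mem (O.add_mem (hn 3) hI) (O.mul_mem h10 h5))) using 1
      push_cast; ring)
    (by
      rw [inv_neg_six_sub]
      convert! O.neg_mem (O.mul_mem h10 (O.mul_mem (O.sub_mem (hn 3) hI) (O.mul_mem h10 h5))) using 1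
      push_cast; ring)
    (by
      rw [inv_neg_four_sub]
      convert! O.neg_mem (O.mul_mem h10 (O.sub_mem h2 hI)) using 1
      ring)
    (by
      rw [inv_neg_four_add]
      convert! O.neg_mem (O.mul_mem h10 (O.add_mem h2 hI)) using 1
      ring) hD
  simpa using main

/-- The numerator of the integrand. -/
noncomputable def numPoly (n k : ℕ) : ℂ[X] :=
  (X * (X ^ 4 + 6 * X ^ 2 + 25)) ^ (4 * n) * X ^ (2 * k)

theorem numPoly_comp_neg (n k : ℕ) : (numPoly n k).comp (-X) = numPoly n k := by
  simp only [numPoly, mul_comp, pow_comp, add_comp, X_comp, ofNat_comp, Nat.cast_ofNat]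
  rw [show (-X * ((-X) ^ 4 + 6 * (-X) ^ 2 + 25) : ℂ[X]) = -(X * (X ^ 4 + 6 * X ^ 2 + 25)) by ring,
    Even.neg_pow ⟨2 * n, by ring⟩, Even.neg_pow ⟨k, by ring⟩]

theorem natDegree_numPoly_le (n k : ℕ) : (numPoly n k).natDegree ≤ 20 * n + 2 * k := by
  unfold numPoly
  have : (X * (X ^ 4 + 6 * X ^ 2 + 25) : ℂ[X]).natDegree ≤ 5 := by compute_degree
  have h1 := natDegree_pow_le_of_le (4 * n) this
  have h2 : (X ^ (2 * k) : ℂ[X]).natDegree ≤ 2 * k := by simp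
  exact (natDegree_mul_le_of_le h1 h2).trans (by omega)

theorem numPoly_mem_lifts {O : Subring ℂ} (n k : ℕ) : numPoly n k ∈ lifts O.subtype :=
  (mem_lifts _).mpr ⟨(X * (X ^ 4 + 6 * X ^ 2 + 25)) ^ (4 * n) * X ^ (2 * k), by simp [numPoly]⟩

theorem numPoly_comp {O : Subring ℂ} {n k : ℕ} {ℓ m : ℂ[X]} {r : ℂ} (hℓ : ℓ ∈ lifts O.subtype)
    (hm : m ∈ lifts O.subtype) (h : ℓ * (ℓ ^ 4 + 6 * ℓ ^ 2 + 25) = C r * m) :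
    ∃ h : O[X], (numPoly n k).comp ℓ = C (r ^ (4 * n)) * h.map O.subtype := by
  refine exists_eq_C_mul_map (P' := m ^ (4 * n) * ℓ ^ (2 * k))
    (mul_mem (pow_mem hm _) (pow_mem hℓ _)) ?_
  simp only [numPoly, mul_comp, pow_comp, add_comp, X_comp, ofNat_comp, Nat.cast_ofNat]
  rw [h, mul_pow, C_pow, mul_assoc]

/-- The integrand. -/
noncomputable def integrand (n k : ℕ) (y : ℂ) : ℂ :=
  (numPoly n k).eval y / ((y - 5) * (y + 5)) ^ (6 * n + 1)

theorem periods_mem_locGauss {p : ℕ} (hp : p.Prime) (h2 : p ≠ 2) (h5 : p ≠ 5) {n k D : ℕ}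
    (hk : k ≤ 2) (hD : ∀ j, 1 ≤ j → j ≤ 8 * n + 3 → j ∣ D) :
    D * ratPart (integrand n k) ∈ locGauss p hp ∧ 2 * halfRes (integrand n k) ∈ locGauss p hp := by
  refine periods_mem_of_inv_ten_mem (J := 8 * n + 3) I_mem_locGauss ?_ (numPoly_comp_neg n k)
    (numPoly_mem_lifts n k) (by omega) (by omega) ?_ fun j h1 h2 ↦ div_natCast_mem_of_dvd (hD j h1 h2)
  · refine inv_natCast_mem_locGauss (b := 10) fun h ↦ ?_
    have : p ∣ 2 * 5 := h
    rcases (Nat.Prime.dvd_mul hp).mp this with h | h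
    · exact h2 ((Nat.prime_dvd_prime_iff_eq hp Nat.prime_two).mp h)
    · exact h5 ((Nat.prime_dvd_prime_iff_eq hp Nat.prime_five).mp h)
  · have := natDegree_numPoly_le n k
    omega

theorem periods_mem_locGauss_five {n k D : ℕ} (hk : k ≤ 2)
    (hD : ∀ j, 1 ≤ j → j ≤ 8 * n + 3 → j ∣ D) :
    5 * D * ratPart (integrand n k) ∈ locGauss 5 Nat.prime_five ∧
      10 * halfRes (integrand n k) ∈ locGauss 5 Nat.prime_five := by
  set O := locGauss 5 Nat.prime_five with hO
  have hI : I ∈ O := I_mem_locGauss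
  have hn : ∀ n : ℕ, (n : ℂ) ∈ O := natCast_mem O
  have hi : ∀ b : ℕ, ¬5 ∣ b → (b : ℂ)⁻¹ ∈ O := fun b hb ↦ inv_natCast_mem_locGauss hb
  set c : ℂ := 5 ^ (6 * n) / 10 ^ (6 * n + 1) with hc
  have hc0 : c ≠ 0 := by simp [hc]
  have hc1 : c * 10 ^ (6 * n + 1) = 5 ^ (6 * n) := div_mul_cancel₀ _ (by norm_num)
  have hc5 : c * (5 * 2 ^ (6 * n + 1)) = 1 := by
    rw [hc, show (10 : ℂ) = 5 * 2 by norm_num, mul_pow]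
    field_simp
    ring
  have hcm : c⁻¹ ∈ O := by
    rw [← eq_inv_of_mul_eq_one_right hc5]
    simpa using hn (5 * 2 ^ (6 * n + 1))
  have main := periods_mem_of_local hI (numPoly_comp_neg n k) (L := 6 * n + 1) (J := 8 * n + 3)
    (by omega) (by omega) (by have := natDegree_numPoly_le n k; omega) (lam := 5) (c := c)
    (μ := 125 ^ (4 * n)) (by norm_num) hc0
    (by
      rw [hc1, add_tsub_cancel_right, show (125 : ℂ) = 5 ^ 3 by norm_num, ← pow_mul, ← pow_add]
      congr 1; ring)
    (by convert hi 2 (by norm_num) using 1; norm_num)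
    (numPoly_comp (m := (1 + X) * (25 * (1 + X) ^ 4 + 6 * (1 + X) ^ 2 + 1))
      (add_mem (C_mem_lifts_subtype (hn 5)) (mul_mem (C_mem_lifts_subtype (hn 5)) (X_mem_lifts _)))
      ((mem_lifts _).mpr ⟨(1 + X) * (25 * (1 + X) ^ 4 + 6 * (1 + X) ^ 2 + 1), by simp⟩)
      (by
        rw [show C (125 : ℂ) = 125 from map_ofNat C 125, show C (5 : ℂ) = 5 from map_ofNat C 5]
        ring))
    (α := 1) (β := 1) (ρ := c) one_ne_zero hc0
    (exists_eq_C_mul_map (P' := C c⁻¹ * (numPoly n k).comp (1 + X))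
      (mul_mem (C_mem_lifts_subtype hcm) (by
        obtain ⟨h, hh⟩ := (mem_lifts _).mp (numPoly_mem_lifts (O := O) n k)
        exact (mem_lifts _).mpr ⟨h.comp (1 + X), by simp [Polynomial.map_comp, hh]⟩))
      (by rw [← mul_assoc, ← C_mul, mul_inv_cancel₀ hc0]; simp))
    (ε := -24) (by norm_num)
    (by
      have h24 : (-12 : ℂ)⁻¹ ∈ O := by
        convert O.neg_mem (hi 12 (by norm_num)) using 1; norm_num
      have h24' : (-24 : ℂ)⁻¹ ∈ O := by
        convert O.neg_mem (hi 24 (by norm_num)) using 1; norm_num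
      refine ⟨C (⟨_, h24⟩ : O) + C (⟨_, h24'⟩ : O) * X, ?_⟩
      have e1 : (C (-24) * C ((-24)⁻¹) : ℂ[X]) = 1 := by rw [← C_mul]; norm_num
      have e2 : (C (-24) * C ((-12)⁻¹) : ℂ[X]) = 2 := by
        rw [← C_mul, show (2 : ℂ[X]) = C 2 from (map_ofNat C 2).symm]; norm_num
      have e3 : (C (-24) : ℂ[X]) = -24 := by rw [C_neg]; congr 1
      have e5 : (C 5 : ℂ[X]) = 5 := map_ofNat C 5
      simp only [Polynomial.map_mul, Polynomial.map_add, Polynomial.map_one, map_X, map_C,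
        Subring.subtype_apply, C_1, e5, mul_add, e3] at e1 e2 ⊢
      linear_combination -X ^ 2 * e1 - X * e2)
    (κ₁ := 1) (κ₂ := 1)
    (exists_eq_C_mul_map (P' := 1 + X + C (-5))
      (add_mem (add_mem (one_mem _) (X_mem_lifts _)) (C_mem_lifts_subtype (O.neg_mem (hn 5))))
      (by simp [sub_eq_add_neg]))
    (exists_eq_C_mul_map (P' := 1 + X + C 5)
      (add_mem (add_mem (one_mem _) (X_mem_lifts _)) (C_mem_lifts_subtype (hn 5))) (by simp))
    (r₁ := 5) (r₂ := 1) (r₃ := 1) (r₄ := ((-24 : ℂ)⁻¹) ^ (6 * n + 1)) (hn 5) O.one_mem O.one_mem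
    (O.pow_mem (by convert O.neg_mem (hi 24 (by norm_num)) using 1; norm_num) _) (by simp)
    (by simp) (by simp) (by rw [mul_assoc, ← mul_pow]; norm_num)
    (v₁ := -2 - 2 * I) (v₂ := -2 + 2 * I)
    (O.sub_mem (O.neg_mem (hn 2)) (O.mul_mem (hn 2) hI))
    (O.add_mem (O.neg_mem (hn 2)) (O.mul_mem (hn 2) hI)) (by ring) (by ring)
    (mem_locGauss_of_eq 4 (-3) (-1) (by norm_num) (by rw [inv_neg_six_add]; push_cast; ring))
    (mem_locGauss_of_eq 4 (-3) 1 (by norm_num) (by rw [inv_neg_six_sub]; push_cast; ring))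
    (mem_locGauss_of_eq 2 (-2) 1 (by norm_num) (by rw [inv_neg_four_sub]; push_cast; ring))
    (mem_locGauss_of_eq 2 (-2) (-1) (by norm_num) (by rw [inv_neg_four_add]; push_cast; ring))
    (D := D) fun j h1 h2 ↦ div_natCast_mem_of_dvd (hD j h1 h2)
  have hu : 5 * c * 2 ^ (6 * n + 1) = 1 := by rw [← hc5]; ring
  have hinv : c⁻¹ = 5 * 2 ^ (6 * n + 1) := by
    exact inv_eq_of_mul_eq_one_right hc5
  rw [hinv] at main
  constructor
  · refine mem_locGauss_of_mul (b := 2 ^ (6 * n + 1)) ?_ main.1 ?_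
    · intro h; exact absurd (Nat.Prime.dvd_of_dvd_pow Nat.prime_five h) (by norm_num)
    · push_cast; unfold integrand; ring
  · refine mem_locGauss_of_mul (b := 2 ^ (6 * n + 1)) ?_ main.2 ?_
    · intro h; exact absurd (Nat.Prime.dvd_of_dvd_pow Nat.prime_five h) (by norm_num)
    · push_cast; unfold integrand; ring

end Localization

section LocalizationTwo

open Polynomial Complex

theorem periods_mem_locGauss_two {n k D : ℕ} (hk : k ≤ 2)
    (hD : ∀ j, 1 ≤ j → j ≤ 8 * n + 3 → j ∣ D) :
    2 / 2 ^ (5 * n) * D * ratPart (integrand n k) ∈ locGauss 2 Nat.prime_two ∧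
      4 / 2 ^ (5 * n) * halfRes (integrand n k) ∈ locGauss 2 Nat.prime_two := by
  set O := locGauss 2 Nat.prime_two with hO
  have hI : I ∈ O := I_mem_locGauss
  have hn : ∀ n : ℕ, (n : ℂ) ∈ O := natCast_mem O
  have hg : ∀ a b : ℤ, (a + b * I : ℂ) ∈ O := fun a b ↦
    O.add_mem (intCast_mem _ _) (O.mul_mem (intCast_mem _ _) hI)
  have lX := X_mem_lifts O.subtype
  have lC : ∀ {x : ℂ}, x ∈ O → C x ∈ lifts O.subtype := fun h ↦ C_mem_lifts_subtype h
  set lam : ℂ := 2 + 2 * I with hlam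
  have hlam0 : lam ≠ 0 := fun h ↦ by simpa [hlam] using congrArg Complex.re h
  have hlamO : lam ∈ O := by simpa using hg 2 2
  set c : ℂ := 32 ^ (4 * n) / (10 ^ (6 * n + 1) * lam ^ (6 * n)) with hc
  have hc0 : c ≠ 0 := by simp [hc, hlam0]
  have hc1 : c * 10 ^ (6 * n + 1) * lam ^ (6 * n) = 32 ^ (4 * n) := by
    rw [hc]
    field_simp
  have hε : (-28 - 4 * I : ℂ) ≠ 0 := fun h ↦ by simpa using congrArg Complex.re h
  set J : ℂ[X] := C I with hJ
  have J2 : J ^ 2 = -1 := by rw [hJ, ← C_pow, I_sq, C_neg, C_1]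
  have J3 : J ^ 3 = -J := by rw [pow_succ, J2]; ring
  have J4 : J ^ 4 = 1 := by rw [show J ^ 4 = J ^ 2 * J ^ 2 by ring, J2]; ring
  have J5 : J ^ 5 = J := by rw [show J ^ 5 = J ^ 4 * J by ring, J4]; ring
  have n1 : ∀ (m : ℕ) [m.AtLeastTwo], (C (ofNat(m) : ℂ) : ℂ[X]) = ofNat(m) := fun m _ ↦
    map_ofNat C m
  have main := periods_mem_of_local hI (numPoly_comp_neg n k) (L := 6 * n + 1) (J := 8 * n + 3)
    (by omega) (by omega) (by have := natDegree_numPoly_le n k; omega) (lam := lam) (c := c)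
    (μ := 32 ^ (4 * n)) hlam0 hc0 (by rw [add_tsub_cancel_right, hc1])
    (mem_locGauss_of_eq 5 1 1 (by norm_num) (by rw [hlam]; push_cast; ring))
    (numPoly_comp (m := C 125 + C ((225 : ℤ) + (225 : ℤ) * I) * X + C ((0 : ℤ) + (335 : ℤ) * I) * X ^ 2
        + C ((-128 : ℤ) + (128 : ℤ) * I) * X ^ 3 + C (((-50 : ℤ) + (0 : ℤ) * I)) * X ^ 4
        + C ((-4 : ℤ) + (-4 : ℤ) * I) * X ^ 5)
      (add_mem (lC (hn 5)) (mul_mem (lC hlamO) lX))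
      (add_mem (add_mem (add_mem (add_mem (add_mem (lC (hn 125)) (mul_mem (lC (hg _ _)) lX))
        (mul_mem (lC (hg _ _)) (pow_mem lX _))) (mul_mem (lC (hg _ _)) (pow_mem lX _)))
        (mul_mem (lC (hg _ _)) (pow_mem lX _))) (mul_mem (lC (hg _ _)) (pow_mem lX _)))
      (by
        simp only [hlam, C_add, C_mul, ← hJ, Int.cast_ofNat, Int.cast_neg, Int.cast_zero, C_neg,
          C_0, n1]
        ring_nf
        simp only [J2, J3, J4, J5]
        ring))
    (α := -1 + 2 * I) (β := lam) (ρ := 32 ^ (4 * n)) hlam0 (by simp)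
    (numPoly_comp (m := C ((-7 : ℤ) + (-1 : ℤ) * I) * X + C ((-4 : ℤ) + (23 : ℤ) * I) * X ^ 2
        + C ((32 : ℤ) + (8 : ℤ) * I) * X ^ 3 + C (((10 : ℤ) + (-20 : ℤ) * I)) * X ^ 4
        + C ((-4 : ℤ) + (-4 : ℤ) * I) * X ^ 5)
      (add_mem (lC (by simpa using hg (-1) 2)) (mul_mem (lC hlamO) lX))
      (add_mem (add_mem (add_mem (add_mem (mul_mem (lC (hg _ _)) lX)
        (mul_mem (lC (hg _ _)) (pow_mem lX _))) (mul_mem (lC (hg _ _)) (pow_mem lX _)))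
        (mul_mem (lC (hg _ _)) (pow_mem lX _))) (mul_mem (lC (hg _ _)) (pow_mem lX _)))
      (by
        simp only [hlam, C_add, C_mul, ← hJ, Int.cast_ofNat, Int.cast_neg, Int.cast_one, C_neg,
          C_1, n1]
        ring_nf
        simp only [J2, J3, J4, J5]
        ring))
    (ε := -28 - 4 * I) hε
    (by
      obtain ⟨w, hw⟩ := (mem_lifts _).mp (add_mem
        (lC (mem_locGauss_of_eq (p := 2) (hp := Nat.prime_two) (x := (2 - I) / 5) 5 2 (-1)
          (by norm_num) (by push_cast; ring)))
        (mul_mem (lC (mem_locGauss_of_eq (p := 2) (hp := Nat.prime_two) (x := (-1 - 7 * I) / 25)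
          25 (-1) (-7) (by norm_num) (by push_cast; ring))) lX))
      refine ⟨w, ?_⟩
      have e1 : C (-28 - 4 * I) * C ((2 - I) / 5) = (-12 + 4 * J : ℂ[X]) := by
        rw [← C_mul, hJ, ← n1, ← n1, ← C_neg, ← C_mul, ← C_add]
        congr 1
        linear_combination 4 / 5 * I_sq
      have e2 : C (-28 - 4 * I) * C ((-1 - 7 * I) / 25) = (8 * J : ℂ[X]) := by
        rw [← C_mul, hJ, ← n1, ← C_mul]
        congr 1
        linear_combination 28 / 25 * I_sq
      rw [Polynomial.map_add, Polynomial.map_mul, hw, Polynomial.map_one, map_X]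
      have e3 : C (-28 - 4 * I) = (-28 - 4 * J : ℂ[X]) := by
        simp only [C_sub, C_mul, C_neg, n1, hJ]
      rw [show C (-28 - 4 * I) * (1 + X * (C ((2 - I) / 5) + C ((-1 - 7 * I) / 25) * X)) =
        (-28 - 4 * J + X * (-12 + 4 * J) + X ^ 2 * (8 * J) : ℂ[X]) by
          linear_combination e3 + X * e1 + X ^ 2 * e2]
      simp only [hlam, C_add, C_mul, C_neg, C_1, n1, ← hJ]
      linear_combination (4 * X ^ 2 + 8 * X + 4) * J2)
    (κ₁ := lam) (κ₂ := 2)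
    (exists_eq_C_mul_map (P' := C ((-1 : ℤ) + (2 : ℤ) * I) + X) (add_mem (lC (hg _ _)) lX) (by
      simp only [hlam, C_add, C_mul, ← hJ, Int.cast_ofNat, Int.cast_neg, Int.cast_one, C_neg,
        C_1, n1]
      linear_combination (-4) * J2))
    (exists_eq_C_mul_map (P' := C ((2 : ℤ) + (1 : ℤ) * I) + C ((1 : ℤ) + (1 : ℤ) * I) * X)
      (add_mem (lC (hg _ _)) (mul_mem (lC (hg _ _)) lX)) (by
      simp only [hlam, C_add, C_mul, ← hJ, Int.cast_ofNat, Int.cast_one, C_neg, C_1, n1]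
      ring))
    (r₁ := 1) (r₂ := 1 + I) (r₃ := ((5 : ℕ) : ℂ)⁻¹ ^ (6 * n + 1))
    (r₄ := ((-4 - 3 * I) / 5) ^ (6 * n + 1))
    O.one_mem (O.add_mem O.one_mem hI) (O.pow_mem (inv_natCast_mem_locGauss (by norm_num)) _)
    (O.pow_mem (mem_locGauss_of_eq 5 (-4) (-3) (by norm_num) (by push_cast; ring)) _)
    (by ring) (by rw [hlam]; ring)
    (by
      rw [add_tsub_cancel_right, ← hc1]
      have : (10 : ℂ) * ((5 : ℕ) : ℂ)⁻¹ = 2 := by norm_num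
      rw [← this, mul_pow]
      ring)
    (by
      have : (-28 - 4 * I) * ((-4 - 3 * I) / 5) = 10 * lam := by
        rw [hlam]; linear_combination 12 / 5 * I_sq
      rw [mul_assoc, ← mul_pow, this, ← hc1]
      ring)
    (v₁ := -1 - I) (v₂ := 0) (O.sub_mem (O.neg_mem O.one_mem) hI) O.zero_mem
    (by rw [hlam]; linear_combination 2 * I_sq) (by ring)
    (mem_locGauss_of_eq 5 (-1) (-2) (by norm_num)
      (by rw [inv_neg_six_add, hlam]; push_cast; linear_combination -1 / 2 * I_sq))
    (mem_locGauss_of_eq 5 (-2) (-1) (by norm_num)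
      (by rw [inv_neg_six_sub, hlam]; push_cast; linear_combination 1 / 2 * I_sq))
    (mem_locGauss_of_eq 5 (-3) (-1) (by norm_num)
      (by rw [inv_neg_four_sub, hlam]; push_cast; linear_combination 1 * I_sq))
    (mem_locGauss_of_eq 5 (-1) (-3) (by norm_num)
      (by rw [inv_neg_four_add, hlam]; push_cast; linear_combination -1 * I_sq))
    (D := D) fun j h1 h2 ↦ div_natCast_mem_of_dvd (hD j h1 h2)
  have hinv : ((5 ^ (6 * n + 1) : ℕ) : ℂ) * (2 / 2 ^ (5 * n)) = I ^ (9 * n) * c⁻¹ := by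
    have e1 : lam ^ (6 * n) = 2 ^ (9 * n) * I ^ (3 * n) := by
      have : lam ^ 6 = 2 ^ 9 * I ^ 3 := by
        rw [show lam ^ 6 = (lam ^ 2) ^ 3 by ring, show lam ^ 2 = 8 * I by
          rw [hlam]; linear_combination 4 * I_sq]
        ring
      rw [pow_mul, this, mul_pow, ← pow_mul, ← pow_mul]
    have e2 : I ^ (9 * n) * I ^ (3 * n) = 1 := by
      rw [← pow_add, show 9 * n + 3 * n = 4 * (3 * n) by ring, pow_mul, I_pow_four, one_pow]
    rw [hc, inv_div, e1, show (10 : ℂ) = 5 * 2 by norm_num, show (32 : ℂ) = 2 ^ 5 by norm_num,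
      ← pow_mul, mul_pow]
    push_cast
    calc _ = (5 : ℂ) ^ (6 * n + 1) * (2 / 2 ^ (5 * n)) * (I ^ (9 * n) * I ^ (3 * n)) := by
          rw [e2, mul_one]
      _ = _ := by
        field_simp
        rw [show 5 * (4 * n) = 5 * n + (6 * n + 9 * n) by ring]
        ring
  have h5 : ¬2 ∣ 5 ^ (6 * n + 1) := fun h ↦
    absurd (Nat.Prime.dvd_of_dvd_pow Nat.prime_two h) (by norm_num)
  constructor
  · refine mem_locGauss_of_mul h5 (O.mul_mem (O.pow_mem hI (9 * n)) main.1) ?_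
    rw [← mul_assoc, ← mul_assoc, hinv]
    unfold integrand; ring
  · refine mem_locGauss_of_mul h5 (O.mul_mem (O.pow_mem hI (9 * n)) main.2) ?_
    rw [show (4 : ℂ) / 2 ^ (5 * n) = 2 / 2 ^ (5 * n) * 2 by ring, ← mul_assoc, ← mul_assoc, hinv]
    unfold integrand; ring

end LocalizationTwo

section SavedPrimes

open Polynomial Complex

theorem exists_pow_mul_eq_expand_add {p : ℕ} (hp : p.Prime) (f : ℤ[X]) (a : ℕ) :
    ∃ g : ℤ[X], f ^ (p * a) = expand ℤ p (f ^ a) + C (p : ℤ) * g := by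
  have := Fact.mk hp
  have h : C (p : ℤ) ∣ f ^ (p * a) - expand ℤ p (f ^ a) := by
    rw [C_dvd_iff_dvd_coeff]
    intro i
    rw [← ZMod.intCast_zmod_eq_zero_iff_dvd]
    have : ((f ^ (p * a) - expand ℤ p (f ^ a)).map (Int.castRingHom (ZMod p))) = 0 := by
      rw [Polynomial.map_sub, map_expand, Polynomial.map_pow, Polynomial.map_pow,
        ZMod.expand_card, ← pow_mul, mul_comm, sub_self]
    have h1 := congrArg (fun q : (ZMod p)[X] ↦ q.coeff i) this
    rw [coeff_map, coeff_zero] at h1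
    exact h1
  obtain ⟨g, hg⟩ := h
  exact ⟨g, by linear_combination hg⟩

theorem coeff_comp_neg_X {R : Type*} [CommRing R] (f : R[X]) (i : ℕ) :
    (f.comp (-X)).coeff i = f.coeff i * (-1) ^ i := by
  rw [show (-X : R[X]) = C (-1) * X by simp, comp_C_mul_X_coeff]

theorem coeff_eq_zero_of_odd {f : ℤ[X]} (hf : f.comp (-X) = -f) {i : ℕ} (hi : Even i) :
    f.coeff i = 0 := by
  have := coeff_comp_neg_X f i
  rw [hf, hi.neg_one_pow, coeff_neg] at this
  omega

theorem coeff_eq_zero_of_even {f : ℤ[X]} (hf : f.comp (-X) = f) {i : ℕ} (hi : Odd i) :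
    f.coeff i = 0 := by
  have := coeff_comp_neg_X f i
  rw [hf, hi.neg_one_pow] at this
  omega

theorem coeff_expand_mul_eq_zero {p : ℕ} (hp : p.Prime) (hp2 : p ≠ 2) (f : ℤ[X]) {W : ℤ[X]}
    (hW : W.comp (-X) = -W) (hdeg : W.natDegree < 2 * p - 1) {e : ℕ} (he : p ∣ e + 1) :
    (expand ℤ p f * W).coeff e = 0 := by
  rw [coeff_mul]
  refine Finset.sum_eq_zero fun x hx ↦ ?_
  rw [Finset.HasAntidiagonal.mem_antidiagonal] at hx
  rw [coeff_expand hp.pos]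
  split_ifs with h1
  · have h2 : p ∣ x.2 + 1 := by
      rw [← hx, add_assoc] at he
      exact (Nat.dvd_add_right h1).mp he
    obtain ⟨m, hm⟩ := h2
    have hodd := hp.odd_of_ne_two hp2
    have : W.coeff x.2 = 0 := by
      rcases lt_or_ge m 2 with h | h
      · interval_cases m
        · omega
        · refine coeff_eq_zero_of_odd hW ?_
          rw [mul_one] at hm
          rcases hodd with ⟨r, hr⟩
          exact ⟨r, by omega⟩
      · refine coeff_eq_zero_of_natDegree_lt ?_
        have : p * 2 ≤ p * m := Nat.mul_le_mul_left p h
        omega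
    rw [this, mul_zero]
  · simp

/-- The odd antiderivative of the image in `ℂ[X]` of an even integer polynomial. -/
noncomputable def antideriv (V : ℤ[X]) : ℂ[X] :=
  ∑ e ∈ Finset.range (V.natDegree + 1), C ((V.coeff e : ℂ) / ((e + 1 : ℕ) : ℂ)) * X ^ (e + 1)

theorem antideriv_comp_neg_X {V : ℤ[X]} (hV : V.comp (-X) = V) :
    (antideriv V).comp (-X) = -antideriv V := by
  simp only [antideriv, Polynomial.sum_comp, mul_comp, C_comp, pow_comp, X_comp]
  rw [← Finset.sum_neg_distrib]
  refine Finset.sum_congr rfl fun e _ ↦ ?_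
  rcases Nat.even_or_odd e with h | h
  · rw [(h.add_one).neg_pow, mul_neg]
  · simp [coeff_eq_zero_of_even hV h]

theorem natDegree_antideriv_le (V : ℤ[X]) : (antideriv V).natDegree ≤ V.natDegree + 1 := by
  refine natDegree_sum_le_of_forall_le _ _ fun e he ↦ (natDegree_C_mul_X_pow_le _ _).trans ?_
  have := Finset.mem_range.mp he
  omega

theorem derivative_antideriv (V : ℤ[X]) :
    derivative (antideriv V) = V.map (Int.castRingHom ℂ) := by
  conv_rhs => rw [V.as_sum_range_C_mul_X_pow]
  simp only [antideriv, derivative_sum, derivative_C_mul_X_pow, Polynomial.map_sum,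
    Polynomial.map_mul, map_C, Polynomial.map_pow, map_X]
  refine Finset.sum_congr rfl fun e _ ↦ ?_
  rw [div_mul_cancel₀ _ (by exact_mod_cast e.succ_ne_zero)]
  simp

theorem map_intCast_mem_lifts {O : Subring ℂ} (V : ℤ[X]) :
    V.map (Int.castRingHom ℂ) ∈ lifts O.subtype :=
  (mem_lifts _).mpr ⟨V.map (Int.castRingHom O), by
    rw [Polynomial.map_map]; congr 1⟩

theorem antideriv_mem_lifts {p : ℕ} {hp : p.Prime} {V : ℤ[X]}
    (hV : ∀ e, p ∣ e + 1 → V.coeff e = 0) : antideriv V ∈ lifts (locGauss p hp).subtype := by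
  refine sum_mem fun e _ ↦ mul_mem (C_mem_lifts_subtype ?_) (pow_mem (X_mem_lifts _) _)
  by_cases h : p ∣ e + 1
  · simp [hV e h]
  · rw [div_eq_mul_inv]
    exact mul_mem (intCast_mem _ _) (inv_natCast_mem_locGauss h)

theorem natCast_div_mem_locGauss {p : ℕ} (hp : p.Prime) {j : ℕ} (h1 : 1 ≤ j) (h2 : j < p ^ 2) :
    (p : ℂ) / j ∈ locGauss p hp := by
  by_cases h : p ∣ j
  · obtain ⟨m, rfl⟩ := h
    have hm : ¬p ∣ m := by
      rintro ⟨l, rfl⟩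
      have : 1 ≤ l := by
        rcases Nat.eq_zero_or_pos l with rfl | h
        · simp at h1
        · exact h
      nlinarith [Nat.mul_le_mul_left (p ^ 2) this]
    have : (p : ℂ) ≠ 0 := by exact_mod_cast hp.ne_zero
    convert inv_natCast_mem_locGauss (hp := hp) hm using 1
    push_cast
    field_simp
  · rw [div_eq_mul_inv]
    exact mul_mem (natCast_mem _ _) (inv_natCast_mem_locGauss h)

theorem not_dvd_of_ne {p : ℕ} (hp : p.Prime) (h2 : p ≠ 2) (h5 : p ≠ 5) (i j : ℕ) :
    ¬p ∣ 2 ^ i * 5 ^ j := by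
  intro h
  rcases (Nat.Prime.dvd_mul hp).mp h with h | h
  · exact h2 ((Nat.prime_dvd_prime_iff_eq hp Nat.prime_two).mp (hp.dvd_of_dvd_pow h))
  · exact h5 ((Nat.prime_dvd_prime_iff_eq hp Nat.prime_five).mp (hp.dvd_of_dvd_pow h))

theorem ratPart_mem_locGauss_of_saved {p : ℕ} (hp : p.Prime) (h12 : 12 < p) {n k a b s t : ℕ}
    (hk : k ≤ 2) (h4 : 4 * n = p * a + s) (h6 : 6 * n = p * b + t) (hs : Odd s) (ht : t < p)
    (hdeg : 5 * s + 2 * k + 2 * (p - 1 - t) < 2 * p - 1) (hp4 : p ≤ 4 * n)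
    (hsq : 10 * n + 4 < p ^ 2) : ratPart (integrand n k) ∈ locGauss p hp := by
  set O := locGauss p hp with hO
  have hI : I ∈ O := I_mem_locGauss
  have hp2 : p ≠ 2 := by omega
  have hp5 : p ≠ 5 := by omega
  have hodd := hp.odd_of_ne_two hp2
  have ha : Odd a := by
    rcases Nat.even_or_odd a with h | h
    · exfalso
      have h1 : Odd (p * a + s) := (h.mul_left p).add_odd hs
      rw [← h4] at h1
      exact (Nat.not_even_iff_odd.mpr h1) ⟨2 * n, by ring⟩
    · exact h
  set M : ℤ[X] := X * (X ^ 4 + 6 * X ^ 2 + 25) with hM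
  set E : ℤ[X] := (X - 5) * (X + 5) with hE
  have hMneg : M.comp (-X) = -M := by
    simp only [hM, mul_comp, pow_comp, add_comp, X_comp, ofNat_comp, Nat.cast_ofNat]
    ring
  have hEneg : E.comp (-X) = E := by
    simp only [hE, mul_comp, sub_comp, add_comp, X_comp, ofNat_comp, Nat.cast_ofNat]
    ring
  have hMdeg : M.natDegree ≤ 5 := by rw [hM]; compute_degree
  have hEdeg : E.natDegree ≤ 2 := by
    rw [hE, show ((X - 5) * (X + 5) : ℤ[X]) = X ^ 2 - 25 by ring]; compute_degree
  set W : ℤ[X] := M ^ s * X ^ (2 * k) * E ^ (p - 1 - t) with hW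
  have hWneg : W.comp (-X) = -W := by
    simp only [hW, mul_comp, pow_comp, X_comp, hMneg, hEneg]
    rw [hs.neg_pow, (even_two_mul k).neg_pow]
    ring
  have hWdeg : W.natDegree ≤ 5 * s + 2 * k + 2 * (p - 1 - t) := by
    refine natDegree_mul_le_of_le (natDegree_mul_le_of_le ?_ (by simp)) ?_
    · exact (natDegree_pow_le_of_le s hMdeg).trans (by omega)
    · exact (natDegree_pow_le_of_le _ hEdeg).trans (by omega)
  obtain ⟨g, hg⟩ := exists_pow_mul_eq_expand_add hp M a
  set V : ℤ[X] := expand ℤ p (M ^ a) * W with hV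
  have hVneg : V.comp (-X) = V := by
    have : (expand ℤ p (M ^ a)).comp (-X) = -expand ℤ p (M ^ a) := by
      rw [expand_eq_comp_X_pow, comp_assoc, X_pow_comp, hodd.neg_pow,
        ← neg_comp, ← ha.neg_pow, ← hMneg, ← pow_comp, comp_assoc]
      simp
    rw [hV, mul_comp, this, hWneg, neg_mul_neg]
  set N : ℤ[X] := M ^ (p * a) * W with hN
  have hNneg : N.comp (-X) = N := by
    simp only [hN, mul_comp, pow_comp, hMneg, hWneg, (hodd.mul ha).neg_pow, neg_mul_neg]
  have hNV : N = V + C (p : ℤ) * (g * W) := by rw [hN, hg, hV]; ring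
  have hgneg : (g * W).comp (-X) = g * W := by
    have h1 : C (p : ℤ) * (g * W) = N - V := by rw [hNV]; ring
    have h2 : (C (p : ℤ) * (g * W)).comp (-X) = (N - V).comp (-X) := by rw [h1]
    rw [mul_comp, C_comp, sub_comp, hNneg, hVneg, ← h1] at h2
    exact mul_left_cancel₀ (C_ne_zero.mpr (by exact_mod_cast hp.ne_zero)) h2
  set d : ℕ := 20 * n + 2 * k + 2 * (p - 1 - t) with hd
  have hVdeg : V.natDegree ≤ d := by
    refine (natDegree_mul_le_of_le ((natDegree_expand _ _).trans_le
      (Nat.mul_le_mul_right p (natDegree_pow_le_of_le a hMdeg))) hWdeg).trans ?_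
    have : a * 5 * p = 5 * (p * a) := by ring
    omega
  have hNdeg : N.natDegree ≤ d := by
    refine (natDegree_mul_le_of_le (natDegree_pow_le_of_le _ hMdeg) hWdeg).trans ?_
    omega
  have hgdeg : (g * W).natDegree ≤ d := by
    have h1 : C (p : ℤ) * (g * W) = N - V := by rw [hNV]; ring
    rw [← natDegree_C_mul (a := (p : ℤ)) (by exact_mod_cast hp.ne_zero), h1]
    exact (natDegree_sub_le_of_le hNdeg hVdeg).trans (by simp)
  set B : ℕ := b + 1 with hB
  set φ := Int.castRingHom ℂ with hφ
  have hpB : p * B = 6 * n + 1 + (p - 1 - t) := by rw [hB, mul_add]; omega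
  set Z := antideriv V with hZ
  have hZO : Z ∈ lifts O.subtype := antideriv_mem_lifts fun e he ↦
    coeff_expand_mul_eq_zero hp hp2 _ hWneg (hWdeg.trans_lt hdeg) he
  set H : ℂ[X] := C ((2 * B : ℕ) : ℂ) * X * Z + (g * W * E).map φ with hH
  have hHO : H ∈ lifts O.subtype := add_mem (mul_mem (mul_mem
    (C_mem_lifts_subtype (natCast_mem _ _)) (X_mem_lifts _)) hZO) (map_intCast_mem_lifts _)
  have hHneg : H.comp (-X) = H := by
    have h1 : ((g * W * E).map φ).comp (-X) = (g * W * E).map φ := by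
      rw [show (-X : ℂ[X]) = (-X : ℤ[X]).map φ by simp, ← Polynomial.map_comp, mul_comp (g * W),
        hgneg, hEneg]
    rw [hH, add_comp, h1, mul_comp, mul_comp, C_comp, X_comp, hZ, antideriv_comp_neg_X hVneg]
    ring
  have hHdeg : H.natDegree ≤ d + 2 := by
    refine (natDegree_add_le_of_degree_le ?_ ((natDegree_map_le).trans
      (natDegree_mul_le_of_le hgdeg hEdeg)))
    rw [mul_assoc]
    refine (natDegree_C_mul_le _ _).trans ((natDegree_mul_le_of_le natDegree_X_le
      ((natDegree_antideriv_le V).trans (Nat.succ_le_succ hVdeg))).trans (by omega))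
  have hEe : ∀ y : ℂ, (E.map φ).eval y = (y - 5) * (y + 5) := fun y ↦ by
    simp [hE]
  have hsplit : Set.EqOn (integrand n k) (fun y ↦
      ((V.map φ).eval y / ((y - 5) * (y + 5)) ^ (p * B) -
        (p * B : ℕ) * (2 * y) * Z.eval y / ((y - 5) * (y + 5)) ^ (p * B + 1)) +
      p * (H.eval y / ((y - 5) * (y + 5)) ^ (p * B + 1))) regSet := by
    intro y hy
    have hE0 : (y - 5) * (y + 5) ≠ 0 := mul_ne_zero hy.1 hy.2
    have hnum : (numPoly n k).eval y * ((y - 5) * (y + 5)) ^ (p - 1 - t) =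
        (V.map φ).eval y + p * ((g * W).map φ).eval y := by
      have h1 : numPoly n k * (E.map φ) ^ (p - 1 - t) = N.map φ := by
        have h2 : numPoly n k = (M ^ (4 * n) * X ^ (2 * k)).map φ := by
          simp [numPoly, hM]
        rw [h2, ← Polynomial.map_pow, ← Polynomial.map_mul, hN, hW, h4]
        congr 1
        ring
      have h2 := congrArg (Polynomial.eval y) h1
      have h3 : (C (p : ℤ) * (g * W)).map φ = C (p : ℂ) * (g * W).map φ := by
        rw [Polynomial.map_mul (p := C (p : ℤ)), map_C, hφ, eq_intCast, Int.cast_natCast]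
      rw [hNV, eval_mul, eval_pow, hEe, Polynomial.map_add, eval_add, h3, eval_mul, eval_C] at h2
      exact h2
    have hHe : H.eval y = (2 * B : ℕ) * y * Z.eval y + ((g * W).map φ).eval y *
        ((y - 5) * (y + 5)) := by
      rw [hH, Polynomial.map_mul (p := g * W)]
      simp only [eval_add, eval_mul, eval_C, eval_X, hEe]
    have hi : integrand n k y = ((V.map φ).eval y + p * ((g * W).map φ).eval y) /
        ((y - 5) * (y + 5)) ^ (p * B) := by
      rw [← hnum, integrand, hpB, pow_add _ (6 * n + 1), mul_div_mul_right _ _ (pow_ne_zero _ hE0)]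
    simp only
    rw [hi, hHe]
    have hE1 := pow_ne_zero (p * B) hE0
    rw [pow_succ]
    push_cast
    generalize ((y - 5) * (y + 5)) ^ (p * B) = e at hE1 ⊢
    generalize (y - 5) * (y + 5) = e' at hE0 ⊢
    field_simp
    ring
  have hc0 : ∀ y ∈ regSet, ∀ m : ℕ, ((y - 5) * (y + 5)) ^ m ≠ 0 := fun y hy m ↦
    pow_ne_zero _ (mul_ne_zero hy.1 hy.2)
  have hcE : ∀ m : ℕ, ContinuousOn (fun y : ℂ ↦ ((y - 5) * (y + 5)) ^ m) regSet := fun m ↦ by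
    fun_prop
  have hc1 : ContinuousOn (fun y ↦ (V.map φ).eval y / ((y - 5) * (y + 5)) ^ (p * B) -
        (p * B : ℕ) * (2 * y) * Z.eval y / ((y - 5) * (y + 5)) ^ (p * B + 1)) regSet :=
    ((continuousOn_eval_regSet _).div (hcE _) fun y hy ↦ hc0 y hy _).sub
      (((by fun_prop : ContinuousOn (fun y : ℂ ↦ ((p * B : ℕ) : ℂ) * (2 * y)) regSet).mul
        (continuousOn_eval_regSet _)).div (hcE _) fun y hy ↦ hc0 y hy _)
  have hc2 : ContinuousOn (fun y ↦ H.eval y / ((y - 5) * (y + 5)) ^ (p * B + 1)) regSet :=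
    (continuousOn_eval_regSet _).div (hcE _) fun y hy ↦ hc0 y hy _
  have hc3 : ContinuousOn (fun y ↦ (p : ℂ) *
      (H.eval y / ((y - 5) * (y + 5)) ^ (p * B + 1))) regSet := continuousOn_const.mul hc2
  rw [ratPart_congr hsplit, ratPart_add hc1 hc3, ratPart_const_mul]
  refine O.add_mem ?_ ?_
  · rw [ratPart_of_hasDerivAt (G := fun y ↦ Z.eval y / ((y - 5) * (y + 5)) ^ (p * B)) hc1]
    · have hval : ∀ y ∈ O, ((y - 5) * (y + 5))⁻¹ ∈ O →
          Z.eval y / ((y - 5) * (y + 5)) ^ (p * B) ∈ O := by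
        intro y hy hy'
        rw [div_eq_mul_inv, ← inv_pow]
        refine O.mul_mem ?_ (O.pow_mem hy' _)
        obtain ⟨z, hz⟩ := (mem_lifts _).mp hZO
        rw [← hz, show y = O.subtype ⟨y, hy⟩ from rfl, eval_map_apply]
        exact Subtype.coe_prop _
      have hmem : ∀ u v : ℤ, (u + v * I : ℂ) ∈ O := fun u v ↦
        O.add_mem (intCast_mem _ _) (O.mul_mem (intCast_mem _ _) hI)
      have h200 : ¬p ∣ 200 := not_dvd_of_ne hp hp2 hp5 3 2
      refine O.mul_mem (O.neg_mem hI) (O.sub_mem (hval _ ?_ ?_) (hval _ ?_ ?_))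
      · simpa using hmem (-1) 2
      · refine mem_locGauss_of_eq 200 (-7) 1 h200 ?_
        rw [mul_inv_eq_iff_eq_mul₀]
        · push_cast; linear_combination (32 - 4 * I) * I_sq
        · intro h; have := congrArg Complex.re h; norm_num at this
      · simpa [sub_eq_add_neg] using hmem (-1) (-2)
      · refine mem_locGauss_of_eq 200 (-7) (-1) h200 ?_
        rw [mul_inv_eq_iff_eq_mul₀]
        · push_cast; linear_combination (32 + 4 * I) * I_sq
        · intro h; have := congrArg Complex.re h; norm_num at this
    · intro y hy
      have hE0 : (y - 5) * (y + 5) ≠ 0 := mul_ne_zero hy.1 hy.2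
      have d1 : HasDerivAt (fun y ↦ Z.eval y) ((V.map φ).eval y) y := by
        rw [← derivative_antideriv]; exact Z.hasDerivAt y
      have d2 : HasDerivAt (fun y : ℂ ↦ (y - 5) * (y + 5)) (2 * y) y :=
        (((hasDerivAt_id y).sub_const 5).mul ((hasDerivAt_id y).add_const 5)).congr_deriv
          (by simp; ring)
      refine (d1.fun_div (d2.fun_pow (p * B)) (pow_ne_zero _ hE0)).congr_deriv ?_
      have hpB1 : p * B = (p * B - 1) + 1 := by omega
      generalize p * B - 1 = m at hpB1
      rw [hpB1]
      generalize (y - 5) * (y + 5) = e' at hE0 ⊢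
      field_simp
      ring
  · have hJ := periods_mem_of_inv_ten_mem (O := O) hI (J := 10 * n + 3)
      (inv_natCast_mem_locGauss (b := 10) (not_dvd_of_ne hp hp2 hp5 1 1)) hHneg hHO
      (L := p * B + 1) (by omega) (by omega) (by omega) (D := p) fun j h1 h2 ↦
        natCast_div_mem_locGauss hp h1 (by omega)
    exact hJ.1

end SavedPrimes

section IntegerMultiples

open Complex

/-- Primes dividing the common denominator whose contribution cancels. -/
def savedPrimes (n : ℕ) : Finset ℕ :=
  {p ∈ Finset.range (4 * n + 1) | p.Prime ∧ 12 < p ∧ 10 * n + 4 < p ^ 2 ∧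
    ((p ≤ 4 * (n % p) ∧ 3 * (n % p) < p) ∨ (3 * p ≤ 4 * (n % p) ∧ 6 * (n % p) < 5 * p))}

theorem ratPart_mem_locGauss_of_mem_savedPrimes {n k p : ℕ} (hp : p.Prime) (h : p ∈ savedPrimes n)
    (hk : k ≤ 2) : ratPart (integrand n k) ∈ locGauss p hp := by
  simp only [savedPrimes, Finset.mem_filter, Finset.mem_range] at h
  obtain ⟨h4, -, h12, hsq, h⟩ := h
  have hodd := hp.odd_of_ne_two (by omega)
  have hn := Nat.div_add_mod n p
  set r := n % p
  set m := n / p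
  rcases h with ⟨h1, h2⟩ | ⟨h1, h2⟩
  · refine ratPart_mem_locGauss_of_saved hp h12 (a := 4 * m + 1) (b := 6 * m + 1)
      (s := 4 * r - p) (t := 6 * r - p) hk ?_ ?_ ?_ (by omega) (by omega) (by omega) hsq
    · rw [mul_add, mul_one, mul_left_comm]; omega
    · rw [mul_add, mul_one, mul_left_comm]; omega
    · obtain ⟨l, hl⟩ := hodd
      exact ⟨2 * r - l - 1, by omega⟩
  · refine ratPart_mem_locGauss_of_saved hp h12 (a := 4 * m + 3) (b := 6 * m + 4)
      (s := 4 * r - 3 * p) (t := 6 * r - 4 * p) hk ?_ ?_ ?_ (by omega) (by omega) (by omega) hsq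
    · rw [mul_add, mul_left_comm]; omega
    · rw [mul_add, mul_left_comm]; omega
    · obtain ⟨l, hl⟩ := hodd
      exact ⟨2 * r - 3 * l - 2, by omega⟩

theorem prime_of_mem_savedPrimes {n p : ℕ} (h : p ∈ savedPrimes n) : p.Prime :=
  (Finset.mem_filter.mp h).2.1

theorem prod_savedPrimes_dvd {n D : ℕ} (hD : ∀ j, 1 ≤ j → j ≤ 8 * n + 3 → j ∣ D) :
    ∏ p ∈ savedPrimes n, p ∣ D := by
  refine Finset.prod_primes_dvd D (fun p hp ↦ (prime_of_mem_savedPrimes hp).prime) fun p hp ↦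
    hD p (prime_of_mem_savedPrimes hp).one_le ?_
  have := Finset.mem_range.mp (Finset.mem_filter.mp hp).1
  omega

theorem periods_mem_gaussRing {n k D Q : ℕ} (hk : k ≤ 2)
    (hD : ∀ j, 1 ≤ j → j ≤ 8 * n + 3 → j ∣ D) (hQ : D = (∏ p ∈ savedPrimes n, p) * Q) :
    20 * Q / 2 ^ (5 * n) * ratPart (integrand n k) ∈ gaussRing ∧
      20 * Q / 2 ^ (5 * n) * halfRes (integrand n k) ∈ gaussRing := by
  set Δ := ∏ p ∈ savedPrimes n, p with hΔ
  have hΔ0 : (Δ : ℂ) ≠ 0 := by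
    exact_mod_cast Finset.prod_ne_zero_iff.mpr fun p hp ↦ (prime_of_mem_savedPrimes hp).ne_zero
  have hΔp : ∀ p (hp : p.Prime), p ∉ savedPrimes n → (Δ : ℂ)⁻¹ ∈ locGauss p hp := by
    refine fun p hp h ↦ inv_natCast_mem_locGauss fun hd ↦ h ?_
    obtain ⟨q, hq, hpq⟩ := (hp.prime.dvd_finsetProd_iff _).mp hd
    rwa [(Nat.prime_dvd_prime_iff_eq hp (prime_of_mem_savedPrimes hq)).mp hpq]
  have h2p : ∀ p (hp : p.Prime), p ≠ 2 → ((2 : ℂ) ^ (5 * n))⁻¹ ∈ locGauss p hp := by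
    intro p hp h
    have := inv_natCast_mem_locGauss (hp := hp) (b := 2 ^ (5 * n)) fun hd ↦
      h ((Nat.prime_dvd_prime_iff_eq hp Nat.prime_two).mp (hp.dvd_of_dvd_pow hd))
    simpa using this
  have hDQ : (D : ℂ) = Δ * Q := by rw [hQ]; push_cast; rfl
  have hn : ∀ p (hp : p.Prime) (m : ℕ), (m : ℂ) ∈ locGauss p hp := fun p hp m ↦ natCast_mem _ m
  have hsmall : ∀ p, p ≤ 12 → p ∉ savedPrimes n := fun p hp h ↦ by
    have := (Finset.mem_filter.mp h).2.2.1
    omega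
  constructor <;> refine mem_gaussRing_of_forall_mem_locGauss fun p hp ↦ ?_
  · by_cases h2 : p = 2
    · subst h2
      convert mul_mem (mul_mem (hn 2 hp 10) (hΔp 2 hp (hsmall 2 (by norm_num))))
        (periods_mem_locGauss_two hk hD).1 using 1
      rw [hDQ]; push_cast; field_simp; ring
    by_cases hs : p ∈ savedPrimes n
    · convert mul_mem (mul_mem (hn p hp (20 * Q)) (h2p p hp h2))
        (ratPart_mem_locGauss_of_mem_savedPrimes hp hs hk) using 1
      push_cast; field_simp
    by_cases h5 : p = 5
    · subst h5
      convert mul_mem (mul_mem (mul_mem (hn 5 hp 4) (h2p 5 hp h2)) (hΔp 5 hp hs))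
        (periods_mem_locGauss_five hk hD).1 using 1
      rw [hDQ]; push_cast; field_simp; ring
    · convert mul_mem (mul_mem (mul_mem (hn p hp 20) (h2p p hp h2)) (hΔp p hp hs))
        (periods_mem_locGauss hp h2 h5 hk hD).1 using 1
      rw [hDQ]; push_cast; field_simp
  · by_cases h2 : p = 2
    · subst h2
      convert mul_mem (hn 2 hp (5 * Q)) (periods_mem_locGauss_two hk hD).2 using 1
      push_cast; field_simp; ring
    by_cases h5 : p = 5
    · subst h5
      convert mul_mem (mul_mem (hn 5 hp (2 * Q)) (h2p 5 hp h2))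
        (periods_mem_locGauss_five hk hD).2 using 1
      push_cast; field_simp; ring
    · convert mul_mem (mul_mem (hn p hp (10 * Q)) (h2p p hp h2))
        (periods_mem_locGauss hp h2 h5 hk hD).2 using 1
      push_cast; field_simp; ring

end IntegerMultiples

section SavedPrimesAsymptotics

open Filter Topology Chebyshev

theorem theta_sub_theta {x y : ℝ} (hxy : x ≤ y) :
    θ y - θ x = ∑ p ∈ Finset.Ioc ⌊x⌋₊ ⌊y⌋₊ with p.Prime, Real.log p := by
  have h : Finset.Ioc 0 ⌊y⌋₊ = Finset.Ioc 0 ⌊x⌋₊ ∪ Finset.Ioc ⌊x⌋₊ ⌊y⌋₊ :=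
    (Finset.Ioc_union_Ioc_eq_Ioc (Nat.zero_le _) (Nat.floor_mono hxy)).symm
  have hd : Disjoint (Finset.Ioc 0 ⌊x⌋₊) (Finset.Ioc ⌊x⌋₊ ⌊y⌋₊) := by
    rw [Finset.disjoint_left]
    intro a h1 h2
    have := (Finset.mem_Ioc.mp h1).2
    have := (Finset.mem_Ioc.mp h2).1
    omega
  rw [theta, theta, h, Finset.filter_union, Finset.sum_union (Finset.disjoint_filter_filter hd)]
  ring

/-- A lower bound for the weight of the saved primes `p` with `n / p = k`. -/
noncomputable def fiberBound (n : ℝ) (k : ℕ) : ℝ :=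
  (θ (n * (4 / (4 * k + 1))) - θ (n * (3 / (3 * k + 1)))) +
    (θ (n * (4 / (4 * k + 3))) - θ (n * (6 / (6 * k + 5))))

theorem fiberBound_le {n k K : ℕ} (hk : k < K) (hn : 200 * K ^ 2 ≤ n) :
    fiberBound n k ≤ ∑ p ∈ savedPrimes n with n / p = k, Real.log p := by
  have e1 : (n : ℝ) * (3 / (3 * k + 1)) ≤ n * (4 / (4 * k + 1)) := by
    gcongr ?_ * ?_
    rw [div_le_div_iff₀ (by positivity) (by positivity)]
    linarith
  have e2 : (n : ℝ) * (6 / (6 * k + 5)) ≤ n * (4 / (4 * k + 3)) := by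
    gcongr ?_ * ?_
    rw [div_le_div_iff₀ (by positivity) (by positivity)]
    linarith
  have mem1 : ∀ p ∈ Finset.Ioc ⌊(n : ℝ) * (3 / (3 * k + 1))⌋₊ ⌊(n : ℝ) * (4 / (4 * k + 1))⌋₊,
      3 * n < p * (3 * k + 1) ∧ p * (4 * k + 1) ≤ 4 * n := by
    intro p hp
    rw [Finset.mem_Ioc, Nat.floor_lt (by positivity), Nat.le_floor_iff (by positivity), ← mul_div_assoc,
      ← mul_div_assoc, div_lt_iff₀ (by positivity), le_div_iff₀ (by positivity)] at hp
    constructor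
    · have := hp.1; rw [mul_comm]; exact_mod_cast this
    · have := hp.2; rw [mul_comm 4 n]; exact_mod_cast this
  have mem2 : ∀ p ∈ Finset.Ioc ⌊(n : ℝ) * (6 / (6 * k + 5))⌋₊ ⌊(n : ℝ) * (4 / (4 * k + 3))⌋₊,
      6 * n < p * (6 * k + 5) ∧ p * (4 * k + 3) ≤ 4 * n := by
    intro p hp
    rw [Finset.mem_Ioc, Nat.floor_lt (by positivity), Nat.le_floor_iff (by positivity), ← mul_div_assoc,
      ← mul_div_assoc, div_lt_iff₀ (by positivity), le_div_iff₀ (by positivity)] at hp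
    constructor
    · have := hp.1; rw [mul_comm]; exact_mod_cast this
    · have := hp.2; rw [mul_comm 4 n]; exact_mod_cast this
  have hbig : ∀ p, n < p * (k + 1) → 12 < p ∧ 10 * n + 4 < p ^ 2 := by
    intro p hp
    have h1 : n < p * K := hp.trans_le (Nat.mul_le_mul_left p hk)
    have hK : 1 ≤ K := by omega
    have h2 : 200 * K < p := by
      by_contra! h
      nlinarith
    exact ⟨by omega, by nlinarith⟩
  have hdiv : ∀ p, n < p * (k + 1) → p * k ≤ n → n / p = k ∧ p * k + n % p = n := by
    intro p h1 h2
    have : n / p = k := Nat.div_eq_of_lt_le (by rwa [mul_comm]) (by rwa [mul_comm])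
    exact ⟨this, by rw [← this]; exact Nat.div_add_mod n p⟩
  rw [fiberBound, theta_sub_theta e1, theta_sub_theta e2, ← Finset.sum_union]
  · refine Finset.sum_le_sum_of_subset_of_nonneg ?_ fun p _ _ ↦ Real.log_natCast_nonneg p
    intro p hp
    simp only [Finset.mem_union, Finset.mem_filter] at hp
    simp only [savedPrimes, Finset.mem_filter, Finset.mem_range]
    rcases hp with ⟨h, hp⟩ | ⟨h, hp⟩
    · obtain ⟨h1, h2⟩ := mem1 p h
      have h3 : n < p * (k + 1) := by nlinarith
      obtain ⟨h4, h5⟩ := hdiv p h3 (by nlinarith)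
      refine ⟨⟨by nlinarith, hp, (hbig p h3).1, (hbig p h3).2, Or.inl ⟨by nlinarith, by nlinarith⟩⟩, h4⟩
    · obtain ⟨h1, h2⟩ := mem2 p h
      have h3 : n < p * (k + 1) := by nlinarith
      obtain ⟨h4, h5⟩ := hdiv p h3 (by nlinarith)
      refine ⟨⟨by nlinarith, hp, (hbig p h3).1, (hbig p h3).2, Or.inr ⟨by nlinarith, by nlinarith⟩⟩, h4⟩
  · refine Finset.disjoint_filter_filter (Finset.disjoint_left.mpr fun p h h' ↦ ?_)
    have h1 := (mem1 p h).1
    have h2 := (mem2 p h').2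
    nlinarith

/-- The limit of `fiberBound n k / n`. -/
noncomputable def fiberDensity (k : ℕ) : ℝ :=
  (4 / (4 * k + 1) - 3 / (3 * k + 1)) + (4 / (4 * k + 3) - 6 / (6 * k + 5))

theorem tendsto_theta_mul_div {c : ℝ} (hc : 0 < c) :
    Tendsto (fun n : ℕ ↦ θ (n * c) / n) atTop (𝓝 c) := by
  have h : Tendsto (fun n : ℕ ↦ (n : ℝ) * c) atTop atTop :=
    tendsto_natCast_atTop_atTop.atTop_mul_const hc
  have := (tendsto_theta_div.comp h).mul_const c
  rw [one_mul] at this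
  refine this.congr fun n ↦ ?_
  rw [Function.comp_apply]
  rcases eq_or_ne (n : ℝ) 0 with h0 | h0
  · simp [h0]
  · field_simp

theorem tendsto_fiberBound_div (k : ℕ) :
    Tendsto (fun n : ℕ ↦ fiberBound n k / n) atTop (𝓝 (fiberDensity k)) := by
  refine (((tendsto_theta_mul_div (c := 4 / (4 * k + 1)) (by positivity)).sub
    (tendsto_theta_mul_div (c := 3 / (3 * k + 1)) (by positivity))).add
    ((tendsto_theta_mul_div (c := 4 / (4 * k + 3)) (by positivity)).sub
    (tendsto_theta_mul_div (c := 6 / (6 * k + 5)) (by positivity)))).congr fun n ↦ ?_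
  rw [fiberBound]
  ring

/-- A function whose increments bound `fiberDensity` from below. -/
noncomputable def densityTail (k : ℕ) : ℝ := 4 / (24 * k + 1) - 140 / (3 * (24 * k + 1) ^ 3)

theorem densityTail_sub_le (k : ℕ) : densityTail k - densityTail (k + 1) ≤ fiberDensity k := by
  have h : fiberDensity k - (densityTail k - densityTail (k + 1)) =
      (80317440 * k ^ 4 + 174021120 * k ^ 3 + 189253680 * k ^ 2 + 102908260 * k + 10302425) /
      ((4 * k + 1) * (3 * k + 1) * (4 * k + 3) * (6 * k + 5) * (24 * k + 1) ^ 3 *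
        (24 * k + 25) ^ 3) := by
    rw [fiberDensity, densityTail, densityTail]
    push_cast
    rw [show (24 * ((k : ℝ) + 1) + 1) = 24 * k + 25 by ring]
    field_simp
    ring
  have : 0 ≤ fiberDensity k - (densityTail k - densityTail (k + 1)) := by rw [h]; positivity
  linarith

theorem tendsto_densityTail : Tendsto densityTail atTop (𝓝 0) := by
  have h : Tendsto (fun k : ℕ ↦ (24 * (k : ℝ) + 1)) atTop atTop :=
    (tendsto_natCast_atTop_atTop.const_mul_atTop (by norm_num)).atTop_add tendsto_const_nhds
  have h1 := tendsto_inv_atTop_zero.comp h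
  have h2 := (h1.const_mul 4).sub ((h1.pow 3).const_mul (140 / 3))
  norm_num at h2
  refine h2.congr fun k ↦ ?_
  rw [densityTail]
  field_simp

theorem exists_lt_sum_fiberDensity :
    ∃ K, 1290551217 / 1000000000 < ∑ k ∈ Finset.range K, fiberDensity k := by
  have h1 : ∀ K, 10 ≤ K → ∑ k ∈ Finset.range 10, fiberDensity k + densityTail 10 - densityTail K ≤
      ∑ k ∈ Finset.range K, fiberDensity k := by
    intro K hK
    induction K, hK using Nat.le_induction with
    | base => simp
    | succ K _ ih =>
      rw [Finset.sum_range_succ _ K]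
      linarith [densityTail_sub_le K]
  have h2 : 1290551217 / 1000000000 <
      ∑ k ∈ Finset.range 10, fiberDensity k + densityTail 10 - 0 := by
    simp only [Finset.sum_range_succ, Finset.sum_range_zero, fiberDensity, densityTail]
    norm_num
  have h3 := (tendsto_densityTail.const_sub
    (∑ k ∈ Finset.range 10, fiberDensity k + densityTail 10)).eventually_const_lt h2
  obtain ⟨K, hK, hK'⟩ := (h3.and (eventually_ge_atTop 10)).exists
  exact ⟨K, hK.trans_le (h1 K hK')⟩

theorem eventually_le_sum_log_savedPrimes :
    ∀ᶠ n : ℕ in atTop,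
      1290551217 / 1000000000 * (n : ℝ) ≤ ∑ p ∈ savedPrimes n, Real.log p := by
  obtain ⟨K, hK⟩ := exists_lt_sum_fiberDensity
  have h1 : Tendsto (fun n : ℕ ↦ ∑ k ∈ Finset.range K, fiberBound n k / n) atTop
      (𝓝 (∑ k ∈ Finset.range K, fiberDensity k)) :=
    tendsto_finsetSum _ fun k _ ↦ tendsto_fiberBound_div k
  filter_upwards [h1.eventually_const_lt hK, eventually_ge_atTop (200 * K ^ 2),
    eventually_gt_atTop 0] with n hn hnK hn0
  have hn0' : (0 : ℝ) < n := by exact_mod_cast hn0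
  rw [← Finset.sum_div, lt_div_iff₀ hn0'] at hn
  refine hn.le.trans ((Finset.sum_le_sum fun k hk ↦
    fiberBound_le (Finset.mem_range.mp hk) hnK).trans ?_)
  exact Finset.sum_fiberwise_le_sum_of_sum_fiber_nonneg fun _ _ ↦
    Finset.sum_nonneg fun p _ ↦ Real.log_natCast_nonneg p

end SavedPrimesAsymptotics

section Bounds

open Complex Set

/-- The squared modulus of `y * (y ^ 4 + 6 * y ^ 2 + 25)` at `y = x + z * I`. -/
def numNormSq (x z : ℝ) : ℝ :=
  (x ^ 2 + z ^ 2) * (((x ^ 2 - z ^ 2) ^ 2 - (2 * x * z) ^ 2 + 6 * (x ^ 2 - z ^ 2) + 25) ^ 2 +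
    (2 * (x ^ 2 - z ^ 2) * (2 * x * z) + 6 * (2 * x * z)) ^ 2)

/-- The squared modulus of `(y - 5) * (y + 5)` at `y = x + z * I`. -/
def denNormSq (x z : ℝ) : ℝ := (x ^ 2 - z ^ 2 - 25) ^ 2 + (2 * x * z) ^ 2

theorem sq_norm_num (y : ℂ) : ‖y * (y ^ 4 + 6 * y ^ 2 + 25)‖ ^ 2 = numNormSq y.re y.im := by
  obtain ⟨x, z⟩ := y
  rw [← normSq_eq_norm_sq, normSq_apply, numNormSq]
  simp [pow_succ]
  ring

theorem sq_norm_den (y : ℂ) : ‖(y - 5) * (y + 5)‖ ^ 2 = denNormSq y.re y.im := by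
  obtain ⟨x, z⟩ := y
  rw [← normSq_eq_norm_sq, normSq_apply, denNormSq]
  simp
  ring

/-- Points at which the quotient of the integrands for `n + 1` and `n` is at most `F ^ 2`. -/
def HasRatioBound (F : ℝ) (y : ℂ) : Prop :=
  ‖y * (y ^ 4 + 6 * y ^ 2 + 25)‖ ^ 2 ≤ F * ‖(y - 5) * (y + 5)‖ ^ 3

theorem hasRatioBound_of_tangent {F w : ℝ} {y : ℂ} (hF : 0 ≤ F) (hw : 0 ≤ w)
    (h : numNormSq y.re y.im ≤ F / 2 * (3 * w * denNormSq y.re y.im - w ^ 3)) :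
    HasRatioBound F y := by
  rw [← sq_norm_num, ← sq_norm_den] at h
  refine h.trans ?_
  have h0 := norm_nonneg ((y - 5) * (y + 5))
  generalize ‖(y - 5) * (y + 5)‖ = v at h0
  have : 0 ≤ F / 2 * ((v - w) ^ 2 * (2 * v + w)) := by positivity
  linarith

theorem norm_integrand_le {F : ℝ} {y : ℂ} (h : HasRatioBound F y) (hE : 1 ≤ ‖(y - 5) * (y + 5)‖)
    (hy : ‖y‖ ≤ 9) {n k : ℕ} (hk : k ≤ 2) : ‖integrand n k y‖ ≤ 6561 * F ^ (2 * n) := by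
  unfold HasRatioBound at h
  have hy' : ‖y‖ ^ (2 * k) ≤ 6561 := by
    calc ‖y‖ ^ (2 * k) ≤ 9 ^ (2 * k) := by gcongr
      _ ≤ 9 ^ 4 := pow_le_pow_right₀ (by norm_num) (by omega)
      _ = 6561 := by norm_num
  have e : integrand n k y = (y * (y ^ 4 + 6 * y ^ 2 + 25)) ^ (4 * n) * y ^ (2 * k) /
      ((y - 5) * (y + 5)) ^ (6 * n + 1) := by
    simp [integrand, numPoly]
  rw [e, norm_div, norm_mul, norm_pow, norm_pow, norm_pow]
  generalize ‖(y - 5) * (y + 5)‖ = v at *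
  have hv : 0 < v := by linarith
  rw [div_le_iff₀ (by positivity)]
  have h1 : ‖y * (y ^ 4 + 6 * y ^ 2 + 25)‖ ^ (4 * n) ≤ F ^ (2 * n) * v ^ (6 * n) := by
    calc ‖y * (y ^ 4 + 6 * y ^ 2 + 25)‖ ^ (4 * n)
        = (‖y * (y ^ 4 + 6 * y ^ 2 + 25)‖ ^ 2) ^ (2 * n) := by rw [← pow_mul]; congr 1; ring
      _ ≤ (F * v ^ 3) ^ (2 * n) := by gcongr
      _ = F ^ (2 * n) * v ^ (6 * n) := by rw [mul_pow, ← pow_mul]; congr 2; ring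
  have h2 : 0 ≤ F ^ (2 * n) := (even_two_mul n).pow_nonneg F
  calc _ ≤ F ^ (2 * n) * v ^ (6 * n) * 6561 := by gcongr
    _ = 6561 * F ^ (2 * n) * (v ^ (6 * n) * 1) := by ring
    _ ≤ 6561 * F ^ (2 * n) * (v ^ (6 * n) * v) := by gcongr
    _ = _ := by rw [pow_succ]

/-! ### The circle -/

theorem numNormSq_five_add (a b : ℝ) : numNormSq (5 + a) b = (25 + 10 * a + (a ^ 2 + b ^ 2)) *
    ((a ^ 2 + b ^ 2) ^ 2 + 64 * (a ^ 2 + b ^ 2) + 400 + 16 * a * (a ^ 2 + b ^ 2) +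
      40 * (2 * a ^ 2 - (a ^ 2 + b ^ 2)) + 320 * a) *
    ((a ^ 2 + b ^ 2) ^ 2 + 144 * (a ^ 2 + b ^ 2) + 1600 + 24 * a * (a ^ 2 + b ^ 2) +
      80 * (2 * a ^ 2 - (a ^ 2 + b ^ 2)) + 960 * a) := by
  unfold numNormSq
  ring

theorem denNormSq_five_add (a b : ℝ) :
    denNormSq (5 + a) b = (a ^ 2 + b ^ 2) * (100 + 20 * a + (a ^ 2 + b ^ 2)) := by
  unfold denNormSq
  ring

theorem hasRatioBound_of_mem_sphere {y : ℂ} (hy : ‖y - 5‖ = 31449 / 10000) :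
    HasRatioBound (109258457 / 5000) y := by
  have h1 : (y.re - 5) ^ 2 + y.im ^ 2 = (31449 / 10000) ^ 2 := by
    rw [← hy, ← normSq_eq_norm_sq, normSq_apply]
    simp
    ring
  obtain ⟨c, hc⟩ : ∃ c : ℝ, y.re - 5 = 31449 / 10000 * c :=
    ⟨(y.re - 5) / (31449 / 10000), by field_simp⟩
  have hre : y.re = 5 + 31449 / 10000 * c := by linarith
  have hc2 : c ^ 2 ≤ 1 := by
    rw [hc] at h1
    nlinarith [sq_nonneg y.im]
  have hc1 : -1 ≤ c := by nlinarith
  have hc3 : c ≤ 1 := by nlinarith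
  rw [hc] at h1
  rcases le_total 0 c with h | h
  · refine hasRatioBound_of_tangent (w := 206697 / 5000) (by norm_num) (by norm_num) ?_
    rw [hre, numNormSq_five_add, denNormSq_five_add, h1]
    obtain ⟨x, rfl⟩ : ∃ x, c = 1 - x := ⟨1 - c, by ring⟩
    have hx0 : 0 ≤ x := by linarith
    have hx1 : 0 ≤ 1 - x := h
    rw [← sub_nonneg]
    refine le_of_le_of_eq (b :=
      2609996920243871079510053245321788701999 / 10000000000000000000000000000000000000000 * (1 - x) ^ 5 +
      5709022990890855154725710603431742297486053601999 / 2000000000000000000000000000000000000000 * (x * (1 - x) ^ 4) +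
      7871892468453330460713911041265186793224078501999 / 1000000000000000000000000000000000000000 * (x ^ 2 * (1 - x) ^ 3) +
      8191032678855793541929139267231306460535863401999 / 1000000000000000000000000000000000000000 * (x ^ 3 * (1 - x) ^ 2) +
      7550619225555846155197759573675821027421408301999 / 2000000000000000000000000000000000000000 * (x ^ 4 * (1 - x)) +
      6410350474188169131344620871069250221880713201999 / 10000000000000000000000000000000000000000 * x ^ 5)
      (by positivity) (by ring)
  · refine hasRatioBound_of_tangent (w := 30) (by norm_num) (by norm_num) ?_
    rw [hre, numNormSq_five_add, denNormSq_five_add, h1]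
    obtain ⟨x, rfl⟩ : ∃ x, c = -x := ⟨-c, by ring⟩
    have hx0 : 0 ≤ x := by linarith
    have hx1 : 0 ≤ 1 - x := by linarith
    rw [← sub_nonneg]
    refine le_of_le_of_eq (b :=
      7139519231174504424748286562669510221880713201999 / 10000000000000000000000000000000000000000 * (1 - x) ^ 5 +
      6461681443294899930543304950462939416340018101999 / 2000000000000000000000000000000000000000 * (x * (1 - x) ^ 4) +
      5283988357347565799216564329205283238373083001999 / 1000000000000000000000000000000000000000 * (x ^ 2 * (1 - x) ^ 3) +
      4066138338967182861592913609367061415979907901999 / 1000000000000000000000000000000000000000 * (x ^ 3 * (1 - x) ^ 2) +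
      2843352515965511022495686319543593677160492801999 / 2000000000000000000000000000000000000000 * (x ^ 4 * (1 - x)) +
      1620146180609237281639487806454999749914837701999 / 10000000000000000000000000000000000000000 * x ^ 5)
      (by positivity) (by ring)

theorem norm_halfRes_integrand_le (n : ℕ) {k : ℕ} (hk : k ≤ 2) :
    ‖halfRes (integrand n k)‖ ≤ 20000 * (109258457 / 5000) ^ (2 * n) := by
  have h : ∀ z ∈ Metric.sphere (5 : ℂ) (31449 / 10000),
      ‖integrand n k z‖ ≤ 6561 * (109258457 / 5000) ^ (2 * n) := by
    intro z hz
    rw [mem_sphere_iff_norm] at hz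
    refine norm_integrand_le (hasRatioBound_of_mem_sphere hz) ?_ ?_ hk
    · rw [norm_mul, hz]
      have h1 : ‖(10 : ℂ)‖ ≤ ‖z + 5‖ + ‖z - 5‖ := by
        refine le_trans (le_of_eq ?_) (norm_sub_le (z + 5) (z - 5))
        congr 1; ring
      rw [hz, Complex.norm_ofNat] at h1
      linarith
    · have h1 : ‖z‖ ≤ ‖z - 5‖ + ‖(5 : ℂ)‖ := norm_le_norm_sub_add z 5
      rw [hz, Complex.norm_ofNat] at h1
      linarith
  have h1 := circleIntegral.norm_two_pi_i_inv_smul_integral_le_of_norm_le_const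
    (by norm_num : (0 : ℝ) ≤ 31449 / 10000) h
  rw [halfRes, norm_mul]
  rw [smul_eq_mul] at h1
  refine (mul_le_mul_of_nonneg_left h1 (norm_nonneg _)).trans ?_
  have h2 : ‖(-(1 / 2) : ℂ)‖ = 1 / 2 := by simp
  rw [h2]
  have : (0 : ℝ) ≤ (109258457 / 5000) ^ (2 * n) := by positivity
  linarith

/-! ### The polygonal path -/

/-- A point close to the saddle point of the integrands in the upper half-plane. -/
noncomputable def saddle : ℂ := -354009 / 1000000 + 14300607 / 10000000 * I

theorem hasRatioBound_zero_saddle {y : ℂ} (hy : y ∈ segment ℝ 0 saddle) :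
    HasRatioBound (294584961 / 10000000000) y := by
  rw [segment_eq_image] at hy
  obtain ⟨t, ⟨ht0, ht1⟩, rfl⟩ := hy
  refine hasRatioBound_of_tangent (w := 1346939 / 50000) (by norm_num) (by norm_num) ?_
  have hre : ((1 - t) • (0 : ℂ) + t • saddle).re = -354009 / 1000000 * t := by
    simp [saddle]; ring
  have him : ((1 - t) • (0 : ℂ) + t • saddle).im = 14300607 / 10000000 * t := by
    simp [saddle]; ring
  simp only [hre, him, numNormSq, denNormSq]
  have hv0 : 0 ≤ t ^ 2 := by positivity
  have hv1 : 0 ≤ 1 - t ^ 2 := by nlinarith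
  obtain ⟨v, hv⟩ : ∃ v, v = t ^ 2 := ⟨_, rfl⟩
  rw [← hv] at hv0 hv1
  rw [← sub_nonneg]
  refine le_of_le_of_eq (b :=
      1140073157793315746896911741 / 2500000000000000000000000 * (1 - v) ^ 5 +
      2075817919035952368213132528813 / 2000000000000000000000000000 * (v * (1 - v) ^ 4) +
      8469366641496048375472347176773802499662420937 / 10000000000000000000000000000000000000000000 * (v ^ 2 * (1 - v) ^ 3) +
      2168961200473596506353844629814315063422114671 / 10000000000000000000000000000000000000000000 * (v ^ 3 * (1 - v) ^ 2) +
      2182696540892471066857471667731810557502886728935003 / 25000000000000000000000000000000000000000000000000000000 * (v ^ 4 * (1 - v)) +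
      33601579607547267358679888754840658557738282382069026825540142251 / 10000000000000000000000000000000000000000000000000000000000000000000000 * v ^ 5)
      (by positivity) (by rw [hv]; ring)

theorem hasRatioBound_saddle_endpoint {y : ℂ} (hy : y ∈ segment ℝ saddle (-1 + 2 * I)) :
    HasRatioBound (294584961 / 10000000000) y := by
  rw [segment_eq_image] at hy
  obtain ⟨t, ⟨ht0, ht1⟩, rfl⟩ := hy
  refine hasRatioBound_of_tangent (w := 1346939 / 50000) (by norm_num) (by norm_num) ?_
  have hre : ((1 - t) • saddle + t • (-1 + 2 * I)).re = -354009 / 1000000 - 645991 / 1000000 * t := by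
    simp [saddle]; ring
  have him : ((1 - t) • saddle + t • (-1 + 2 * I)).im =
      14300607 / 10000000 + 5699393 / 10000000 * t := by
    simp [saddle]; ring
  simp only [hre, him, numNormSq, denNormSq]
  have ht1' : 0 ≤ 1 - t := by linarith
  rw [← sub_nonneg]
  refine le_of_le_of_eq (b :=
      33601579607547267358679888754840658557738282382069026825540142251 / 10000000000000000000000000000000000000000000000000000000000000000000000 * (1 - t) ^ 10 +
      1149928330912022910206092582207709972212161551544373397937 / 12500000000000000000000000000000000000000000000000000000000000 * (t * (1 - t) ^ 9) +
      52165675575758827738309342304545264101812085022439749510627 / 100000000000000000000000000000000000000000000000000000000 * (t ^ 2 * (1 - t) ^ 8) +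
      1479070656979797151205711790314574612754673081496463 / 312500000000000000000000000000000000000000000000 * (t ^ 3 * (1 - t) ^ 7) +
      37228251131189106691032077994763715679076873067 / 2000000000000000000000000000000000000000000 * (t ^ 4 * (1 - t) ^ 6) +
      206527004485587677924273676476934006125387262811 / 5000000000000000000000000000000000000000000 * (t ^ 5 * (1 - t) ^ 5) +
      562573901850058065297061904793262890600142420937 / 10000000000000000000000000000000000000000000 * (t ^ 6 * (1 - t) ^ 4) +
      1491553416325853286223208662002501504219 / 31250000000000000000000000000000000 * (t ^ 7 * (1 - t) ^ 3) +
      606312950763110138069191172215687 / 25000000000000000000000000000 * (t ^ 8 * (1 - t) ^ 2) +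
      1635530548930143767597205741 / 250000000000000000000000 * (t ^ 9 * (1 - t)) +
      1660857372072813184396911741 / 2500000000000000000000000 * t ^ 10)
      (by positivity) (by ring)

theorem HasRatioBound.conj {F : ℝ} {y : ℂ} (h : HasRatioBound F (starRingEnd ℂ y)) :
    HasRatioBound F y := by
  unfold HasRatioBound at *
  rw [← norm_conj, ← norm_conj ((y - 5) * (y + 5))]
  simpa only [map_mul, map_add, map_sub, map_pow, map_ofNat] using h

theorem norm_saddle_le : ‖saddle‖ ≤ 3 := by
  refine (norm_add_le _ _).trans ?_
  simp
  norm_num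

theorem norm_endpoint_le : ‖(-1 + 2 * I : ℂ)‖ ≤ 3 := by
  refine (norm_add_le _ _).trans ?_
  simp
  norm_num

theorem norm_lineInt_integrand_le (n : ℕ) {k : ℕ} (hk : k ≤ 2) :
    ‖lineInt (integrand n k)‖ ≤ 200000 * (294584961 / 10000000000) ^ (2 * n) := by
  set B : ℝ := 6561 * (294584961 / 10000000000) ^ (2 * n) with hB
  have hB0 : 0 ≤ B := by positivity
  have hreg : ∀ y : ℂ, ‖y‖ < 5 → (y - 5) * (y + 5) ≠ 0 := by
    intro y hy h
    rcases mul_eq_zero.mp h with h | h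
    · rw [sub_eq_zero.mp h] at hy; simp at hy
    · rw [eq_neg_of_add_eq_zero_left h] at hy; simp at hy
  have hd : DifferentiableOn ℂ (integrand n k) (Metric.ball 0 5) := by
    intro y hy
    rw [mem_ball_zero_iff] at hy
    refine DifferentiableAt.differentiableWithinAt ?_
    unfold integrand
    exact (numPoly n k).differentiable.differentiableAt.div (by fun_prop)
      (pow_ne_zero _ (hreg y hy))
  obtain ⟨G, hG⟩ := hd.isExactOn_ball
  have hseg : ∀ a b : ℂ, ‖a‖ ≤ 3 → ‖b‖ ≤ 3 →
      (∀ y ∈ segment ℝ a b, HasRatioBound (294584961 / 10000000000) y) → ‖G b - G a‖ ≤ 6 * B := by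
    intro a b ha hb h
    have hy3 : ∀ y ∈ segment ℝ a b, ‖y‖ ≤ 3 := fun y hy ↦ by
      have := (convex_closedBall (0 : ℂ) 3).segment_subset (mem_closedBall_zero_iff.mpr ha)
        (mem_closedBall_zero_iff.mpr hb) hy
      exact mem_closedBall_zero_iff.mp this
    have h1 := (convex_segment (𝕜 := ℝ) a b).norm_image_sub_le_of_norm_hasDerivWithin_le (f := G)
      (f' := integrand n k) (C := B)
      (fun y hy ↦ (hG y (mem_ball_zero_iff.mpr (by linarith [hy3 y hy]))).hasDerivWithinAt)
      (fun y hy ↦ norm_integrand_le (h y hy) ?_ (by linarith [hy3 y hy]) hk)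
      (left_mem_segment ℝ a b) (right_mem_segment ℝ a b)
    · refine h1.trans ?_
      have : ‖b - a‖ ≤ 6 := (norm_sub_le b a).trans (by linarith)
      nlinarith
    · have h5 : ‖(5 : ℂ)‖ = 5 := Complex.norm_ofNat 5
      have h2 : ‖(5 : ℂ)‖ ≤ ‖y - 5‖ + ‖y‖ := by
        rw [norm_sub_rev]; exact norm_le_norm_sub_add 5 y
      have h3 : ‖(5 : ℂ)‖ ≤ ‖y + 5‖ + ‖y‖ := by
        refine le_trans (le_of_eq ?_) (norm_sub_le (y + 5) y)
        congr 1; ring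
      have := hy3 y hy
      rw [norm_mul]
      nlinarith
  have hconj : ∀ a b : ℂ, (∀ y ∈ segment ℝ a b, HasRatioBound (294584961 / 10000000000) y) →
      ∀ y ∈ segment ℝ (starRingEnd ℂ a) (starRingEnd ℂ b),
        HasRatioBound (294584961 / 10000000000) y := by
    intro a b h y hy
    refine HasRatioBound.conj (h _ ?_)
    rw [segment_eq_image] at hy ⊢
    obtain ⟨t, ht, rfl⟩ := hy
    exact ⟨t, ht, by simp⟩
  have e1 := hseg _ _ (by simp) norm_saddle_le fun y ↦ hasRatioBound_zero_saddle
  have e2 := hseg _ _ norm_saddle_le norm_endpoint_le fun y ↦ hasRatioBound_saddle_endpoint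
  have e3 := hseg _ _ (by simp) ((norm_conj _).trans_le norm_saddle_le)
    (hconj _ _ fun y ↦ hasRatioBound_zero_saddle)
  have e4 := hseg _ _ ((norm_conj _).trans_le norm_saddle_le)
    ((norm_conj _).trans_le norm_endpoint_le) (hconj _ _ fun y ↦ hasRatioBound_saddle_endpoint)
  rw [map_zero] at e3
  have hc : (starRingEnd ℂ) (-1 + 2 * I) = -1 - 2 * I := by
    simp [sub_eq_add_neg, map_ofNat]
  rw [hc] at e4
  have hcont : ContinuousOn (integrand n k) regSet := by
    unfold integrand
    exact (continuousOn_eval_regSet _).div (by fun_prop) fun y hy ↦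
      pow_ne_zero _ (mul_ne_zero hy.1 hy.2)
  have hline : ∀ t ∈ uIcc (-2 : ℝ) 2, (-1 + t * I : ℂ) ∈ Metric.ball 0 5 := by
    intro t ht
    rw [uIcc_of_le (by norm_num), mem_Icc, ← abs_le] at ht
    rw [mem_ball_zero_iff]
    refine (norm_add_le _ _).trans_lt ?_
    rw [norm_mul, norm_neg, norm_one, norm_I, norm_real, Real.norm_eq_abs]
    linarith
  rw [lineInt_of_hasDerivAt hcont fun t ht ↦ hG _ (hline t ht), norm_mul, norm_neg, norm_I, one_mul]
  have e : G (-1 + 2 * I) - G (-1 - 2 * I) = (G (-1 + 2 * I) - G saddle) + (G saddle - G 0) -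
      ((G (starRingEnd ℂ saddle) - G 0) + (G (-1 - 2 * I) - G (starRingEnd ℂ saddle))) := by ring
  rw [e]
  refine (norm_sub_le _ _).trans ?_
  have f1 := norm_add_le (G (-1 + 2 * I) - G saddle) (G saddle - G 0)
  have f2 := norm_add_le (G (starRingEnd ℂ saddle) - G 0) (G (-1 - 2 * I) - G (starRingEnd ℂ saddle))
  have : 0 ≤ (294584961 / 10000000000 : ℝ) ^ (2 * n) := by positivity
  linarith

end Bounds

section Nonvanishing

open Complex Polynomial Set

theorem continuousOn_inv_den (m : ℕ) :
    ContinuousOn (fun y : ℂ ↦ (((y - 5) * (y + 5)) ^ m)⁻¹) regSet :=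
  ContinuousOn.inv₀ (by fun_prop) fun _ hy ↦ pow_ne_zero _ (mul_ne_zero hy.1 hy.2)

theorem continuousOn_integrand (n k : ℕ) : ContinuousOn (integrand n k) regSet := by
  unfold integrand
  exact (continuousOn_eval_regSet _).mul (continuousOn_inv_den _)

theorem integrand_eq_mul_inv_pow (n k : ℕ) (y : ℂ) : integrand n k y =
    (y * (y ^ 4 + 6 * y ^ 2 + 25)) ^ (4 * n) * y ^ (2 * k) * ((y - 5) * (y + 5))⁻¹ ^ (6 * n + 1) := by
  simp only [integrand, numPoly, eval_mul, eval_pow, eval_add, eval_X, eval_ofNat, inv_pow,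
    div_eq_mul_inv]

/-- An antiderivative relating `integrand n k`, …, `integrand n (k + 3)`. -/
noncomputable def stepFun (n k : ℕ) (y : ℂ) : ℂ :=
  (y * (y ^ 4 + 6 * y ^ 2 + 25)) ^ (4 * n + 1) * y ^ (2 * k) * ((y - 5) * (y + 5))⁻¹ ^ (6 * n)

theorem natCast_mul_pow_pred_mul (m : ℕ) (x : ℂ) : (m : ℂ) * x ^ (m - 1) * x = m * x ^ m := by
  cases m with
  | zero => simp
  | succ m => rw [mul_assoc, ← pow_succ, Nat.add_sub_cancel]

theorem hasDerivAt_stepFun (n k : ℕ) {y : ℂ} (hy : y ∈ regSet) :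
    HasDerivAt (stepFun n k) ((8 * n + 2 * k + 5) * integrand n (k + 3) y +
      -(500 * n + 38 * k + 107) * integrand n (k + 2) y +
      -(2000 * n + 250 * k + 425) * integrand n (k + 1) y +
      -(2500 * n + 1250 * k + 625) * integrand n k y) y := by
  have hE : (y - 5) * (y + 5) ≠ 0 := mul_ne_zero hy.1 hy.2
  have hid := hasDerivAt_id' y
  have h1 : HasDerivAt (fun y : ℂ ↦ y * (y ^ 4 + 6 * y ^ 2 + 25)) (5 * y ^ 4 + 18 * y ^ 2 + 25) y := by
    refine (hid.fun_mul (((hasDerivAt_pow 4 y).fun_add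
      ((hasDerivAt_pow 2 y).const_mul 6)).add_const 25)).congr_deriv ?_
    push_cast
    ring
  have h2 : HasDerivAt (fun y : ℂ ↦ (y - 5) * (y + 5)) (2 * y) y := by
    refine ((hid.sub_const 5).fun_mul (hid.add_const 5)).congr_deriv ?_
    ring
  have h3 := (h2.fun_inv hE).fun_pow (6 * n)
  have h4 := ((h1.fun_pow (4 * n + 1)).fun_mul (hasDerivAt_pow (2 * k) y)).fun_mul h3
  refine h4.congr_deriv ?_
  have hk := natCast_mul_pow_pred_mul (2 * k) y
  have hn := natCast_mul_pow_pred_mul (6 * n) ((y - 5) * (y + 5))⁻¹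
  simp only [integrand_eq_mul_inv_pow, Nat.add_sub_cancel]
  have hwe : (y ^ 2 - 25) * ((y - 5) * (y + 5))⁻¹ = 1 := by
    rw [← mul_inv_cancel₀ hE]
    ring
  rw [div_eq_mul_inv (-(2 * y)), ← inv_pow ((y - 5) * (y + 5))]
  simp only [pow_succ _ (4 * n), pow_succ _ (6 * n), mul_add 2 k, pow_add y]
  generalize ((y - 5) * (y + 5))⁻¹ = w at *
  generalize (y * (y ^ 4 + 6 * y ^ 2 + 25)) ^ (4 * n) = B at *
  generalize w ^ (6 * n) = W at *
  generalize y ^ (2 * k) = Y at *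
  generalize w ^ (6 * n - 1) = W' at *
  generalize y ^ (2 * k - 1) = Y' at *
  push_cast at *
  linear_combination B * (y ^ 4 + 6 * y ^ 2 + 25) * W * hk -
    2 * y ^ 2 * (y ^ 4 + 6 * y ^ 2 + 25) * B * Y * w * hn -
      ((4 * n + 1) * (5 * y ^ 4 + 18 * y ^ 2 + 25) + 2 * k * (y ^ 4 + 6 * y ^ 2 + 25)) * B * Y * W * hwe

theorem eight_mul_add_ne_zero (n k : ℕ) : (8 * n + 2 * k + 5 : ℂ) ≠ 0 := by
  exact_mod_cast (by omega : 8 * n + 2 * k + 5 ≠ 0)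

theorem stepFun_endpoint (n k : ℕ) {y : ℂ} (h : y ^ 4 + 6 * y ^ 2 + 25 = 0) : stepFun n k y = 0 := by
  simp [stepFun, h]

variable {n : ℕ} {c : ℂ}

theorem lineInt_integrand_eq (h : ∀ k ≤ 2, lineInt (integrand n k) = c * halfRes (integrand n k))
    (k : ℕ) : lineInt (integrand n k) = c * halfRes (integrand n k) := by
  induction k using Nat.strong_induction_on with
  | _ k ih =>
  rcases le_or_gt k 2 with hk | hk
  · exact h k hk
  obtain ⟨m, rfl⟩ := Nat.exists_eq_add_of_lt hk
  rw [show 2 + m + 1 = m + 3 by ring] at ih ⊢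
  have h0 := ih m (by omega)
  have h1 := ih (m + 1) (by omega)
  have h2 := ih (m + 2) (by omega)
  have hc (a : ℂ) (j : ℕ) : ContinuousOn (fun y ↦ a * integrand n j y) regSet :=
    continuousOn_const.mul (continuousOn_integrand n j)
  have c1 := (hc (8 * n + 2 * m + 5) (m + 3)).fun_add (hc (-(500 * n + 38 * m + 107)) (m + 2))
  have c2 := c1.fun_add (hc (-(2000 * n + 250 * m + 425)) (m + 1))
  have c3 := c2.fun_add (hc (-(2500 * n + 1250 * m + 625)) m)
  have hl := lineInt_of_hasDerivAt c3 fun t _ ↦ hasDerivAt_stepFun n m (line_mem_regSet t)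
  have hr := halfRes_of_hasDerivAt fun y hy ↦ hasDerivAt_stepFun n m hy
  rw [stepFun_endpoint n m (by ring_nf; simp [I_sq, I_pow_three, I_pow_four]; ring),
    stepFun_endpoint n m (by ring_nf; simp [I_sq, I_pow_three, I_pow_four]; ring)] at hl
  rw [lineInt_add c2 (hc _ _), lineInt_add c1 (hc _ _), lineInt_add (hc _ _) (hc _ _)] at hl
  rw [halfRes_add c2 (hc _ _), halfRes_add c1 (hc _ _), halfRes_add (hc _ _) (hc _ _)] at hr
  simp only [lineInt_const_mul] at hl
  simp only [halfRes_const_mul] at hr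
  refine mul_left_cancel₀ (eight_mul_add_ne_zero n m) ?_
  linear_combination hl - c * hr + (500 * n + 38 * m + 107) * h2 + (2000 * n + 250 * m + 425) * h1 +
    (2500 * n + 1250 * m + 625) * h0

theorem lineInt_eval_sq_eq (h : ∀ k ≤ 2, lineInt (integrand n k) = c * halfRes (integrand n k))
    (g : ℂ[X]) : lineInt (fun y ↦ g.eval (y ^ 2) * integrand n 0 y) =
      c * halfRes (fun y ↦ g.eval (y ^ 2) * integrand n 0 y) := by
  have hcont (g : ℂ[X]) : ContinuousOn (fun y ↦ g.eval (y ^ 2) * integrand n 0 y) regSet :=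
    (g.continuous.comp (continuous_pow 2)).continuousOn.mul (continuousOn_integrand n 0)
  induction g using Polynomial.induction_on' with
  | add p q hp hq =>
    simp only [eval_add, add_mul]
    rw [lineInt_add (hcont p) (hcont q), halfRes_add (hcont p) (hcont q), hp, hq, mul_add]
  | monomial k a =>
    have e : (fun y ↦ (monomial k a).eval (y ^ 2) * integrand n 0 y) =
        fun y ↦ a * integrand n k y := by
      funext y
      simp only [integrand_eq_mul_inv_pow, eval_monomial]
      ring
    rw [e, lineInt_const_mul, halfRes_const_mul, lineInt_integrand_eq h k]
    ring

/-- An odd cubic taking the values `1` and `-1` at the endpoints. -/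
noncomputable def cubicMap (y : ℂ) : ℂ := -(I / 20) * (y * (11 + y ^ 2))

theorem hasDerivAt_cubicMap (y : ℂ) : HasDerivAt cubicMap (-(I / 20) * (11 + 3 * y ^ 2)) y := by
  refine (((hasDerivAt_id' y).fun_mul ((hasDerivAt_pow 2 y).const_add 11)).const_mul _).congr_deriv ?_
  push_cast
  ring

theorem cubicMap_sub_cube (y : ℂ) : cubicMap y - cubicMap y ^ 3 =
    -(I / 8000) * (y * (y ^ 4 + 6 * y ^ 2 + 25)) * ((11 + y ^ 2) * (y ^ 2 + 16)) := by
  unfold cubicMap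
  ring_nf
  simp only [I_pow_three]
  ring

theorem exists_lineInt_integrand_ne (n : ℕ) (c : ℂ) :
    ∃ k ≤ 2, lineInt (integrand n k) ≠ c * halfRes (integrand n k) := by
  by_contra! h
  obtain ⟨K, hK⟩ : ∃ K : ℂ → ℂ, ∀ y, HasDerivAt K ((y - y ^ 3) ^ (4 * n)) y :=
    ⟨_, fun y ↦ (hasDerivAt_comp_antideriv (Q := (X - X ^ 3) ^ (4 * n))
      (q := (X - X ^ 3) ^ (4 * n)) (α := 0) (β := 1) (r := 1) one_ne_zero (by simp) y).congr_deriv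
        (by simp)⟩
  have hF (y : ℂ) : HasDerivAt (fun y ↦ K (cubicMap y))
      ((cubicMap y - cubicMap y ^ 3) ^ (4 * n) * (-(I / 20) * (11 + 3 * y ^ 2))) y :=
    (hK (cubicMap y)).comp y (hasDerivAt_cubicMap y)
  have hcont : ContinuousOn (fun y : ℂ ↦ (cubicMap y - cubicMap y ^ 3) ^ (4 * n) *
      (-(I / 20) * (11 + 3 * y ^ 2))) regSet := by
    unfold cubicMap
    fun_prop
  have h1 := lineInt_of_hasDerivAt hcont fun t _ ↦ hF _
  have h2 := halfRes_of_hasDerivAt fun y _ ↦ hF y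
  set g : ℂ[X] := C ((-(I / 8000)) ^ (4 * n) * -(I / 20)) * ((11 + X) * (X + 16)) ^ (4 * n) *
    (11 + 3 * X) * (X - 25) ^ (6 * n + 1) with hg
  have he : EqOn (fun y : ℂ ↦ (cubicMap y - cubicMap y ^ 3) ^ (4 * n) *
      (-(I / 20) * (11 + 3 * y ^ 2))) (fun y ↦ g.eval (y ^ 2) * integrand n 0 y) regSet := by
    intro y hy
    have hE : (y - 5) * (y + 5) ≠ 0 := mul_ne_zero hy.1 hy.2
    have hw : (y ^ 2 - 25) ^ (6 * n + 1) * ((y - 5) * (y + 5))⁻¹ ^ (6 * n + 1) = 1 := by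
      rw [← mul_pow, show y ^ 2 - 25 = (y - 5) * (y + 5) by ring, mul_inv_cancel₀ hE, one_pow]
    simp only [hg, integrand_eq_mul_inv_pow, cubicMap_sub_cube, eval_mul, eval_C, eval_pow,
      eval_add, eval_sub, eval_X, eval_ofNat, mul_pow (-(I / 8000) * _), mul_pow (-(I / 8000))]
    generalize ((y - 5) * (y + 5))⁻¹ ^ (6 * n + 1) = w at hw ⊢
    generalize (y ^ 2 - 25) ^ (6 * n + 1) = W at hw ⊢
    generalize (y * (y ^ 4 + 6 * y ^ 2 + 25)) ^ (4 * n) = B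
    generalize ((11 + y ^ 2) * (y ^ 2 + 16)) ^ (4 * n) = A
    linear_combination -(-(I / 8000)) ^ (4 * n) * B * A * (-(I / 20) * (11 + 3 * y ^ 2)) * hw
  rw [lineInt_congr he, lineInt_eval_sq_eq h, ← halfRes_congr he, h2, mul_zero] at h1
  have e1 : cubicMap (-1 + 2 * I) = 1 := by
    unfold cubicMap
    ring_nf
    simp [I_sq, I_pow_three, I_pow_four]
    norm_num
  have e2 : cubicMap (-1 - 2 * I) = -1 := by
    unfold cubicMap
    ring_nf
    simp [I_sq, I_pow_three, I_pow_four]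
    norm_num
  rw [e1, e2] at h1
  have h3 : K 1 - K (-1) = ((∫ x in (-1 : ℝ)..1, (x - x ^ 3) ^ (4 * n) : ℝ) : ℂ) := by
    have := intervalIntegral.integral_eq_sub_of_hasDerivAt (a := -1) (b := 1)
      (f := fun x : ℝ ↦ K x) (f' := fun x : ℝ ↦ ((x - x ^ 3) ^ (4 * n) : ℂ))
      (fun x _ ↦ (hK x).comp_ofReal) (Continuous.intervalIntegrable (by fun_prop) _ _)
    rw [← intervalIntegral.integral_ofReal]
    push_cast at this ⊢
    exact this.symm
  have h4 : 0 < ∫ x in (-1 : ℝ)..1, (x - x ^ 3) ^ (4 * n) := by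
    refine intervalIntegral.integral_pos (by norm_num) (by fun_prop)
      (fun x _ ↦ Even.pow_nonneg ⟨2 * n, by ring⟩ _) ⟨1 / 2, by norm_num, ?_⟩
    norm_num
  rw [h3] at h1
  have h5 : ((∫ x in (-1 : ℝ)..1, (x - x ^ 3) ^ (4 * n) : ℝ) : ℂ) ≠ 0 := by exact_mod_cast h4.ne'
  exact (mul_ne_zero (neg_ne_zero.mpr I_ne_zero) h5) h1.symm

end Nonvanishing

section Asymptotics

open Filter Topology

theorem one_le_norm_of_mem_gaussRing {x : ℂ} (hx : x ∈ gaussRing) (h0 : x ≠ 0) : 1 ≤ ‖x‖ := by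
  obtain ⟨z, rfl⟩ := hx
  have hz : z ≠ 0 := by rintro rfl; exact h0 (map_zero _)
  have h1 : (1 : ℤ) ≤ z.norm := GaussianInt.norm_pos.mpr hz
  have h2 : (1 : ℝ) ≤ ‖GaussianInt.toComplex z‖ ^ 2 := by
    rw [← Complex.normSq_eq_norm_sq, ← GaussianInt.intCast_real_norm]
    exact_mod_cast h1
  exact (one_le_sq_iff₀ (norm_nonneg _)).mp h2

/-- The common multiple of `1, …, 8 * n + 3`, without the saved primes. -/
def reducedLcm (n : ℕ) : ℕ := Nat.lcmUpto (8 * n + 3) / ∏ p ∈ savedPrimes n, p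

theorem dvd_lcmUpto {n : ℕ} : ∀ j, 1 ≤ j → j ≤ n → j ∣ Nat.lcmUpto n :=
  fun _ h1 h2 ↦ Finset.dvd_lcm (f := id) (Finset.mem_Icc.mpr ⟨h1, h2⟩)

theorem lcmUpto_eq_mul_reducedLcm (n : ℕ) :
    Nat.lcmUpto (8 * n + 3) = (∏ p ∈ savedPrimes n, p) * reducedLcm n :=
  (Nat.mul_div_cancel' (prod_savedPrimes_dvd dvd_lcmUpto)).symm

/-- The factor clearing the denominators of the periods of `integrand n k`. -/
noncomputable def clearFactor (n : ℕ) : ℝ := 20 * reducedLcm n / 2 ^ (5 * n)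

theorem reducedLcm_pos (n : ℕ) : 0 < reducedLcm n := by
  refine Nat.pos_of_ne_zero fun h ↦ Nat.lcmUpto_ne_zero (8 * n + 3) ?_
  rw [lcmUpto_eq_mul_reducedLcm, h, mul_zero]

theorem clearFactor_pos (n : ℕ) : 0 < clearFactor n := by
  have := reducedLcm_pos n
  unfold clearFactor
  positivity

theorem one_le_clearFactor_mul (n : ℕ) {p q : ℤ} (hq : 1 ≤ q) :
    1 ≤ clearFactor n * (q * (200000 * (294584961 / 10000000000) ^ (2 * n)) +
      q * |Real.pi - p / q| * (20000 * (109258457 / 5000) ^ (2 * n))) := by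
  have hq0 : (0 : ℝ) < q := by exact_mod_cast hq
  have hqC : (q : ℂ) ≠ 0 := by exact_mod_cast hq0.ne'
  obtain ⟨k, hk, hne⟩ := exists_lineInt_integrand_ne n (Real.pi - p / q)
  obtain ⟨ha, hb⟩ := periods_mem_gaussRing hk dvd_lcmUpto (lcmUpto_eq_mul_reducedLcm n)
  have hX : (20 * reducedLcm n / 2 ^ (5 * n) : ℂ) = (clearFactor n : ℂ) := by
    simp [clearFactor]
  rw [hX] at ha hb
  have hmem := gaussRing.add_mem (gaussRing.mul_mem (intCast_mem gaussRing q) ha)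
    (gaussRing.mul_mem (intCast_mem gaussRing p) hb)
  have e : (q : ℂ) * (clearFactor n * ratPart (integrand n k)) +
      p * (clearFactor n * halfRes (integrand n k)) = clearFactor n * (q * lineInt (integrand n k) -
        q * ((Real.pi - p / q : ℝ) : ℂ) * halfRes (integrand n k)) := by
    unfold ratPart
    push_cast
    field_simp
    ring
  rw [e] at hmem
  have h1 := one_le_norm_of_mem_gaussRing hmem <| by
    refine mul_ne_zero (by exact_mod_cast (clearFactor_pos n).ne') ?_
    rw [mul_assoc, ← mul_sub]
    refine mul_ne_zero hqC (sub_ne_zero.mpr ?_)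
    exact_mod_cast hne
  refine h1.trans ?_
  rw [norm_mul, Complex.norm_real, Real.norm_of_nonneg (clearFactor_pos n).le]
  refine mul_le_mul_of_nonneg_left ((norm_sub_le _ _).trans ?_) (clearFactor_pos n).le
  rw [norm_mul, norm_mul, norm_mul, Complex.norm_real, Real.norm_eq_abs, Complex.norm_intCast,
    abs_of_pos hq0]
  gcongr
  · exact norm_lineInt_integrand_le n hk
  · exact norm_halfRes_integrand_le n hk

theorem eventually_const_le_mul (C : ℝ) {ε : ℝ} (hε : 0 < ε) : ∀ᶠ n : ℕ in atTop, C ≤ ε * n :=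
  (tendsto_natCast_atTop_atTop.const_mul_atTop hε).eventually_ge_atTop C

theorem log_clearFactor (n : ℕ) : Real.log (clearFactor n) = Real.log 20 +
    Chebyshev.psi (8 * n + 3) - ∑ p ∈ savedPrimes n, Real.log p - 5 * n * Real.log 2 := by
  have h1 : Real.log (Nat.lcmUpto (8 * n + 3) : ℝ) =
      ∑ p ∈ savedPrimes n, Real.log p + Real.log (reducedLcm n) := by
    rw [lcmUpto_eq_mul_reducedLcm, Nat.cast_mul, Nat.cast_prod, Real.log_mul, Real.log_prod]
    · exact fun p hp ↦ by exact_mod_cast (prime_of_mem_savedPrimes hp).ne_zero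
    · refine Finset.prod_ne_zero_iff.mpr fun p hp ↦ ?_
      exact_mod_cast (prime_of_mem_savedPrimes hp).ne_zero
    · exact_mod_cast (reducedLcm_pos n).ne'
  have h2 := Chebyshev.psi_eq_log_lcmUpto (8 * n + 3)
  push_cast at h2
  rw [h2, h1, clearFactor, Real.log_div, Real.log_mul, Real.log_pow]
  · push_cast; ring
  · norm_num
  · exact_mod_cast (reducedLcm_pos n).ne'
  · exact mul_ne_zero (by norm_num) (by exact_mod_cast (reducedLcm_pos n).ne')
  · positivity

theorem eventually_log_clearFactor_le :
    ∀ᶠ n : ℕ in atTop, Real.log (clearFactor n) ≤ 3.2437128819 * n := by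
  have ht : Tendsto (fun n : ℕ ↦ (8 * n + 3 : ℝ)) atTop atTop :=
    tendsto_atTop_add_const_right _ _ (tendsto_natCast_atTop_atTop.const_mul_atTop (by norm_num))
  have h1 := (tendsto_psi_div.comp ht).eventually_le_const (by norm_num : (1 : ℝ) < 1 + 1e-12)
  filter_upwards [h1, eventually_le_sum_log_savedPrimes,
    eventually_const_le_mul (Real.log 20 + 4) (by norm_num : (0 : ℝ) < 1e-10)] with n h1 h2 h3
  have hpos : (0 : ℝ) < 8 * n + 3 := by positivity
  simp only [Function.comp_apply] at h1
  rw [div_le_iff₀ hpos] at h1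
  rw [log_clearFactor]
  have h4 := mul_le_mul_of_nonneg_left Real.log_two_gt_d9.le (Nat.cast_nonneg (α := ℝ) n)
  linarith

theorem log_lineInt_bound : 2 * Real.log (294584961 / 10000000000) ≤ -7.0495458336 := by
  have h := Real.abs_log_sub_add_sum_range_le (x := 1 - 294584961 / 10000000000 * 2 ^ 5)
    (by rw [abs_of_nonneg] <;> norm_num) 8
  rw [abs_of_nonneg (a := 1 - 294584961 / 10000000000 * 2 ^ 5) (by norm_num), sub_sub_cancel,
    Real.log_mul (by norm_num) (by norm_num), Real.log_pow] at h
  have h1 := (abs_le.mp h).2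
  norm_num [Finset.sum_range_succ] at h1
  linarith [Real.log_two_gt_d9]

theorem log_halfRes_bound : 2 * Real.log (109258457 / 5000) ≤ 19.9840672213 := by
  have h := Real.abs_log_sub_add_sum_range_le (x := 1 - (109258457 / 5000) ^ 12 / 2 ^ 173)
    (by rw [abs_of_nonneg] <;> norm_num) 5
  rw [abs_of_nonneg (a := 1 - (109258457 / 5000) ^ 12 / 2 ^ 173) (by norm_num), sub_sub_cancel,
    Real.log_div (by norm_num) (by norm_num), Real.log_pow, Real.log_pow] at h
  have h1 := (abs_le.mp h).2
  norm_num [Finset.sum_range_succ] at h1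
  linarith [Real.log_two_lt_d9]

theorem eventually_clearFactor_mul_le {C F σ τ : ℝ} (hC : 0 < C) (hF : 0 < F)
    (hσ : 2 * Real.log F ≤ σ) (h : 3.2437128819 + σ < τ) :
    ∀ᶠ n : ℕ in atTop, clearFactor n * (C * F ^ (2 * n)) ≤ Real.exp (τ * n) := by
  filter_upwards [eventually_log_clearFactor_le,
    eventually_const_le_mul (Real.log C) (sub_pos.mpr h)] with n h1 h2
  have h0 := clearFactor_pos n
  rw [← Real.log_le_iff_le_exp (by positivity), Real.log_mul h0.ne' (by positivity),
    Real.log_mul hC.ne' (by positivity), Real.log_pow]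
  have h3 := mul_le_mul_of_nonneg_right hσ (Nat.cast_nonneg (α := ℝ) n)
  push_cast
  linarith

theorem eventually_lower_bound : ∀ᶠ n : ℕ in atTop, ∀ p q : ℤ, 1 ≤ q →
    2 ≤ q * Real.exp (-3.80583295 * n) +
      q * |Real.pi - p / q| * Real.exp (23.227780105 * n) := by
  filter_upwards [eventually_clearFactor_mul_le (C := 400000) (τ := -3.80583295) (by norm_num)
    (by norm_num) log_lineInt_bound (by norm_num), eventually_clearFactor_mul_le (C := 40000)
      (τ := 23.227780105) (by norm_num) (by norm_num) log_halfRes_bound (by norm_num)]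
    with n h1 h2 p q hq
  have hq0 : (0 : ℝ) < q := by exact_mod_cast hq
  have h3 := one_le_clearFactor_mul n (p := p) hq
  have h4 := mul_le_mul_of_nonneg_left h1 hq0.le
  have h5 := mul_le_mul_of_nonneg_left h2 (mul_nonneg hq0.le (abs_nonneg (Real.pi - p / q)))
  linarith

theorem exists_den_le {μ : ℝ} (hμ : 7.1032054 ≤ μ) : ∃ B : ℝ, ∀ p q : ℤ, 1 ≤ q →
    |Real.pi - p / q| < 1 / (q : ℝ) ^ μ → q ≤ B := by
  obtain ⟨N, hN⟩ := eventually_atTop.mp eventually_lower_bound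
  refine ⟨max (Real.exp (3.80583295 * N)) (Real.exp (24000000000)), fun p q hq h ↦ ?_⟩
  by_contra! hlt
  have hq0 : (0 : ℝ) < q := by exact_mod_cast hq
  obtain ⟨hl1, hl2⟩ := max_lt_iff.mp hlt
  rw [← Real.lt_log_iff_exp_lt hq0] at hl1 hl2
  set ℓ := Real.log q with hℓ
  have hqe : (q : ℝ) = Real.exp ℓ := (Real.exp_log hq0).symm
  obtain ⟨n, hn⟩ : ∃ n, n = ⌈ℓ / 3.80583295⌉₊ := ⟨_, rfl⟩
  have hℓ0 : 0 ≤ ℓ := by linarith [show (0 : ℝ) ≤ 24000000000 by norm_num]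
  have hn1 : ℓ ≤ 3.80583295 * n := by
    rw [hn, mul_comm]
    exact (div_le_iff₀ (by norm_num)).mp (Nat.le_ceil _)
  have hn2 : 3.80583295 * (n : ℝ) < ℓ + 3.80583295 := by
    have : (n : ℝ) < ℓ / 3.80583295 + 1 := by
      rw [hn]
      exact Nat.ceil_lt_add_one (by positivity)
    calc 3.80583295 * (n : ℝ) < 3.80583295 * (ℓ / 3.80583295 + 1) := by gcongr
      _ = ℓ + 3.80583295 := by field_simp
  have hNn : N ≤ n := by
    have : (N : ℝ) < n := by linarith
    exact_mod_cast this.le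
  have h1 := hN n hNn p q hq
  have h2 : q * Real.exp (-3.80583295 * n) ≤ 1 := by
    rw [hqe, ← Real.exp_add, Real.exp_le_one_iff]
    linarith
  have h3 : q * |Real.pi - p / q| * Real.exp (23.227780105 * n) < 1 := by
    have e1 : (1 : ℝ) / (q : ℝ) ^ μ = Real.exp (-(μ * ℓ)) := by
      rw [one_div, Real.rpow_def_of_pos hq0, ← Real.exp_neg, mul_comm]
    rw [e1] at h
    calc q * |Real.pi - p / q| * Real.exp (23.227780105 * n)
        < q * Real.exp (-(μ * ℓ)) * Real.exp (23.227780105 * n) := by gcongr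
      _ = Real.exp (ℓ + -(μ * ℓ) + 23.227780105 * n) := by
        rw [Real.exp_add, Real.exp_add, ← hqe]
      _ ≤ 1 := by
        rw [Real.exp_le_one_iff]
        have := mul_le_mul_of_nonneg_right hμ hℓ0
        linarith
  linarith

end Asymptotics

/-- **The irrationality measure of π is at most 7.103205334137… < 7.1032054.**
For every real `μ ≥ 7.1032054` there are only finitely many pairs of integers `(p, q)` with
`q ≥ 1` and `|π - p/q| < 1/q^μ`. -/
theorem irrationality_measure_pi_le (μ : ℝ) (hμ : 7.1032054 ≤ μ) :
    {pq : ℤ × ℤ | 1 ≤ pq.2 ∧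
      |Real.pi - (pq.1 : ℝ) / (pq.2 : ℝ)| < 1 / (pq.2 : ℝ) ^ μ}.Finite := by
  obtain ⟨B, hB⟩ := exists_den_le hμ
  refine ((Set.finite_Icc (-⌈5 * B⌉) ⌈5 * B⌉).prod (Set.finite_Icc 1 ⌈B⌉)).subset ?_
  rintro ⟨p, q⟩ ⟨hq, h⟩
  simp only at hq h
  have hqB := hB p q hq h
  have hq1 : (1 : ℝ) ≤ q := by exact_mod_cast hq
  have hq0 : (0 : ℝ) < q := by linarith
  have h1 : |Real.pi - p / q| < 1 := h.trans_le <| by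
    rw [div_le_one (by positivity)]
    exact Real.one_le_rpow hq1 (by linarith)
  have h2 : |(p : ℝ) / q| ≤ 5 := by
    rw [abs_le]
    constructor <;> linarith [abs_lt.mp h1, Real.pi_gt_three, Real.pi_lt_four]
  rw [abs_div, abs_of_pos hq0, div_le_iff₀ hq0] at h2
  have h3 := abs_le.mp (h2.trans ((mul_le_mul_of_nonneg_left hqB (by norm_num)).trans
    (Int.le_ceil (5 * B))))
  refine ⟨⟨?_, ?_⟩, hq, ?_⟩
  · exact_mod_cast h3.1
  · exact_mod_cast h3.2
  · exact_mod_cast hqB.trans (Int.le_ceil B)
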